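/- (sl_n q-Euler transformation, Corollary 8.3 of the paper) Fix a composition v ∈ ℕ^n and nonzero a, b, c ∈ ℂ with (c)_u ≠ 0 for every composition u and (b)_v ≠ 0. Then there exists ε > 0 such that for all x ∈ ℂ^n with max_i |x_i| < ε both families below (indexed by all compositions u ∈ ℕ^n) are absolutely summable and Σ_u ((a)_u/(c)_u) ⟦u, v⟧(b, c) 𝖤_u(x) = ((a)_v/(b)_v) · (∏_{i=1}^n (a x_i; q)_∞/(b x_i; q)_∞) · Σ_u ((b)_u/(c)_u) ⟦u, v⟧(a, c) 𝖤_u(x). -/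

import Mathlib

open scoped BigOperators
open MvPolynomial

noncomputable section
namespace LRW

variable {n : ℕ}

/-- `|u|`, the weight of a composition `u ∈ ℕⁿ`. -/
def wt (u : Fin n → ℕ) : ℕ := ∑ i, u i

/-- `l'_u(i) = #{k > i : u_k > u_i} + #{k < i : u_k ≥ u_i}`. -/
def lp (u : Fin n → ℕ) (i : Fin n) : ℕ :=
  (Finset.univ.filter fun k => i < k ∧ u i < u k).card +
  (Finset.univ.filter fun k => k < i ∧ u i ≤ u k).card

/-- The spectral vector `⟨u⟩ : ⟨u⟩_i = q^{u_i} t^{n−1−l'_u(i)}`. -/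
def spec (q t : ℂ) (u : Fin n → ℕ) : Fin n → ℂ :=
  fun i => q ^ u i * t ^ (n - 1 - lp u i)

/-- Leg length `l(s)` of the cell `s = (i, j+1)` of `u` (so `j` ranges over
`0, …, u_i − 1`): `l(s) = #{k > i : j+1 ≤ u_k ≤ u_i} + #{k < i : j+1 ≤ u_k + 1 ≤ u_i}`. -/
def leg (u : Fin n → ℕ) (i : Fin n) (j : ℕ) : ℕ :=
  (Finset.univ.filter fun k => i < k ∧ j < u k ∧ u k ≤ u i).card +
  (Finset.univ.filter fun k => k < i ∧ j ≤ u k ∧ u k < u i).card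

/-- `n(u) = Σ_{s ∈ u} l(s)`. -/
def nstat (u : Fin n → ℕ) : ℕ := ∑ i, ∑ j ∈ Finset.range (u i), leg u i j

/-- `n'(u) = Σ_i C(u_i, 2)`. -/
def nstat' (u : Fin n → ℕ) : ℕ := ∑ i, Nat.choose (u i) 2

/-- `n(u⁺) = Σ_{i<j} min(u_i, u_j)`, the statistic `n` of the decreasing
rearrangement of `u`. -/
def nplus (u : Fin n → ℕ) : ℕ := ∑ i, ∑ j, if i < j then min (u i) (u j) else 0

/-- `τ_u = (−1)^{|u|} q^{n'(u)} t^{−n(u⁺)}`. -/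
def tau (q t : ℂ) (u : Fin n → ℕ) : ℂ := (-1) ^ wt u * q ^ nstat' u / t ^ nplus u

/-- The generalized q-shifted factorial `(z)_u = ∏_{s ∈ u} (1 − z q^{a'(s)} t^{−l'(s)})`. -/
def qfac (q t z : ℂ) (u : Fin n → ℕ) : ℂ :=
  ∏ i, ∏ j ∈ Finset.range (u i), (1 - z * q ^ j / t ^ lp u i)

/-- `c'_u = ∏_{s ∈ u} (1 − q^{a(s)+1} t^{l(s)})`. -/
def cp (q t : ℂ) (u : Fin n → ℕ) : ℂ :=
  ∏ i, ∏ j ∈ Finset.range (u i), (1 - q ^ (u i - j) * t ^ leg u i j)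

/-- `M` is a family of interpolation Macdonald polynomials: `M u` has total degree
at most `|u|`, the coefficient of `x^u` in `M u` is `q^{−n'(u)}`, and `M u`
vanishes at `⟨v⟩` for every `v` with `|v| ≤ |u|`, `v ≠ u`. -/
def IsInterpFamily (q t : ℂ) (M : (Fin n → ℕ) → MvPolynomial (Fin n) ℂ) : Prop :=
  ∀ u, (M u).totalDegree ≤ wt u ∧
    coeff (Finsupp.equivFunOnFinite.symm u) (M u) = (q ^ nstat' u)⁻¹ ∧
    ∀ v, wt v ≤ wt u → v ≠ u → eval (spec q t v) (M u) = 0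

/-- `𝖬_u = q^{n'(u)} t^{n(u)} M_u / c'_u`. -/
def MM (q t : ℂ) (M : (Fin n → ℕ) → MvPolynomial (Fin n) ℂ) (u : Fin n → ℕ) :
    MvPolynomial (Fin n) ℂ :=
  C (q ^ nstat' u * t ^ nstat u / cp q t u) * M u

/-- `𝖤_u = t^{n(u)} E_u / c'_u`, where `E_u` is the homogeneous component of
degree `|u|` of `M_u`. -/
def EE (q t : ℂ) (M : (Fin n → ℕ) → MvPolynomial (Fin n) ℂ) (u : Fin n → ℕ) :
    MvPolynomial (Fin n) ℂ :=
  C (t ^ nstat u / cp q t u) * homogeneousComponent (wt u) (M u)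

/-- The generalized q-binomial coefficient `[u; v] = 𝖬_v(⟨u⟩)/𝖬_v(⟨v⟩)`. -/
def qbin (q t : ℂ) (M : (Fin n → ℕ) → MvPolynomial (Fin n) ℂ) (u v : Fin n → ℕ) : ℂ :=
  eval (spec q t u) (MM q t M v) / eval (spec q t v) (MM q t M v)

/-- `⟨0⟩/a = (t^{n−1}/a, …, t/a, 1/a)`. -/
def spec0div (q t a : ℂ) : Fin n → ℂ := fun i => spec q t (fun _ => 0) i / a

/-- `cc` is the family of connection coefficients `c_{uv}(a,b)`:
`cc u v = 0` unless `|v| ≤ |u|`, and `𝖬_u(a·x) = Σ_v cc u v · 𝖬_v(b·x)`. -/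
def IsConnection (q t : ℂ) (M : (Fin n → ℕ) → MvPolynomial (Fin n) ℂ) (a b : ℂ)
    (cc : (Fin n → ℕ) → (Fin n → ℕ) → ℂ) : Prop :=
  (∀ u v, wt u < wt v → cc u v = 0) ∧
  ∀ u, aeval (fun i => C a * X i) (MM q t M u) =
    ∑ᶠ v, cc u v • aeval (fun i => C b * X i) (MM q t M v)

/-- `⟦u, v⟧(a, b) = (𝖤_v(⟨0⟩/a)/𝖤_u(⟨0⟩/b)) · c_{uv}(a, b)`. -/
def skew (q t : ℂ) (M : (Fin n → ℕ) → MvPolynomial (Fin n) ℂ) (a b : ℂ)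
    (cc : (Fin n → ℕ) → (Fin n → ℕ) → ℂ) (u v : Fin n → ℕ) : ℂ :=
  eval (spec0div q t a) (EE q t M v) / eval (spec0div q t b) (EE q t M u) * cc u v

/-- `(z; q)_∞ = ∏_{m ≥ 0} (1 − z q^m)`. -/
noncomputable def qpochInf (z q : ℂ) : ℂ := ∏' m : ℕ, (1 - z * q ^ m)

/-- The genericity assumptions on the parameters `q` and `t`. -/
structure Params (q t : ℂ) : Prop where
  q_ne : q ≠ 0
  q_lt : ‖q‖ < 1
  t_ne : t ≠ 0
  gen : ∀ i j : ℤ, ¬(i = 0 ∧ j = 0) → q ^ i * t ^ j ≠ 1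

lemma Params.eq_of_monomial_eq {q t : ℂ} (P : Params q t) {a b c d : ℕ}
    (h : q ^ a * t ^ b = q ^ c * t ^ d) : a = c ∧ b = d := by
  by_contra hne
  refine P.gen ((a : ℤ) - c) ((b : ℤ) - d) (fun h0 => hne ⟨by omega, by omega⟩) ?_
  have hq := P.q_ne
  have ht := P.t_ne
  rw [zpow_sub₀ hq, zpow_sub₀ ht]
  simp only [zpow_natCast]
  rw [div_mul_div_comm, h]
  exact div_self (mul_ne_zero (pow_ne_zero _ hq) (pow_ne_zero _ ht))

lemma Params.monomial_ne_one {q t : ℂ} (P : Params q t) {a b : ℕ} (ha : a ≠ 0) :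
    q ^ a * t ^ b ≠ 1 := by
  intro h
  have := P.eq_of_monomial_eq (a := a) (b := b) (c := 0) (d := 0) (by simpa using h)
  exact ha this.1

lemma lp_eq_sum (u : Fin n → ℕ) (i : Fin n) :
    lp u i = ∑ k, if u i < u k ∨ (u k = u i ∧ k < i) then 1 else 0 := by
  unfold lp
  rw [Finset.card_filter, Finset.card_filter, ← Finset.sum_add_distrib]
  refine Finset.sum_congr rfl fun k _ => ?_
  rcases lt_trichotomy k i with h | h | h
  · have h' : ¬ i < k := not_lt.mpr h.le
    by_cases h1 : u i < u k
    · simp [h, h', h1, h1.le]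
    · by_cases h2 : u k = u i
      · simp [h, h', h2]
      · have : ¬ u i ≤ u k := by omega
        simp [h', h1, h2, this]
  · subst h; simp
  · have h' : ¬ k < i := not_lt.mpr h.le
    by_cases h1 : u i < u k <;> simp [h, h', h1]

/-- The number of indices ranked strictly below `i` in the composition `u`. -/
def mp (u : Fin n → ℕ) (i : Fin n) : ℕ :=
  ∑ k, if u k < u i ∨ (u k = u i ∧ i < k) then 1 else 0

lemma lp_add_mp (u : Fin n → ℕ) (i : Fin n) : lp u i + mp u i + 1 = n := by
  rw [lp_eq_sum, mp, ← Finset.sum_add_distrib]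
  have h1 : (1 : ℕ) = ∑ k : Fin n, if k = i then 1 else 0 := by simp
  rw [h1, ← Finset.sum_add_distrib]
  trans ∑ _k : Fin n, 1
  · refine Finset.sum_congr rfl fun k _ => ?_
    rcases lt_trichotomy k i with h | h | h
    · have h' : ¬ i < k := not_lt.mpr h.le
      have h'' : k ≠ i := h.ne
      rcases lt_trichotomy (u k) (u i) with g | g | g
      · simp [h', h'', g, g.ne, not_lt.mpr g.le]
      · simp [h, h', h'', g]
      · simp [h', h'', g, g.ne', not_lt.mpr g.le]
    · subst h; simp
    · have h' : ¬ k < i := not_lt.mpr h.le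
      have h'' : k ≠ i := h.ne'
      rcases lt_trichotomy (u k) (u i) with g | g | g
      · simp [h', h'', g, g.ne, not_lt.mpr g.le]
      · simp [h, h', h'', g]
      · simp [h', h'', g, g.ne', not_lt.mpr g.le]
  · simp

lemma spec_eq (q t : ℂ) (u : Fin n → ℕ) (i : Fin n) :
    spec q t u i = q ^ u i * t ^ mp u i := by
  have := lp_add_mp u i
  rw [spec, show n - 1 - lp u i = mp u i by omega]

lemma spec_ne_zero {q t : ℂ} (P : Params q t) (u : Fin n → ℕ) (i : Fin n) :
    spec q t u i ≠ 0 :=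
  mul_ne_zero (pow_ne_zero _ P.q_ne) (pow_ne_zero _ P.t_ne)

/-- The affine rotation `(u₀, …, u_m) ↦ (u₁, …, u_m, u₀ + 1)` of compositions. -/
def Phi {m : ℕ} (u : Fin (m + 1) → ℕ) : Fin (m + 1) → ℕ :=
  Fin.snoc (fun i => u i.succ) (u 0 + 1)

section
variable {m : ℕ} (u : Fin (m + 1) → ℕ)

@[simp] lemma Phi_castSucc (i : Fin m) : Phi u i.castSucc = u i.succ := by simp [Phi]

@[simp] lemma Phi_last : Phi u (Fin.last m) = u 0 + 1 := by simp [Phi]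

lemma wt_Phi : wt (Phi u) = wt u + 1 := by
  unfold wt
  rw [Fin.sum_univ_castSucc, Fin.sum_univ_succ]
  simp only [Phi_castSucc, Phi_last]
  ring

lemma Phi_injective : Function.Injective (Phi (m := m)) := by
  intro u v h
  funext i
  refine Fin.cases ?_ (fun i => ?_) i
  · have := congrFun h (Fin.last m)
    simpa using this
  · have := congrFun h i.castSucc
    simpa using this

lemma exists_Phi (h : u (Fin.last m) ≠ 0) : ∃ w, Phi w = u := by
  refine ⟨Fin.cons (u (Fin.last m) - 1) (fun i => u i.castSucc), ?_⟩
  funext i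
  refine Fin.lastCases ?_ (fun i => ?_) i
  · simp; omega
  · simp

lemma mp_Phi_last : mp (Phi u) (Fin.last m) = mp u 0 := by
  unfold mp
  rw [Fin.sum_univ_castSucc, Fin.sum_univ_succ]
  simp only [Phi_castSucc, Phi_last]
  simp only [lt_irrefl, and_false, or_false, if_false, add_zero, zero_add]
  refine Finset.sum_congr rfl fun k _ => ?_
  have : ¬ Fin.last m < k.castSucc := not_lt.mpr (Fin.le_last _)
  simp only [this, Fin.succ_pos, and_false, or_false, and_true]
  congr 1
  simp only [eq_iff_iff]; omega

lemma mp_Phi_castSucc (i : Fin m) : mp (Phi u) i.castSucc = mp u i.succ := by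
  unfold mp
  rw [Fin.sum_univ_castSucc, Fin.sum_univ_succ, add_comm]
  simp only [Phi_castSucc, Phi_last, Fin.castSucc_lt_castSucc_iff, Fin.succ_lt_succ_iff,
    Fin.castSucc_lt_last, Fin.not_lt_zero, and_true, and_false, or_false]
  congr 1
  congr 1
  simp only [eq_iff_iff]; omega

lemma lp_Phi_last : lp (Phi u) (Fin.last m) = lp u 0 := by
  have h1 := lp_add_mp (Phi u) (Fin.last m)
  have h2 := lp_add_mp u 0
  rw [mp_Phi_last] at h1
  omega

lemma lp_Phi_castSucc (i : Fin m) : lp (Phi u) i.castSucc = lp u i.succ := by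
  have h1 := lp_add_mp (Phi u) i.castSucc
  have h2 := lp_add_mp u i.succ
  rw [mp_Phi_castSucc] at h1
  omega

lemma spec_Phi_last (q t : ℂ) : spec q t (Phi u) (Fin.last m) = q * spec q t u 0 := by
  rw [spec_eq, spec_eq, mp_Phi_last, Phi_last]; ring

lemma spec_Phi_castSucc (q t : ℂ) (i : Fin m) :
    spec q t (Phi u) i.castSucc = spec q t u i.succ := by
  rw [spec_eq, spec_eq, mp_Phi_castSucc, Phi_castSucc]

lemma one_sub_q_spec_ne {q t : ℂ} (P : Params q t) : 1 - q * spec q t u 0 ≠ 0 := by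
  rw [spec_eq, ← mul_assoc, ← pow_succ']
  exact sub_ne_zero.mpr (P.monomial_ne_one (Nat.succ_ne_zero _)).symm

lemma nstat'_Phi : nstat' (Phi u) = nstat' u + u 0 := by
  unfold nstat'
  rw [Fin.sum_univ_castSucc, Fin.sum_univ_succ]
  simp only [Phi_castSucc, Phi_last, Nat.choose_succ_succ' (u 0) 1, Nat.choose_one_right]
  ring

lemma qfac_Phi (q t z : ℂ) :
    qfac q t z (Phi u) = qfac q t z u * (1 - z * q ^ u 0 / t ^ lp u 0) := by
  unfold qfac
  rw [Fin.prod_univ_castSucc, Fin.prod_univ_succ]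
  simp only [Phi_castSucc, Phi_last, lp_Phi_last, lp_Phi_castSucc, Finset.prod_range_succ]
  ring

lemma leg_eq_sum (u : Fin n → ℕ) (i : Fin n) (j : ℕ) :
    leg u i j = ∑ k, if (i < k ∧ j < u k ∧ u k ≤ u i) ∨ (k < i ∧ j ≤ u k ∧ u k < u i)
      then 1 else 0 := by
  unfold leg
  rw [Finset.card_filter, Finset.card_filter, ← Finset.sum_add_distrib]
  refine Finset.sum_congr rfl fun k _ => ?_
  rcases lt_trichotomy k i with h | h | h
  · simp [h, not_lt.mpr h.le]
  · subst h; simp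
  · simp [h, not_lt.mpr h.le]

lemma leg_Phi_castSucc (i : Fin m) (j : ℕ) : leg (Phi u) i.castSucc j = leg u i.succ j := by
  rw [leg_eq_sum, leg_eq_sum, Fin.sum_univ_castSucc, Fin.sum_univ_succ, add_comm]
  simp only [Phi_castSucc, Phi_last, Fin.castSucc_lt_castSucc_iff, Fin.succ_lt_succ_iff,
    Fin.castSucc_lt_last, Fin.not_lt_zero, Fin.succ_pos, true_and, false_and, false_or]
  congr 1
  have : ¬ Fin.last m < i.castSucc := not_lt.mpr (Fin.le_last _)
  simp only [this, false_and, or_false]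
  congr 1
  simp only [eq_iff_iff]; omega

lemma leg_Phi_last_succ (j : ℕ) : leg (Phi u) (Fin.last m) (j + 1) = leg u 0 j := by
  rw [leg_eq_sum, leg_eq_sum, Fin.sum_univ_castSucc, Fin.sum_univ_succ]
  simp only [Phi_castSucc, Phi_last, Fin.succ_pos, Fin.castSucc_lt_last, lt_irrefl, Fin.not_lt_zero,
    false_and, or_false, if_false, add_zero, zero_add, true_and]
  refine Finset.sum_congr rfl fun k _ => ?_
  have : ¬ Fin.last m < k.castSucc := not_lt.mpr (Fin.le_last _)
  simp only [this, false_and, false_or]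
  congr 1
  simp only [eq_iff_iff]; omega

lemma leg_Phi_last_zero : leg (Phi u) (Fin.last m) 0 = mp u 0 := by
  rw [← mp_Phi_last, leg_eq_sum, mp]
  refine Finset.sum_congr rfl fun k _ => ?_
  have : ¬ Fin.last m < k := not_lt.mpr (Fin.le_last _)
  simp only [this, false_and, false_or, and_false, or_false, zero_le, true_and]
  congr 1
  simp only [eq_iff_iff, and_iff_right_iff_imp]
  intro h
  exact lt_of_le_of_ne (Fin.le_last _) (by rintro rfl; exact lt_irrefl _ h)

lemma nstat_Phi : nstat (Phi u) = nstat u + mp u 0 := by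
  unfold nstat
  rw [Fin.sum_univ_castSucc, Fin.sum_univ_succ]
  simp only [Phi_castSucc, Phi_last, Finset.sum_range_succ', leg_Phi_castSucc, leg_Phi_last_succ,
    leg_Phi_last_zero]
  ring

lemma cp_Phi (q t : ℂ) : cp q t (Phi u) = cp q t u * (1 - q * spec q t u 0) := by
  unfold cp
  rw [Fin.prod_univ_castSucc, Fin.prod_univ_succ]
  simp only [Phi_castSucc, Phi_last, Finset.prod_range_succ', leg_Phi_castSucc, leg_Phi_last_succ,
    leg_Phi_last_zero, Nat.add_sub_add_right, Nat.sub_zero]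
  rw [spec_eq]
  ring

/-- The transposition of the neighbouring indices `i` and `i + 1`. -/
def sw (i : Fin m) : Equiv.Perm (Fin (m + 1)) := Equiv.swap i.castSucc i.succ

@[simp] lemma sw_castSucc (i : Fin m) : sw i i.castSucc = i.succ := Equiv.swap_apply_left _ _

@[simp] lemma sw_succ (i : Fin m) : sw i i.succ = i.castSucc := Equiv.swap_apply_right _ _

lemma sw_of_ne (i : Fin m) {j : Fin (m + 1)} (h1 : j ≠ i.castSucc) (h2 : j ≠ i.succ) :
    sw i j = j := Equiv.swap_apply_of_ne_of_ne h1 h2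

@[simp] lemma sw_sw (i : Fin m) (j : Fin (m + 1)) : sw i (sw i j) = j := Equiv.swap_apply_self _ _ _

lemma sw_lt_sw (i : Fin m) (j k : Fin (m + 1))
    (h : ¬ (j = i.castSucc ∧ k = i.succ)) (h' : ¬ (j = i.succ ∧ k = i.castSucc)) :
    sw i j < sw i k ↔ j < k := by
  by_cases j1 : j = i.castSucc
  · subst j1
    by_cases k1 : k = i.castSucc
    · subst k1; simp
    · have k2 : k ≠ i.succ := fun hk => h ⟨rfl, hk⟩
      rw [sw_castSucc, sw_of_ne i k1 k2]
      simp only [Fin.lt_def, Fin.ext_iff, Fin.val_succ, Fin.val_castSucc, ne_eq] at *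
      omega
  · by_cases j2 : j = i.succ
    · subst j2
      by_cases k2 : k = i.succ
      · subst k2; simp
      · have k1 : k ≠ i.castSucc := fun hk => h' ⟨rfl, hk⟩
        rw [sw_succ, sw_of_ne i k1 k2]
        simp only [Fin.lt_def, Fin.ext_iff, Fin.val_succ, Fin.val_castSucc, ne_eq] at *
        omega
    · rw [sw_of_ne i j1 j2]
      by_cases k1 : k = i.castSucc
      · subst k1
        rw [sw_castSucc]
        simp only [Fin.lt_def, Fin.ext_iff, Fin.val_succ, Fin.val_castSucc] at *
        omega
      · by_cases k2 : k = i.succ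
        · subst k2
          rw [sw_succ]
          simp only [Fin.lt_def, Fin.ext_iff, Fin.val_succ, Fin.val_castSucc] at *
          omega
        · rw [sw_of_ne i k1 k2]

lemma comp_sw_of_eq {i : Fin m} (h : u i.castSucc = u i.succ) : u ∘ sw i = u := by
  funext j
  simp only [Function.comp]
  by_cases j1 : j = i.castSucc
  · subst j1; simp [h]
  · by_cases j2 : j = i.succ
    · subst j2; simp [h]
    · rw [sw_of_ne i j1 j2]

lemma comp_sw_sw (i : Fin m) {α : Type*} (f : Fin (m + 1) → α) : (f ∘ sw i) ∘ sw i = f := by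
  funext j; simp

lemma wt_comp_sw (i : Fin m) : wt (u ∘ sw i) = wt u := by
  unfold wt
  exact Equiv.sum_comp (sw i) u

lemma nstat'_comp_sw (i : Fin m) : nstat' (u ∘ sw i) = nstat' u := by
  unfold nstat'
  exact Equiv.sum_comp (sw i) fun j => Nat.choose (u j) 2

lemma mp_comp_sw {i : Fin m} (h : u i.castSucc ≠ u i.succ) (j : Fin (m + 1)) :
    mp (u ∘ sw i) j = mp u (sw i j) := by
  unfold mp
  rw [← Equiv.sum_comp (sw i)]
  refine Finset.sum_congr rfl fun k _ => ?_
  simp only [Function.comp, sw_sw]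
  congr 1
  simp only [eq_iff_iff]
  apply or_congr Iff.rfl
  apply and_congr_right
  intro hk
  conv_rhs => rw [show k = sw i (sw i k) by simp]
  refine (sw_lt_sw i _ _ ?_ ?_).symm
  · rintro ⟨rfl, h2⟩
    rw [show k = i.castSucc by rw [← sw_sw i k, h2]; simp] at hk
    exact h (by simpa using hk)
  · rintro ⟨rfl, h2⟩
    rw [show k = i.succ by rw [← sw_sw i k, h2]; simp] at hk
    exact h (by simpa using hk.symm)

lemma mp_of_eq {i : Fin m} (h : u i.castSucc = u i.succ) :
    mp u i.castSucc = mp u i.succ + 1 := by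
  have h1 : ∑ k : Fin (m + 1), (if k = i.succ then 1 else 0) = 1 := by simp
  refine Eq.trans ?_ (congrArg (mp u i.succ + ·) h1)
  simp only [mp]
  rw [← Finset.sum_add_distrib]
  refine Finset.sum_congr rfl fun k _ => ?_
  by_cases hk : k = i.succ
  · subst hk
    simp [h]
  · rw [if_neg hk, add_zero, h]
    congr 1
    simp only [eq_iff_iff]
    apply or_congr Iff.rfl
    apply and_congr_right
    intro _
    simp only [Fin.lt_def, Fin.ext_iff, Fin.val_succ, Fin.val_castSucc] at *
    omega

lemma spec_comp_sw {i : Fin m} (q t : ℂ) (h : u i.castSucc ≠ u i.succ) :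
    spec q t (u ∘ sw i) = spec q t u ∘ sw i := by
  funext j
  simp only [Function.comp, spec_eq]
  rw [← mp_comp_sw u h]

lemma spec_of_eq {i : Fin m} (q t : ℂ) (h : u i.castSucc = u i.succ) :
    spec q t u i.castSucc = t * spec q t u i.succ := by
  rw [spec_eq, spec_eq, mp_of_eq u h, h]; ring

lemma spec_adj_ne {q t : ℂ} (P : Params q t) (i : Fin m) :
    spec q t u i.castSucc ≠ spec q t u i.succ := by
  intro h
  rw [spec_eq, spec_eq] at h
  have h' := P.eq_of_monomial_eq h
  have := mp_of_eq u h'.1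
  omega

lemma spec_adj_ne_mul {q t : ℂ} (P : Params q t) {i : Fin m} (h : u i.castSucc ≠ u i.succ) :
    spec q t u i.castSucc ≠ t * spec q t u i.succ := by
  intro h'
  rw [spec_eq, spec_eq, mul_left_comm, ← pow_succ'] at h'
  exact h (P.eq_of_monomial_eq h').1

lemma lp_comp_sw {i : Fin m} (h : u i.castSucc ≠ u i.succ) (j : Fin (m + 1)) :
    lp (u ∘ sw i) j = lp u (sw i j) := by
  have h1 := lp_add_mp (u ∘ sw i) j
  have h2 := lp_add_mp u (sw i j)
  rw [mp_comp_sw u h] at h1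
  omega

lemma qfac_comp_sw (q t z : ℂ) (i : Fin m) : qfac q t z (u ∘ sw i) = qfac q t z u := by
  by_cases h : u i.castSucc = u i.succ
  · rw [comp_sw_of_eq u h]
  · unfold qfac
    rw [← Equiv.prod_comp (sw i) fun j => ∏ k ∈ Finset.range (u j), (1 - z * q ^ k / t ^ lp u j)]
    simp only [lp_comp_sw u h, Function.comp]

lemma mp_last_of_zero (h : u (Fin.last m) = 0) : mp u (Fin.last m) = 0 := by
  unfold mp
  refine Finset.sum_eq_zero fun k _ => ?_
  have : ¬ Fin.last m < k := not_lt.mpr (Fin.le_last _)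
  simp [h, this]

lemma spec_last_of_zero (q t : ℂ) (h : u (Fin.last m) = 0) : spec q t u (Fin.last m) = 1 := by
  rw [spec_eq, mp_last_of_zero u h, h]; simp

end

section
variable {m : ℕ} {u : Fin (m + 1) → ℕ} {p : Fin m}

lemma leg_comp_sw_of_lt {i : Fin (m + 1)}
    (hi : i < p.castSucc) (j : ℕ) : leg (u ∘ sw p) i j = leg u i j := by
  have hi1 : i ≠ p.castSucc := hi.ne
  have hi2 : i ≠ p.succ := (hi.trans Fin.castSucc_lt_succ).ne
  rw [leg_eq_sum, leg_eq_sum, ← Equiv.sum_comp (sw p)]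
  refine Finset.sum_congr rfl fun k _ => ?_
  simp only [Function.comp, sw_sw]
  have e1 : i < sw p k ↔ i < k := by
    conv_lhs => rw [← sw_of_ne p hi1 hi2]
    exact sw_lt_sw p i k (fun h => hi1 h.1) (fun h => hi2 h.1)
  have e2 : sw p k < i ↔ k < i := by
    conv_lhs => rw [← sw_of_ne p hi1 hi2]
    exact sw_lt_sw p k i (fun h => hi2 h.2) (fun h => hi1 h.2)
  simp only [e1, e2, sw_of_ne p hi1 hi2]

lemma leg_comp_sw_special (hp : u p.castSucc ≠ 0) (h0 : ∀ j, p.castSucc < j → u j = 0) (j : ℕ) :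
    leg (u ∘ sw p) p.succ j = leg u p.castSucc j + if j = 0 then 1 else 0 := by
  rw [leg_eq_sum, leg_eq_sum]
  have h1 : (if j = 0 then 1 else 0) =
      ∑ k : Fin (m + 1), if k = p.castSucc ∧ j = 0 then 1 else 0 := by
    by_cases hj : j = 0 <;> simp [hj]
  rw [h1, ← Finset.sum_add_distrib]
  have hz : u p.succ = 0 := h0 _ Fin.castSucc_lt_succ
  refine Finset.sum_congr rfl fun k _ => ?_
  simp only [Function.comp, sw_succ]
  by_cases k1 : k = p.castSucc
  · subst k1
    have hpos : 0 < u p.castSucc := Nat.pos_of_ne_zero hp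
    simp [hz, hpos, not_lt.mpr (Fin.castSucc_lt_succ (i := p)).le]
  · by_cases k2 : k = p.succ
    · subst k2
      simp [hz, not_lt.mpr (Fin.castSucc_lt_succ (i := p)).le,
        (Fin.castSucc_lt_succ (i := p)).ne']
    · rw [sw_of_ne p k1 k2]
      simp only [k1, false_and, if_false, add_zero]
      by_cases hlt : p.castSucc < k
      · have hz' := h0 k hlt
        have h3 : ¬ k < p.succ := by
          simp only [Fin.lt_def, Fin.ext_iff, Fin.val_succ, Fin.val_castSucc] at *
          omega
        simp [hz', h3, not_lt.mpr hlt.le]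
      · have h3 : k < p.succ ∧ k < p.castSucc ∧ ¬ p.succ < k ∧ ¬ p.castSucc < k := by
          simp only [Fin.lt_def, Fin.ext_iff, Fin.val_succ, Fin.val_castSucc] at *
          omega
        simp [h3.1, h3.2.1, h3.2.2.1, h3.2.2.2]

/-- The row-wise comparison of a function of the cells of `u` and of `u ∘ sw p`, when
`p` is the last nonzero position of `u`. -/
lemma prod_cells_comp_sw {A : Type*} [CommMonoid A] (hp : u p.castSucc ≠ 0)
    (h0 : ∀ j, p.castSucc < j → u j = 0) (F : ℕ → ℕ → ℕ → A) :
    (∏ i, ∏ j ∈ Finset.range ((u ∘ sw p) i), F ((u ∘ sw p) i) j (leg (u ∘ sw p) i j)) *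
      F (u p.castSucc) 0 (leg u p.castSucc 0) =
    (∏ i, ∏ j ∈ Finset.range (u i), F (u i) j (leg u i j)) *
      F (u p.castSucc) 0 (leg u p.castSucc 0 + 1) := by
  have hz : u p.succ = 0 := h0 _ Fin.castSucc_lt_succ
  have hpos : 0 < u p.castSucc := Nat.pos_of_ne_zero hp
  rw [← Equiv.prod_comp (sw p)]
  simp only [Function.comp, sw_sw]
  rw [← Finset.mul_prod_erase Finset.univ _ (Finset.mem_univ p.castSucc),
    ← Finset.mul_prod_erase Finset.univ (fun i => ∏ j ∈ Finset.range (u i), F (u i) j (leg u i j))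
      (Finset.mem_univ p.castSucc)]
  have hrest : ∏ x ∈ Finset.univ.erase p.castSucc,
      ∏ x_1 ∈ Finset.range (u x), F (u x) x_1 (leg (u ∘ sw p) (sw p x) x_1) =
      ∏ x ∈ Finset.univ.erase p.castSucc, ∏ j ∈ Finset.range (u x), F (u x) j (leg u x j) := by
    refine Finset.prod_congr rfl fun x hx => ?_
    have hx1 : x ≠ p.castSucc := Finset.ne_of_mem_erase hx
    by_cases hlt : x < p.castSucc
    · have hx2 : x ≠ p.succ := (hlt.trans Fin.castSucc_lt_succ).ne
      rw [sw_of_ne p hx1 hx2]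
      refine Finset.prod_congr rfl fun j _ => ?_
      rw [leg_comp_sw_of_lt hlt j]
    · have := h0 x (lt_of_le_of_ne (not_lt.mp hlt) (Ne.symm hx1))
      simp [this]
  rw [hrest, sw_castSucc]
  obtain ⟨k, hk⟩ : ∃ k, u p.castSucc = k + 1 := ⟨u p.castSucc - 1, by omega⟩
  simp only [leg_comp_sw_special hp h0, hk, Finset.prod_range_succ']
  simp only [if_true, Nat.succ_ne_zero, if_false, add_zero]
  ac_rfl

lemma nstat_comp_sw_special (hp : u p.castSucc ≠ 0) (h0 : ∀ j, p.castSucc < j → u j = 0) :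
    nstat (u ∘ sw p) = nstat u + 1 := by
  have h := prod_cells_comp_sw (A := Multiplicative ℕ) hp h0 fun _ _ l => Multiplicative.ofAdd l
  have h' := congrArg Multiplicative.toAdd h
  simp only [toAdd_mul, toAdd_prod, toAdd_ofAdd] at h'
  unfold nstat
  omega

lemma cp_comp_sw_special (q t : ℂ) (hp : u p.castSucc ≠ 0)
    (h0 : ∀ j, p.castSucc < j → u j = 0) :
    cp q t (u ∘ sw p) * (1 - q ^ u p.castSucc * t ^ leg u p.castSucc 0) =
      cp q t u * (1 - q ^ u p.castSucc * t ^ (leg u p.castSucc 0 + 1)) :=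
  prod_cells_comp_sw hp h0 fun k j l => 1 - q ^ (k - j) * t ^ l

lemma mp_special (hp : u p.castSucc ≠ 0) (h0 : ∀ j, p.castSucc < j → u j = 0) :
    mp u p.castSucc = mp u p.succ + (leg u p.castSucc 0 + 1) := by
  have hz : u p.succ = 0 := h0 _ Fin.castSucc_lt_succ
  have hpos : 0 < u p.castSucc := Nat.pos_of_ne_zero hp
  have h1 : ∑ k : Fin (m + 1), (if k = p.succ then 1 else 0) = 1 := by simp
  refine Eq.trans ?_ (congrArg (fun z => mp u p.succ + (leg u p.castSucc 0 + z)) h1)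
  simp only [leg_eq_sum, mp]
  rw [← Finset.sum_add_distrib, ← Finset.sum_add_distrib]
  refine Finset.sum_congr rfl fun k _ => ?_
  by_cases k2 : k = p.succ
  · subst k2
    simp [hz, hpos, not_lt.mpr (Fin.castSucc_lt_succ (i := p)).le]
  · by_cases hlt : p.castSucc < k
    · have hz' := h0 k hlt
      have h3 : p.succ < k := by
        simp only [Fin.lt_def, Fin.ext_iff, Fin.val_succ, Fin.val_castSucc] at *
        omega
      simp [hz', hz, h3, k2, hpos, not_lt.mpr hlt.le]
    · have h3 : ¬ p.succ < k := by
        simp only [Fin.lt_def, Fin.ext_iff, Fin.val_succ, Fin.val_castSucc] at *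
        omega
      by_cases k1 : k = p.castSucc
      · subst k1
        simp [k2, hz, h3]
      · have h4 : k < p.castSucc := lt_of_le_of_ne (not_lt.mp hlt) k1
        simp [k2, hz, h3, hlt, h4]

lemma spec_special (q t : ℂ) (hp : u p.castSucc ≠ 0) (h0 : ∀ j, p.castSucc < j → u j = 0) :
    spec q t u p.castSucc =
      q ^ u p.castSucc * t ^ (leg u p.castSucc 0 + 1) * spec q t u p.succ := by
  rw [spec_eq, spec_eq, mp_special hp h0, h0 p.succ Fin.castSucc_lt_succ]
  ring

end

lemma wt_zero : wt (0 : Fin n → ℕ) = 0 := by simp [wt]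

lemma wt_eq_zero_iff (u : Fin n → ℕ) : wt u = 0 ↔ u = 0 := by
  simp [wt, funext_iff]

/-- Induction along paths: from `0`, one reaches each composition by affine rotations and by
moving the last nonzero entry one step to the left. -/
lemma path_induction {m : ℕ} {Q : (Fin (m + 1) → ℕ) → Prop} (zero : Q 0)
    (phi : ∀ u, Q u → Q (Phi u))
    (special : ∀ (u : Fin (m + 1) → ℕ) (p : Fin m), u p.castSucc ≠ 0 →
      (∀ j, p.castSucc < j → u j = 0) → Q (u ∘ sw p) → Q u) (u : Fin (m + 1) → ℕ) : Q u := by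
  have key : ∀ N, ∀ u : Fin (m + 1) → ℕ, wt u = N → Q u := by
    intro N
    induction N with
    | zero => intro u hu; rw [(wt_eq_zero_iff u).1 hu]; exact zero
    | succ N ih =>
      have inner : ∀ r : Fin (m + 1), ∀ u : Fin (m + 1) → ℕ, wt u = N + 1 → u r ≠ 0 →
          (∀ j, r < j → u j = 0) → Q u := by
        intro r
        induction r using Fin.reverseInduction with
        | last =>
          intro u hu hr _
          obtain ⟨w, rfl⟩ := exists_Phi u hr
          rw [wt_Phi] at hu
          exact phi w (ih w (by omega))
        | cast p ihp =>
          intro u hu hr h0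
          refine special u p hr h0 (ihp (u ∘ sw p) (by rw [wt_comp_sw, hu]) (by simpa using hr) ?_)
          intro j hj
          have : p.castSucc < j := Fin.castSucc_lt_succ.trans hj
          simp only [Function.comp]
          rw [sw_of_ne p this.ne' hj.ne']
          exact h0 j this
      intro u hu
      have hne : (Finset.univ.filter fun r => u r ≠ 0).Nonempty := by
        by_contra hcon
        have h00 : u = 0 := by
          funext r
          by_contra hr
          exact hcon ⟨r, by simpa using hr⟩
        rw [h00, wt_zero] at hu
        omega
      refine inner ((Finset.univ.filter fun r => u r ≠ 0).max' hne) u hu ?_ ?_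
      · have := Finset.max'_mem _ hne
        simpa using this
      · intro j hj
        by_contra hcon
        exact absurd (Finset.le_max' (Finset.univ.filter fun r => u r ≠ 0) j (by simpa using hcon))
          (not_le.mpr hj)
  exact key _ u rfl

section
variable {m : ℕ}

lemma mp_snoc_castSucc (v : Fin m → ℕ) (i : Fin m) :
    mp (Fin.snoc v 0 : Fin (m + 1) → ℕ) i.castSucc = mp v i + 1 := by
  unfold mp
  rw [Fin.sum_univ_castSucc]
  simp only [Fin.snoc_castSucc, Fin.snoc_last, Fin.castSucc_lt_castSucc_iff]
  congr 1
  simp only [Fin.castSucc_lt_last, and_true]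
  rw [if_pos]
  omega

lemma spec_snoc (q t : ℂ) (v : Fin m → ℕ) :
    spec q t (Fin.snoc v 0 : Fin (m + 1) → ℕ) =
      Fin.snoc (α := fun _ => ℂ) (fun i => t * spec q t v i) 1 := by
  funext i
  refine Fin.lastCases ?_ (fun i => ?_) i
  · rw [spec_last_of_zero _ q t (by simp), Fin.snoc_last]
  · rw [Fin.snoc_castSucc, spec_eq, spec_eq, mp_snoc_castSucc, Fin.snoc_castSucc]
    ring

lemma wt_snoc (v : Fin m → ℕ) (k : ℕ) : wt (Fin.snoc v k : Fin (m + 1) → ℕ) = wt v + k := by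
  unfold wt
  rw [Fin.sum_univ_castSucc]
  simp

/-- The rotation `X₀ ↦ q⁻¹ X_m`, `X_{i+1} ↦ X_i`. -/
def rotA (q : ℂ) : MvPolynomial (Fin (m + 1)) ℂ →ₐ[ℂ] MvPolynomial (Fin (m + 1)) ℂ :=
  aeval (Fin.cons (C q⁻¹ * X (Fin.last m)) fun i : Fin m => X i.castSucc)

/-- The inverse rotation `X_m ↦ q X₀`, `X_i ↦ X_{i+1}`. -/
def rotB (q : ℂ) : MvPolynomial (Fin (m + 1)) ℂ →ₐ[ℂ] MvPolynomial (Fin (m + 1)) ℂ :=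
  aeval (Fin.snoc (α := fun _ => MvPolynomial (Fin (m + 1)) ℂ) (fun i : Fin m => X i.succ)
    (C q * X 0))

@[simp] lemma rotA_X_zero (q : ℂ) : rotA (m := m) q (X 0) = C q⁻¹ * X (Fin.last m) := by
  simp [rotA]

@[simp] lemma rotA_X_succ (q : ℂ) (i : Fin m) : rotA q (X i.succ) = X i.castSucc := by
  simp [rotA]

@[simp] lemma rotB_X_last (q : ℂ) : rotB (m := m) q (X (Fin.last m)) = C q * X 0 := by
  simp [rotB]

@[simp] lemma rotB_X_castSucc (q : ℂ) (i : Fin m) : rotB q (X i.castSucc) = X i.succ := by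
  simp [rotB]

lemma rotA_rotB {q : ℂ} (hq : q ≠ 0) (f : MvPolynomial (Fin (m + 1)) ℂ) :
    rotA q (rotB q f) = f := by
  have : (rotA (m := m) q).comp (rotB q) = AlgHom.id ℂ _ := by
    refine MvPolynomial.algHom_ext fun i => ?_
    refine Fin.lastCases ?_ (fun i => ?_) i
    · simp only [AlgHom.comp_apply, rotB_X_last, map_mul, rotA_X_zero, AlgHom.id_apply]
      rw [← algebraMap_eq, AlgHom.commutes, algebraMap_eq, ← mul_assoc, ← C_mul,
        mul_inv_cancel₀ hq, C_1, one_mul]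
    · simp
  exact DFunLike.congr_fun this f

lemma rotB_rotA {q : ℂ} (hq : q ≠ 0) (f : MvPolynomial (Fin (m + 1)) ℂ) :
    rotB q (rotA q f) = f := by
  have : (rotB (m := m) q).comp (rotA q) = AlgHom.id ℂ _ := by
    refine MvPolynomial.algHom_ext fun i => ?_
    refine Fin.cases ?_ (fun i => ?_) i
    · simp only [AlgHom.comp_apply, rotB_X_last, map_mul, rotA_X_zero, AlgHom.id_apply]
      rw [← algebraMap_eq, AlgHom.commutes, algebraMap_eq, ← mul_assoc, ← C_mul,
        inv_mul_cancel₀ hq, C_1, one_mul]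
    · simp
  exact DFunLike.congr_fun this f

lemma eval_rotB (q : ℂ) (x : Fin (m + 1) → ℂ) (f : MvPolynomial (Fin (m + 1)) ℂ) :
    eval x (rotB q f) =
      eval (Fin.snoc (α := fun _ => ℂ) (fun i : Fin m => x i.succ) (q * x 0)) f := by
  have : (aeval x).comp (rotB (m := m) q) =
      aeval (Fin.snoc (α := fun _ => ℂ) (fun i : Fin m => x i.succ) (q * x 0)) := by
    refine MvPolynomial.algHom_ext fun i => ?_
    refine Fin.lastCases ?_ (fun i => ?_) i <;> simp
  simpa [coe_aeval_eq_eval] using DFunLike.congr_fun this f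

lemma eval_rotB_spec (q t : ℂ) (s : ℂ) (v : Fin (m + 1) → ℕ) (f : MvPolynomial (Fin (m + 1)) ℂ) :
    eval (fun i => s * spec q t v i) (rotB q f) = eval (fun i => s * spec q t (Phi v) i) f := by
  rw [eval_rotB]
  congr 2
  funext i
  refine Fin.lastCases ?_ (fun i => ?_) i
  · rw [Fin.snoc_last, spec_Phi_last]; ring
  · rw [Fin.snoc_castSucc, spec_Phi_castSucc]

lemma eval_rotA_spec_Phi {q : ℂ} (hq : q ≠ 0) (t : ℂ) (v : Fin (m + 1) → ℕ)
    (f : MvPolynomial (Fin (m + 1)) ℂ) :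
    eval (spec q t (Phi v)) (rotA q f) = eval (spec q t v) f := by
  have := eval_rotB_spec q t 1 v (rotA q f)
  rw [rotB_rotA hq] at this
  simpa using this.symm

lemma totalDegree_aeval_le {σ τ : Type*} (g : σ → MvPolynomial τ ℂ)
    (hg : ∀ i, (g i).totalDegree ≤ 1) (f : MvPolynomial σ ℂ) :
    (aeval g f).totalDegree ≤ f.totalDegree := by
  rw [aeval_def, eval₂_eq]
  refine (totalDegree_finsetSum _ _).trans (Finset.sup_le fun d hd => ?_)
  refine (totalDegree_mul _ _).trans ?_
  rw [algebraMap_eq, totalDegree_C, zero_add]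
  refine (totalDegree_finsetProd _ _).trans ?_
  refine le_trans ?_ (le_totalDegree hd)
  rw [Finsupp.sum]
  refine Finset.sum_le_sum fun i _ => ?_
  refine (totalDegree_pow _ _).trans ?_
  calc d i * (g i).totalDegree ≤ d i * 1 := Nat.mul_le_mul_left _ (hg i)
    _ = d i := mul_one _

lemma totalDegree_C_mul_X_le {σ : Type*} (a : ℂ) (i : σ) :
    (C a * X i : MvPolynomial σ ℂ).totalDegree ≤ 1 := by
  refine (totalDegree_mul _ _).trans ?_
  rw [totalDegree_C, totalDegree_X]

lemma totalDegree_rotB_le (q : ℂ) (f : MvPolynomial (Fin (m + 1)) ℂ) :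
    (rotB q f).totalDegree ≤ f.totalDegree := by
  refine totalDegree_aeval_le _ (fun i => ?_) f
  refine Fin.lastCases ?_ (fun i => ?_) i
  · rw [Fin.snoc_last]; exact totalDegree_C_mul_X_le _ _
  · rw [Fin.snoc_castSucc, totalDegree_X]

lemma totalDegree_rotA_le (q : ℂ) (f : MvPolynomial (Fin (m + 1)) ℂ) :
    (rotA q f).totalDegree ≤ f.totalDegree := by
  refine totalDegree_aeval_le _ (fun i => ?_) f
  refine Fin.cases ?_ (fun i => ?_) i
  · rw [Fin.cons_zero]; exact totalDegree_C_mul_X_le _ _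
  · rw [Fin.cons_succ, totalDegree_X]

lemma X_last_sub_C_dvd (s : ℂ) (f : MvPolynomial (Fin (m + 1)) ℂ)
    (h : aeval (Fin.snoc (α := fun _ => MvPolynomial (Fin m) ℂ) (fun i => X i) (C s)) f = 0) :
    X (Fin.last m) - C s ∣ f := by
  set I := Ideal.span {(X (Fin.last m) - C s : MvPolynomial (Fin (m + 1)) ℂ)}
  have key : Ideal.Quotient.mkₐ ℂ I =
      ((Ideal.Quotient.mkₐ ℂ I).comp (rename Fin.castSucc)).comp
        (aeval (Fin.snoc (α := fun _ => MvPolynomial (Fin m) ℂ) (fun i => X i) (C s))) := by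
    refine MvPolynomial.algHom_ext fun i => ?_
    refine Fin.lastCases ?_ (fun i => ?_) i
    · simp only [AlgHom.comp_apply, aeval_X, Fin.snoc_last, rename_C, Ideal.Quotient.mkₐ_eq_mk]
      rw [Ideal.Quotient.eq]
      exact Ideal.subset_span rfl
    · simp
  have h2 := DFunLike.congr_fun key f
  rw [AlgHom.comp_apply, h, map_zero, Ideal.Quotient.mkₐ_eq_mk, Ideal.Quotient.eq_zero_iff_mem,
    Ideal.mem_span_singleton] at h2
  exact h2

end

theorem eq_zero_of_vanishes {q t : ℂ} (P : Params q t) (n N : ℕ) (s : ℂ) (hs : s ≠ 0)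
    (f : MvPolynomial (Fin n) ℂ) (hf : f.totalDegree ≤ N)
    (h : ∀ v, wt v ≤ N → eval (fun i => s * spec q t v i) f = 0) : f = 0 := by
  induction n generalizing N s with
  | zero =>
    have h0 := h 0 (by simp [wt])
    rw [eq_C_of_isEmpty f] at h0 ⊢
    simpa using h0
  | succ m ih =>
    induction N generalizing f with
    | zero =>
      have hc := totalDegree_eq_zero_iff_eq_C.1 (Nat.le_zero.1 hf)
      have h0 := h 0 (by simp [wt])
      rw [hc] at h0 ⊢
      simpa using h0
    | succ N ihN =>
      have hdvd : X (Fin.last m) - C s ∣ f := by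
        refine X_last_sub_C_dvd s f (ih (N + 1) (s * t) (mul_ne_zero hs P.t_ne) _ ?_ ?_)
        · refine (totalDegree_aeval_le _ (fun i => ?_) f).trans hf
          refine Fin.lastCases ?_ (fun i => ?_) i
          · rw [Fin.snoc_last, totalDegree_C]; exact Nat.zero_le _
          · rw [Fin.snoc_castSucc, totalDegree_X]
        · intro v hv
          rw [← h (Fin.snoc v 0) (by rw [wt_snoc]; omega), spec_snoc]
          have : (aeval fun i => s * t * spec q t v i).comp
              (aeval (Fin.snoc (α := fun _ => MvPolynomial (Fin m) ℂ) (fun i => X i) (C s))) =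
              aeval (R := ℂ) fun i =>
                s * Fin.snoc (α := fun _ => ℂ) (fun i => t * spec q t v i) 1 i := by
            refine MvPolynomial.algHom_ext fun i => ?_
            refine Fin.lastCases ?_ (fun i => ?_) i
            · simp
            · simp [mul_assoc]
          exact DFunLike.congr_fun this f
      obtain ⟨g, rfl⟩ := hdvd
      by_cases hg : g = 0
      · simp [hg]
      have hne : (X (Fin.last m) - C s : MvPolynomial (Fin (m + 1)) ℂ) ≠ 0 := by
        intro h0
        have := congrArg (eval fun _ => s + 1) h0
        simp at this
      have hdeg : (X (Fin.last m) - C s : MvPolynomial (Fin (m + 1)) ℂ).totalDegree = 1 := by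
        rw [sub_eq_add_neg, ← C_neg, totalDegree_add_eq_left_of_totalDegree_lt]
        · exact totalDegree_X _
        · rw [totalDegree_X, totalDegree_C]; norm_num
      rw [totalDegree_mul_of_isDomain hne hg, hdeg] at hf
      exfalso
      apply hg
      have hB : rotB q g = 0 := by
        refine ihN _ ((totalDegree_rotB_le q g).trans (by omega)) fun v hv => ?_
        have h1 := h (Phi v) (by rw [wt_Phi]; omega)
        rw [eval_rotB_spec]
        rw [map_mul] at h1
        refine (mul_eq_zero.1 h1).resolve_left ?_
        simp only [map_sub, eval_X, eval_C, spec_Phi_last]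
        intro h2
        have h3 : s * (1 - q * spec q t v 0) = 0 := by linear_combination -h2
        exact mul_ne_zero hs (one_sub_q_spec_ne v P) h3
      rw [← rotA_rotB P.q_ne g, hB, map_zero]

section
variable {m : ℕ}

/-- The polynomial ring in `m + 1` variables. -/
abbrev Pol (m : ℕ) := MvPolynomial (Fin (m + 1)) ℂ

/-- The action of the transposition `sw i` on polynomials. -/
abbrev sP (i : Fin m) : Pol m →ₐ[ℂ] Pol m := rename (sw i)

lemma sP_sP (i : Fin m) (f : Pol m) : sP i (sP i f) = f := by
  rw [rename_rename]
  have : (sw i : Fin (m + 1) → Fin (m + 1)) ∘ sw i = id := by funext j; simp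
  rw [this, rename_id_apply]

lemma X_sub_X_ne_zero (i : Fin m) : (X i.castSucc - X i.succ : Pol m) ≠ 0 := by
  intro h
  have := congrArg (eval fun j => if j = i.succ then 1 else 0) h
  simp [(Fin.castSucc_lt_succ (i := i)).ne] at this

lemma X_sub_X_dvd (i : Fin m) (f : Pol m) : X i.castSucc - X i.succ ∣ f - sP i f := by
  set I := Ideal.span {(X i.castSucc - X i.succ : Pol m)}
  have h0 : Ideal.Quotient.mk I (X i.castSucc) = Ideal.Quotient.mk I (X i.succ) := by
    rw [Ideal.Quotient.eq]; exact Ideal.subset_span rfl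
  have key : Ideal.Quotient.mkₐ ℂ I = (Ideal.Quotient.mkₐ ℂ I).comp (sP i) := by
    refine MvPolynomial.algHom_ext fun j => ?_
    simp only [AlgHom.comp_apply, rename_X, Ideal.Quotient.mkₐ_eq_mk]
    by_cases j1 : j = i.castSucc
    · subst j1; simp [h0]
    · by_cases j2 : j = i.succ
      · subst j2; simp [h0]
      · rw [sw_of_ne i j1 j2]
  have h2 := DFunLike.congr_fun key f
  simp only [AlgHom.comp_apply, Ideal.Quotient.mkₐ_eq_mk] at h2
  rw [Ideal.Quotient.eq, Ideal.mem_span_singleton] at h2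
  exact h2

lemma exists_hecke (t : ℂ) (i : Fin m) (f : Pol m) : ∃ g : Pol m,
    (X i.castSucc - X i.succ) * g =
      C (t - 1) * X i.castSucc * f + (X i.castSucc - C t * X i.succ) * sP i f := by
  obtain ⟨g, hg⟩ := X_sub_X_dvd i f
  refine ⟨C t * f - (X i.castSucc - C t * X i.succ) * g, ?_⟩
  rw [C_sub, C_1]
  linear_combination (-(X i.castSucc - C t * X i.succ)) * (-hg)

/-- The Hecke operator `T_i`. -/
def heckeT (t : ℂ) (i : Fin m) : Module.End ℂ (Pol m) where
  toFun f := (exists_hecke t i f).choose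
  map_add' f g := by
    apply mul_left_cancel₀ (X_sub_X_ne_zero i)
    have h1 := (exists_hecke t i (f + g)).choose_spec
    have h2 := map_add (sP i) f g
    linear_combination h1 - (exists_hecke t i f).choose_spec - (exists_hecke t i g).choose_spec +
      (X i.castSucc - C t * X i.succ) * h2
  map_smul' c f := by
    apply mul_left_cancel₀ (X_sub_X_ne_zero i)
    have h1 := (exists_hecke t i (c • f)).choose_spec
    have h2 := map_smul (sP i) c f
    rw [RingHom.id_apply]
    have h3 := fun g : Pol m => smul_eq_C_mul g c
    rw [h3 (sP i f)] at h2
    rw [h3 (Exists.choose _)]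
    linear_combination h1 - C c * (exists_hecke t i f).choose_spec +
      (X i.castSucc - C t * X i.succ) * h2 + C (t - 1) * X i.castSucc * smul_eq_C_mul f c

lemma heckeT_spec (t : ℂ) (i : Fin m) (f : Pol m) :
    (X i.castSucc - X i.succ) * heckeT t i f =
      C (t - 1) * X i.castSucc * f + (X i.castSucc - C t * X i.succ) * sP i f :=
  (exists_hecke t i f).choose_spec

lemma sP_heckeT_spec (t : ℂ) (i : Fin m) (f : Pol m) :
    (X i.succ - X i.castSucc) * sP i (heckeT t i f) =
      C (t - 1) * X i.succ * sP i f + (X i.succ - C t * X i.castSucc) * f := by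
  have := congrArg (sP i) (heckeT_spec t i f)
  simpa only [map_mul, map_sub, map_add, rename_X, rename_C, sw_castSucc, sw_succ, sP_sP] using this

/-- The inverse of the Hecke operator `T_i`. -/
def heckeTinv (t : ℂ) (i : Fin m) : Module.End ℂ (Pol m) :=
  t⁻¹ • (heckeT t i - (t - 1) • 1)

lemma heckeTinv_spec {t : ℂ} (ht : t ≠ 0) (i : Fin m) (f : Pol m) :
    (X i.castSucc - X i.succ) * (C t * heckeTinv t i f) =
      C (t - 1) * X i.succ * f + (X i.castSucc - C t * X i.succ) * sP i f := by
  have h1 : C t * heckeTinv t i f = heckeT t i f - C (t - 1) * f := by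
    rw [← smul_eq_C_mul, ← smul_eq_C_mul]
    simp [heckeTinv, smul_smul, ht]
  rw [h1, mul_sub, heckeT_spec]
  ring

lemma heckeT_mul_self (t : ℂ) (i : Fin m) (f : Pol m) :
    heckeT t i (heckeT t i f) = (t - 1) • heckeT t i f + t • f := by
  apply mul_left_cancel₀ (X_sub_X_ne_zero i)
  apply mul_left_cancel₀ (X_sub_X_ne_zero i)
  have h1 := heckeT_spec t i (heckeT t i f)
  have h2 := heckeT_spec t i f
  have h3 := sP_heckeT_spec t i f
  rw [smul_eq_C_mul, smul_eq_C_mul]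
  rw [C_sub, C_1] at *
  linear_combination (X i.castSucc - X i.succ) * h1 + ((C t - 1) * X i.castSucc -
    (C t - 1) * (X i.castSucc - X i.succ)) * h2 - (X i.castSucc - C t * X i.succ) * h3

lemma heckeT_heckeTinv {t : ℂ} (ht : t ≠ 0) (i : Fin m) (f : Pol m) :
    heckeT t i (heckeTinv t i f) = f := by
  simp [heckeTinv, heckeT_mul_self, smul_smul, ht]

lemma X_succ_mul_heckeT {t : ℂ} (ht : t ≠ 0) (i : Fin m) (f : Pol m) :
    X i.succ * heckeT t i f = C t * heckeTinv t i (X i.castSucc * f) := by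
  apply mul_left_cancel₀ (X_sub_X_ne_zero i)
  rw [heckeTinv_spec ht, mul_left_comm, heckeT_spec, map_mul, rename_X, sw_castSucc]
  ring

lemma heckeT_mul_of_symm (t : ℂ) (i : Fin m) {g : Pol m} (hg : sP i g = g) (f : Pol m) :
    heckeT t i (g * f) = g * heckeT t i f := by
  apply mul_left_cancel₀ (X_sub_X_ne_zero i)
  have h1 := heckeT_spec t i (g * f)
  rw [map_mul (sP i), hg] at h1
  linear_combination h1 - g * heckeT_spec t i f

lemma eval_sP (i : Fin m) (x : Fin (m + 1) → ℂ) (f : Pol m) :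
    eval x (sP i f) = eval (x ∘ sw i) f := eval_rename _ _ _

lemma eval_heckeT (t : ℂ) (i : Fin m) {x : Fin (m + 1) → ℂ} (hx : x i.castSucc ≠ x i.succ)
    (f : Pol m) :
    eval x (heckeT t i f) = (t - 1) * x i.castSucc / (x i.castSucc - x i.succ) * eval x f +
      (x i.castSucc - t * x i.succ) / (x i.castSucc - x i.succ) * eval (x ∘ sw i) f := by
  have h := congrArg (eval x) (heckeT_spec t i f)
  simp only [map_mul, map_add, map_sub, eval_X, eval_C, eval_sP, map_one] at h
  have h0 : x i.castSucc - x i.succ ≠ 0 := sub_ne_zero.mpr hx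
  field_simp
  linear_combination h

lemma totalDegree_sP_le (i : Fin m) (f : Pol m) : (sP i f).totalDegree ≤ f.totalDegree :=
  totalDegree_rename_le _ _

lemma totalDegree_heckeT_le (t : ℂ) (i : Fin m) (f : Pol m) :
    (heckeT t i f).totalDegree ≤ f.totalDegree := by
  by_cases h0 : heckeT t i f = 0
  · simp [h0]
  have hD : (X i.castSucc - X i.succ : Pol m).IsHomogeneous 1 :=
    (isHomogeneous_X _ _).sub (isHomogeneous_X _ _)
  have h1 := totalDegree_mul_of_isDomain (X_sub_X_ne_zero i) h0
  rw [hD.totalDegree (X_sub_X_ne_zero i), heckeT_spec] at h1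
  have h2 : (C (t - 1) * X i.castSucc * f).totalDegree ≤ 1 + f.totalDegree :=
    (totalDegree_mul _ _).trans (Nat.add_le_add_right (totalDegree_C_mul_X_le _ _) _)
  have h3 : ((X i.castSucc - C t * X i.succ) * sP i f).totalDegree ≤ 1 + f.totalDegree := by
    refine (totalDegree_mul _ _).trans (Nat.add_le_add ?_ (totalDegree_sP_le i f))
    exact (totalDegree_sub _ _).trans (max_le (totalDegree_X _).le (totalDegree_C_mul_X_le _ _))
  have h4 := totalDegree_add (C (t - 1) * X i.castSucc * f)
    ((X i.castSucc - C t * X i.succ) * sP i f)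
  have h5 := max_le h2 h3
  omega

/-- A linear operator raises degrees by `k`. -/
def Raises (k : ℕ) (L : Module.End ℂ (Pol m)) : Prop :=
  ∀ (d : ℕ) (f : Pol m), f.IsHomogeneous d → (L f).IsHomogeneous (d + k)

lemma Raises.hc {k : ℕ} {L : Module.End ℂ (Pol m)} (hL : Raises k L) (d : ℕ) (f : Pol m) :
    homogeneousComponent (d + k) (L f) = L (homogeneousComponent d f) := by
  conv_lhs => rw [← sum_homogeneousComponent f]
  rw [map_sum, map_sum]
  have : ∀ e ∈ Finset.range (f.totalDegree + 1),
      homogeneousComponent (d + k) (L (homogeneousComponent e f)) =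
        if e = d then L (homogeneousComponent d f) else 0 := by
    intro e _
    rw [homogeneousComponent_of_mem (hL e _ (homogeneousComponent_isHomogeneous e f))]
    by_cases h : e = d
    · subst h; simp
    · rw [if_neg h, if_neg (by omega)]
  rw [Finset.sum_congr rfl this, Finset.sum_ite_eq']
  split_ifs with h
  · rfl
  · rw [homogeneousComponent_eq_zero, map_zero]
    simpa using h

lemma Raises.comp {k l : ℕ} {L L' : Module.End ℂ (Pol m)} (hL : Raises k L) (hL' : Raises l L') :
    Raises (l + k) (L * L') := fun d f hf => by
  have := hL _ _ (hL' d f hf)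
  rwa [add_assoc] at this

lemma Raises.add {k : ℕ} {L L' : Module.End ℂ (Pol m)} (hL : Raises k L) (hL' : Raises k L') :
    Raises k (L + L') := fun d f hf => (hL d f hf).add (hL' d f hf)

lemma Raises.smul {k : ℕ} {L : Module.End ℂ (Pol m)} (hL : Raises k L) (c : ℂ) :
    Raises k (c • L) := fun d f hf => by
  rw [LinearMap.smul_apply, smul_eq_C_mul]
  have := (isHomogeneous_C (Fin (m + 1)) c).mul (hL d f hf)
  rwa [zero_add] at this

lemma Raises.one : Raises 0 (1 : Module.End ℂ (Pol m)) := fun d f hf => by simpa using hf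

/-- Multiplication by a polynomial, as an operator. -/
def mulOp (g : Pol m) : Module.End ℂ (Pol m) := LinearMap.mulLeft ℂ g

@[simp] lemma mulOp_apply (g f : Pol m) : mulOp g f = g * f := rfl

lemma mulOp_raises {k : ℕ} {g : Pol m} (hg : g.IsHomogeneous k) : Raises k (mulOp g) :=
  fun d f hf => by
    have := hg.mul hf
    rwa [add_comm k d] at this

lemma isHomogeneous_of_mul_left {f g : Pol m} {k d : ℕ} (hf : f.IsHomogeneous k) (hf0 : f ≠ 0)
    (h : (f * g).IsHomogeneous (d + k)) : g.IsHomogeneous d := by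
  have key : ∀ e, e ≠ d → homogeneousComponent e g = 0 := by
    intro e he
    have h1 := (mulOp_raises hf).hc e g
    rw [mulOp_apply, mulOp_apply, homogeneousComponent_of_mem h, if_neg (by omega)] at h1
    exact (mul_eq_zero.1 h1.symm).resolve_left hf0
  rw [← sum_homogeneousComponent g]
  refine IsHomogeneous.sum _ _ _ fun e _ => ?_
  by_cases he : e = d
  · subst he; exact homogeneousComponent_isHomogeneous _ _
  · rw [key e he]; exact isHomogeneous_zero _ _ _

lemma sP_isHomogeneous (i : Fin m) {f : Pol m} {d : ℕ} (hf : f.IsHomogeneous d) :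
    (sP i f).IsHomogeneous d := hf.rename_isHomogeneous

lemma heckeT_raises (t : ℂ) (i : Fin m) : Raises 0 (heckeT t i) := fun d f hf => by
  have hD : (X i.castSucc - X i.succ : Pol m).IsHomogeneous 1 :=
    (isHomogeneous_X _ _).sub (isHomogeneous_X _ _)
  refine isHomogeneous_of_mul_left hD (X_sub_X_ne_zero i) ?_
  rw [heckeT_spec]
  have hC : ∀ a : ℂ, ∀ j : Fin (m + 1), (C a * X j : Pol m).IsHomogeneous 1 := fun a j => by
    have := (isHomogeneous_C (Fin (m + 1)) a).mul (isHomogeneous_X ℂ j)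
    rwa [zero_add] at this
  have h1 := (hC (t - 1) i.castSucc).mul hf
  have h2 := ((isHomogeneous_X ℂ i.castSucc).sub (hC t i.succ)).mul (sP_isHomogeneous i hf)
  have := h1.add h2
  rwa [add_comm 1 d] at this

lemma heckeTinv_raises (t : ℂ) (i : Fin m) : Raises 0 (heckeTinv t i) := by
  have : heckeTinv t i = t⁻¹ • (heckeT t i + (-(t - 1)) • (1 : Module.End ℂ (Pol m))) := by
    rw [heckeTinv, sub_eq_add_neg]
    congr 2
    exact (neg_smul _ _).symm
  rw [this]
  exact ((heckeT_raises t i).add (Raises.one.smul _)).smul _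

lemma isHomogeneous_aeval {g : Fin (m + 1) → Pol m} (hg : ∀ i, (g i).IsHomogeneous 1) {d : ℕ}
    {f : Pol m} (hf : f.IsHomogeneous d) : (aeval g f).IsHomogeneous d := by
  have := hf.aeval g hg
  rwa [one_mul] at this

lemma isHomogeneous_C_mul_X' (a : ℂ) (j : Fin (m + 1)) : (C a * X j : Pol m).IsHomogeneous 1 := by
  have := (isHomogeneous_C (Fin (m + 1)) a).mul (isHomogeneous_X ℂ j)
  rwa [zero_add] at this

lemma rotA_raises (q : ℂ) : Raises (m := m) 0 (rotA q).toLinearMap := fun d f hf => by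
  refine isHomogeneous_aeval (fun i => ?_) hf
  refine Fin.cases ?_ (fun i => ?_) i
  · exact isHomogeneous_C_mul_X' _ _
  · exact isHomogeneous_X _ _

lemma rotB_raises (q : ℂ) : Raises (m := m) 0 (rotB q).toLinearMap := fun d f hf => by
  refine isHomogeneous_aeval (fun i => ?_) hf
  refine Fin.lastCases ?_ (fun i => ?_) i
  · simpa using isHomogeneous_C_mul_X' q 0
  · simpa using isHomogeneous_X ℂ i.succ

/-- The partial products `T_{k-1} ⋯ T₀`. -/
def cyc (t : ℂ) (k : Fin (m + 1)) : Module.End ℂ (Pol m) :=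
  Fin.induction (motive := fun _ => Module.End ℂ (Pol m)) 1 (fun i S => heckeT t i * S) k

/-- The partial products `T_{k-1}⁻¹ ⋯ T₀⁻¹`. -/
def cycInv (t : ℂ) (k : Fin (m + 1)) : Module.End ℂ (Pol m) :=
  Fin.induction (motive := fun _ => Module.End ℂ (Pol m)) 1 (fun i S => heckeTinv t i * S) k

/-- The partial products of the transpositions. -/
def cycS (k : Fin (m + 1)) : Pol m →ₐ[ℂ] Pol m :=
  Fin.induction (motive := fun _ => Pol m →ₐ[ℂ] Pol m) (AlgHom.id ℂ _)
    (fun i S => (sP i).comp S) k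

lemma cyc_zero (t : ℂ) : cyc (m := m) t 0 = 1 := rfl

lemma cyc_succ (t : ℂ) (i : Fin m) : cyc t i.succ = heckeT t i * cyc t i.castSucc :=
  Fin.induction_succ ..

lemma cycInv_zero (t : ℂ) : cycInv (m := m) t 0 = 1 := rfl

lemma cycInv_succ (t : ℂ) (i : Fin m) : cycInv t i.succ = heckeTinv t i * cycInv t i.castSucc :=
  Fin.induction_succ ..

lemma cycS_zero : cycS (m := m) 0 = AlgHom.id ℂ _ := rfl

lemma cycS_succ (i : Fin m) : cycS i.succ = (sP i).comp (cycS i.castSucc) :=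
  Fin.induction_succ ..

lemma cyc_raises (t : ℂ) (k : Fin (m + 1)) : Raises 0 (cyc t k) := by
  induction k using Fin.induction with
  | zero => exact Raises.one
  | succ i ih => rw [cyc_succ]; exact (heckeT_raises t i).comp ih

lemma cycInv_raises (t : ℂ) (k : Fin (m + 1)) : Raises 0 (cycInv t k) := by
  induction k using Fin.induction with
  | zero => exact Raises.one
  | succ i ih => rw [cycInv_succ]; exact (heckeTinv_raises t i).comp ih

lemma X_mul_cyc {t : ℂ} (ht : t ≠ 0) (k : Fin (m + 1)) (f : Pol m) :
    X k * cyc t k f = C (t ^ (k : ℕ)) * cycInv t k (X 0 * f) := by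
  induction k using Fin.induction with
  | zero => simp [cyc_zero, cycInv_zero]
  | succ i ih =>
    rw [cyc_succ, cycInv_succ, Module.End.mul_apply, Module.End.mul_apply, X_succ_mul_heckeT ht, ih,
      ← smul_eq_C_mul, ← smul_eq_C_mul, map_smul, ← smul_eq_C_mul, smul_smul, Fin.val_succ,
      pow_succ',
      Fin.val_castSucc]

lemma X_dvd_cycInv_sub {t : ℂ} (ht : t ≠ 0) (k : Fin (m + 1)) (f : Pol m) :
    X k ∣ C (t ^ (k : ℕ)) * cycInv t k f - cycS k f ∨ k = 0 := by
  induction k using Fin.induction with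
  | zero => right; rfl
  | succ i ih =>
    left
    have ih' : X i.castSucc ∣ C (t ^ (i : ℕ)) * cycInv t i.castSucc f - cycS i.castSucc f := by
      rcases ih with h | h
      · exact h
      · rw [h, cycInv_zero, cycS_zero]
        have : (i : ℕ) = 0 := by simpa [Fin.ext_iff] using h
        simp [this]
    obtain ⟨g, hg⟩ := ih'
    set F := C (t ^ (i : ℕ)) * cycInv t i.castSucc f with hF
    have e1 : C (t ^ ((i.succ : Fin (m + 1)) : ℕ)) * cycInv t i.succ f = C t * heckeTinv t i F := by
      rw [cycInv_succ, Module.End.mul_apply, hF, ← smul_eq_C_mul, ← smul_eq_C_mul,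
        ← smul_eq_C_mul, map_smul, smul_smul, Fin.val_succ, pow_succ']
    obtain ⟨w, hw⟩ := X_sub_X_dvd i F
    have e2 : C t * heckeTinv t i F = sP i F + X i.succ * (C (t - 1) * w) := by
      apply mul_left_cancel₀ (X_sub_X_ne_zero i)
      rw [heckeTinv_spec ht]
      rw [C_sub, C_1]
      linear_combination ((C t - 1) * X i.succ) * hw
    have e3 : sP i F = cycS i.succ f + X i.succ * sP i g := by
      have := congrArg (sP i) (sub_eq_iff_eq_add.1 hg)
      rw [this, map_add, map_mul, rename_X, sw_castSucc, cycS_succ, AlgHom.comp_apply]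
      ring
    rw [e1, e2, e3]
    exact ⟨sP i g + C (t - 1) * w, by ring⟩

lemma cycS_X_zero (k : Fin (m + 1)) : cycS k (X 0) = X k := by
  induction k using Fin.induction with
  | zero => simp [cycS_zero]
  | succ i ih => rw [cycS_succ, AlgHom.comp_apply, ih, rename_X, sw_castSucc]

lemma cycS_X_succ (k : Fin (m + 1)) (j : Fin m) :
    cycS k (X j.succ) = if j.castSucc < k then X j.castSucc else X j.succ := by
  induction k using Fin.induction with
  | zero => simp [cycS_zero]
  | succ i ih =>
    rw [cycS_succ, AlgHom.comp_apply, ih]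
    split_ifs with h1 h2 h2
    · rw [rename_X, sw_of_ne i h1.ne]
      exact (h1.trans Fin.castSucc_lt_succ).ne
    · exact absurd (h1.trans Fin.castSucc_lt_succ) h2
    · have : j = i := by
        simp only [Fin.lt_def, Fin.ext_iff, Fin.val_succ, Fin.val_castSucc] at *
        omega
      subst this
      rw [rename_X, sw_succ]
    · rw [rename_X, sw_of_ne i]
      · simp only [Fin.lt_def, Fin.ext_iff, Fin.val_succ, Fin.val_castSucc, ne_eq] at *
        omega
      · simp only [Fin.lt_def, Fin.ext_iff, Fin.val_succ, Fin.val_castSucc, ne_eq] at *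
        omega

lemma X_last_dvd_rotA_sub {q t : ℂ} (ht : t ≠ 0) (f : Pol m) :
    X (Fin.last m) ∣ rotA q f - C (t ^ m) * cycInv t (Fin.last m) f := by
  have hS : X (Fin.last m) ∣ rotA q f - cycS (Fin.last m) f := by
    set I := Ideal.span {(X (Fin.last m) : Pol m)}
    have h0 : Ideal.Quotient.mk I (X (Fin.last m)) = 0 := by
      rw [Ideal.Quotient.eq_zero_iff_mem]; exact Ideal.subset_span rfl
    have key : (Ideal.Quotient.mkₐ ℂ I).comp (rotA q) =
        (Ideal.Quotient.mkₐ ℂ I).comp (cycS (Fin.last m)) := by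
      refine MvPolynomial.algHom_ext fun j => ?_
      simp only [AlgHom.comp_apply, Ideal.Quotient.mkₐ_eq_mk]
      refine Fin.cases ?_ (fun j => ?_) j
      · rw [rotA_X_zero, cycS_X_zero, map_mul, h0, mul_zero]
      · rw [rotA_X_succ, cycS_X_succ, if_pos (Fin.castSucc_lt_last j)]
    have h2 := DFunLike.congr_fun key f
    simp only [AlgHom.comp_apply, Ideal.Quotient.mkₐ_eq_mk] at h2
    rw [Ideal.Quotient.eq, Ideal.mem_span_singleton] at h2
    exact h2
  have h1 : X (Fin.last m) ∣ C (t ^ m) * cycInv t (Fin.last m) f - cycS (Fin.last m) f := by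
    rcases X_dvd_cycInv_sub ht (Fin.last m) f with h | h
    · exact h
    · rw [h, cycInv_zero, cycS_zero]
      have : m = 0 := by simpa [Fin.ext_iff] using h
      simp [this]
  have := dvd_sub hS h1
  rwa [sub_sub_sub_cancel_right] at this

lemma coeff_heckeT (t : ℂ) (p : Fin m) (f : Pol m) (w : Fin (m + 1) →₀ ℕ) (hw : w p.succ = 0) :
    coeff w (heckeT t p f) = (t - 1) * coeff w f + coeff w (sP p f) := by
  have h := congrArg (coeff (w + Finsupp.single p.castSucc 1)) (heckeT_spec t p f)
  have hz : p.succ ∉ (w + Finsupp.single p.castSucc 1).support := by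
    simp [hw, (Fin.castSucc_lt_succ (i := p)).ne]
  have e0 : ∀ g : Pol m, coeff (w + Finsupp.single p.castSucc 1) (X p.succ * g) = 0 := by
    intro g; rw [coeff_X_mul', if_neg hz]
  have e1 : ∀ g : Pol m, coeff (w + Finsupp.single p.castSucc 1) (X p.castSucc * g) =
      coeff w g := by
    intro g; rw [add_comm w, coeff_X_mul]
  rw [sub_mul, coeff_sub, e0, e1, coeff_add, mul_assoc, coeff_C_mul, e1, sub_mul (X p.castSucc),
    coeff_sub, e1,
    mul_assoc, coeff_C_mul, e0] at h
  simpa using h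

end

/-- The finite set of compositions of weight `N`. -/
def comps (n N : ℕ) : Finset (Fin n → ℕ) :=
  (Fintype.piFinset fun _ => Finset.range (N + 1)).filter fun u => wt u = N

@[simp] lemma mem_comps {N : ℕ} {u : Fin n → ℕ} : u ∈ comps n N ↔ wt u = N := by
  simp only [comps, Finset.mem_filter, Fintype.mem_piFinset, Finset.mem_range,
    and_iff_right_iff_imp]
  rintro rfl i
  exact Nat.lt_succ_of_le (Finset.single_le_sum (f := u) (fun _ _ => Nat.zero_le _)
    (Finset.mem_univ i))

lemma Raises.totalDegree_le {m : ℕ} {L : Module.End ℂ (Pol m)} (hL : Raises 0 L) (f : Pol m) :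
    (L f).totalDegree ≤ f.totalDegree := by
  conv_lhs => rw [← sum_homogeneousComponent f]
  rw [map_sum]
  refine (totalDegree_finsetSum _ _).trans (Finset.sup_le fun d hd => ?_)
  have h1 := (hL d _ (homogeneousComponent_isHomogeneous d f)).totalDegree_le
  have h2 := Finset.mem_range.1 hd
  omega

/-- A composition as an exponent vector. -/
abbrev expo (u : Fin n → ℕ) : Fin n →₀ ℕ := Finsupp.equivFunOnFinite.symm u

lemma cp_ne_zero {q t : ℂ} (P : Params q t) (u : Fin n → ℕ) : cp q t u ≠ 0 := by
  refine Finset.prod_ne_zero_iff.2 fun i _ => Finset.prod_ne_zero_iff.2 fun j hj => ?_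
  rw [Finset.mem_range] at hj
  exact sub_ne_zero.mpr (P.monomial_ne_one (by omega)).symm

/-- The factor relating `𝖬_u` and `M_u`. -/
def nrm (q t : ℂ) (u : Fin n → ℕ) : ℂ := q ^ nstat' u * t ^ nstat u / cp q t u

lemma nrm_ne_zero {q t : ℂ} (P : Params q t) (u : Fin n → ℕ) : nrm q t u ≠ 0 :=
  div_ne_zero (mul_ne_zero (pow_ne_zero _ P.q_ne) (pow_ne_zero _ P.t_ne)) (cp_ne_zero P u)

section
variable {m : ℕ} {q t : ℂ} {M : (Fin (m + 1) → ℕ) → Pol m}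

lemma MM_eq (q t : ℂ) (M : (Fin (m + 1) → ℕ) → Pol m) (u : Fin (m + 1) → ℕ) :
    MM q t M u = C (nrm q t u) * M u := rfl

lemma totalDegree_MM_le (hM : IsInterpFamily q t M) (u : Fin (m + 1) → ℕ) :
    (MM q t M u).totalDegree ≤ wt u := by
  refine (totalDegree_mul _ _).trans ?_
  rw [totalDegree_C, zero_add]
  exact (hM u).1

lemma eval_MM_of_ne (hM : IsInterpFamily q t M) {u v : Fin (m + 1) → ℕ} (h : wt v ≤ wt u)
    (hv : v ≠ u) : eval (spec q t v) (MM q t M u) = 0 := by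
  rw [MM_eq, map_mul, (hM u).2.2 v h hv, mul_zero]

lemma coeff_MM (hM : IsInterpFamily q t M) (u : Fin (m + 1) → ℕ) :
    coeff (expo u) (MM q t M u) = nrm q t u * (q ^ nstat' u)⁻¹ := by
  rw [MM_eq, coeff_C_mul, (hM u).2.1]

lemma eq_zero_of_vanishes_spec (P : Params q t) {N : ℕ} {f : Pol m} (hf : f.totalDegree ≤ N)
    (h : ∀ v, wt v ≤ N → eval (spec q t v) f = 0) : f = 0 :=
  eq_zero_of_vanishes P (m + 1) N 1 one_ne_zero f hf (by simpa using h)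

/-- The value `𝖬_u(⟨u⟩)`. -/
def zet (q t : ℂ) (M : (Fin (m + 1) → ℕ) → Pol m) (u : Fin (m + 1) → ℕ) : ℂ :=
  eval (spec q t u) (MM q t M u)

lemma zet_ne_zero (P : Params q t) (hM : IsInterpFamily q t M) (u : Fin (m + 1) → ℕ) :
    zet q t M u ≠ 0 := by
  intro h
  have h0 : MM q t M u = 0 := by
    refine eq_zero_of_vanishes_spec P (totalDegree_MM_le hM u) fun v hv => ?_
    by_cases hvu : v = u
    · rw [hvu]; exact h
    · exact eval_MM_of_ne hM hv hvu
  have h1 := coeff_MM hM u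
  rw [h0, coeff_zero] at h1
  exact mul_ne_zero (nrm_ne_zero P u) (inv_ne_zero (pow_ne_zero _ P.q_ne)) h1.symm

lemma eq_smul_MM (P : Params q t) (hM : IsInterpFamily q t M) {u : Fin (m + 1) → ℕ} {f : Pol m}
    (hf : f.totalDegree ≤ wt u) (h : ∀ v, wt v ≤ wt u → v ≠ u → eval (spec q t v) f = 0) :
    f = C (eval (spec q t u) f / zet q t M u) * MM q t M u := by
  rw [← sub_eq_zero]
  refine eq_zero_of_vanishes_spec P (N := wt u) ?_ fun v hv => ?_
  · refine (totalDegree_sub _ _).trans (max_le hf ((totalDegree_mul _ _).trans ?_))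
    rw [totalDegree_C, zero_add]
    exact totalDegree_MM_le hM u
  · rw [map_sub, map_mul, eval_C]
    by_cases hvu : v = u
    · subst hvu
      change _ - _ * zet q t M v = 0
      rw [div_mul_cancel₀ _ (zet_ne_zero P hM v), sub_self]
    · rw [h v hv hvu, eval_MM_of_ne hM hv hvu]; simp

lemma mem_span_MM (P : Params q t) (hM : IsInterpFamily q t M) {N : ℕ} {f : Pol m}
    (hf : f.totalDegree ≤ N) : f ∈ Submodule.span ℂ (MM q t M '' {w | wt w ≤ N}) := by
  have key : ∀ k ≤ N + 1, ∃ g ∈ Submodule.span ℂ (MM q t M '' {w | wt w ≤ N}),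
      g.totalDegree ≤ N ∧ ∀ v, wt v < k → eval (spec q t v) (f - g) = 0 := by
    intro k
    induction k with
    | zero => intro _; exact ⟨0, Submodule.zero_mem _, by simp, fun v hv => absurd hv (by omega)⟩
    | succ k ih =>
      intro hk
      obtain ⟨g, hg, hgd, hgv⟩ := ih (by omega)
      refine ⟨g + ∑ w ∈ comps (m + 1) k,
        C (eval (spec q t w) (f - g) / zet q t M w) * MM q t M w, ?_, ?_, ?_⟩
      · refine Submodule.add_mem _ hg (Submodule.sum_mem _ fun w hw => ?_)
        rw [← smul_eq_C_mul]
        refine Submodule.smul_mem _ _ (Submodule.subset_span ⟨w, ?_, rfl⟩)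
        simp only [mem_comps] at hw
        change wt w ≤ N; omega
      · refine (totalDegree_add _ _).trans (max_le hgd ?_)
        refine (totalDegree_finsetSum _ _).trans (Finset.sup_le fun w hw => ?_)
        refine (totalDegree_mul _ _).trans ?_
        rw [totalDegree_C, zero_add]
        simp only [mem_comps] at hw
        exact (totalDegree_MM_le hM w).trans (by omega)
      · intro v hv
        rw [← sub_sub, map_sub, map_sum]
        rcases Nat.lt_succ_iff_lt_or_eq.1 hv with h | h
        · rw [hgv v h, Finset.sum_eq_zero, sub_zero]
          intro w hw
          simp only [mem_comps] at hw
          rw [map_mul, eval_MM_of_ne hM (by omega) (by rintro rfl; omega), mul_zero]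
        · rw [Finset.sum_eq_single v]
          · rw [map_mul, eval_C]
            change _ - _ * zet q t M v = 0
            rw [div_mul_cancel₀ _ (zet_ne_zero P hM v), sub_self]
          · intro w hw hwv
            simp only [mem_comps] at hw
            rw [map_mul, eval_MM_of_ne hM (by omega) (Ne.symm hwv), mul_zero]
          · intro hv'; simp only [mem_comps] at hv'; omega
  obtain ⟨g, hg, hgd, hgv⟩ := key (N + 1) le_rfl
  have : f - g = 0 := eq_zero_of_vanishes_spec P (N := N)
    ((totalDegree_sub _ _).trans (max_le hf hgd)) fun v hv => hgv v (by omega)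
  rw [sub_eq_zero.1 this]
  exact hg

/-- The top homogeneous component of `𝖬_u`. -/
def TE (q t : ℂ) (M : (Fin (m + 1) → ℕ) → Pol m) (u : Fin (m + 1) → ℕ) : Pol m :=
  homogeneousComponent (wt u) (MM q t M u)

lemma TE_isHomogeneous (u : Fin (m + 1) → ℕ) : (TE q t M u).IsHomogeneous (wt u) :=
  homogeneousComponent_isHomogeneous _ _

lemma hc_MM (hM : IsInterpFamily q t M) {u : Fin (m + 1) → ℕ} {d : ℕ} (h : wt u ≤ d) :
    homogeneousComponent d (MM q t M u) = if wt u = d then TE q t M u else 0 := by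
  split_ifs with h1
  · rw [← h1]; rfl
  · exact homogeneousComponent_eq_zero _ _ (lt_of_le_of_lt (totalDegree_MM_le hM u) (by omega))

lemma mem_span_TE (P : Params q t) (hM : IsInterpFamily q t M) {d : ℕ} {f : Pol m}
    (hf : f.IsHomogeneous d) : f ∈ Submodule.span ℂ (TE q t M '' {w | wt w = d}) := by
  have h1 := mem_span_MM P hM (hf.totalDegree_le)
  have h2 : homogeneousComponent d f ∈ Submodule.map (homogeneousComponent d)
      (Submodule.span ℂ (MM q t M '' {w | wt w ≤ d})) := Submodule.mem_map_of_mem h1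
  rw [homogeneousComponent_of_mem hf, if_pos rfl, Submodule.map_span] at h2
  refine Submodule.span_le.2 ?_ h2
  rintro _ ⟨_, ⟨w, hw, rfl⟩, rfl⟩
  rw [hc_MM hM hw]
  split_ifs with h
  · exact Submodule.subset_span ⟨w, h, rfl⟩
  · exact Submodule.zero_mem _

lemma span_TE (P : Params q t) (hM : IsInterpFamily q t M) :
    ⊤ ≤ Submodule.span ℂ (Set.range (TE q t M)) := by
  intro f _
  rw [← sum_homogeneousComponent f]
  refine Submodule.sum_mem _ fun d _ => ?_
  exact Submodule.span_mono (Set.image_subset_range _ _)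
    (mem_span_TE P hM (homogeneousComponent_isHomogeneous d f))

lemma totalDegree_lt_or_eq_zero {d : ℕ} {g : Pol m} (hg : g.totalDegree ≤ d)
    (h0 : homogeneousComponent d g = 0) : g = 0 ∨ g.totalDegree < d := by
  by_cases h : g.totalDegree < d
  · exact Or.inr h
  left
  by_contra hg0
  have hd : g.totalDegree = d := by omega
  obtain ⟨s, hs, hsd⟩ := Finset.exists_mem_eq_sup g.support
    (support_nonempty.2 hg0) (fun s => s.sum fun _ e => e)
  have h1 := congrArg (coeff s) h0
  rw [coeff_homogeneousComponent, if_pos, coeff_zero] at h1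
  · exact (mem_support_iff.1 hs) h1
  · rw [← hd, totalDegree, hsd, Finsupp.degree_eq_sum, Finsupp.sum_fintype]
    simp

lemma linearIndependent_TE (P : Params q t) (hM : IsInterpFamily q t M) :
    LinearIndependent ℂ (TE q t M) := by
  rw [linearIndependent_iff']
  intro s c hsum u hu
  obtain ⟨d, hd⟩ : ∃ d, d = wt u := ⟨_, rfl⟩
  set g := ∑ w ∈ s.filter (fun w => wt w = d), C (c w) * MM q t M w with hg
  have hgd : g.totalDegree ≤ d := by
    refine (totalDegree_finsetSum _ _).trans (Finset.sup_le fun w hw => ?_)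
    refine (totalDegree_mul _ _).trans ?_
    rw [totalDegree_C, zero_add]
    exact (totalDegree_MM_le hM w).trans (Finset.mem_filter.1 hw).2.le
  have hghc : homogeneousComponent d g = 0 := by
    have h1 := congrArg (homogeneousComponent d) hsum
    rw [map_zero, map_sum] at h1
    rw [hg, map_sum, Finset.sum_filter]
    refine Eq.trans ?_ h1
    refine Finset.sum_congr rfl fun w _ => ?_
    rw [map_smul, homogeneousComponent_of_mem (TE_isHomogeneous w)]
    split_ifs with h2 h3 h3
    · rw [homogeneousComponent_C_mul, hc_MM hM h2.le, if_pos h2, smul_eq_C_mul]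
    · exact absurd h2.symm h3
    · exact absurd h3.symm h2
    · rw [smul_zero]
  have hg0 : g = 0 := by
    rcases totalDegree_lt_or_eq_zero hgd hghc with h | h
    · exact h
    · refine eq_zero_of_vanishes_spec P (N := d - 1) (by omega) fun v hv => ?_
      rw [hg, map_sum]
      refine Finset.sum_eq_zero fun w hw => ?_
      have := (Finset.mem_filter.1 hw).2
      rw [map_mul, eval_MM_of_ne hM (by omega) (by rintro rfl; omega), mul_zero]
  have h2 := congrArg (eval (spec q t u)) hg0
  rw [hg, map_sum, map_zero, Finset.sum_eq_single u] at h2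
  · rw [map_mul, eval_C] at h2
    exact (mul_eq_zero.1 h2).resolve_right (zet_ne_zero P hM u)
  · intro w hw hwu
    have := (Finset.mem_filter.1 hw).2
    rw [map_mul, eval_MM_of_ne hM (by omega) (Ne.symm hwu), mul_zero]
  · intro h3
    exact absurd (Finset.mem_filter.2 ⟨hu, hd.symm⟩) h3

/-- The basis of the homogeneous nonsymmetric Macdonald polynomials. -/
def TEb (P : Params q t) (hM : IsInterpFamily q t M) :
    Module.Basis (Fin (m + 1) → ℕ) ℂ (Pol m) :=
  Module.Basis.mk (linearIndependent_TE P hM) (span_TE P hM)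

@[simp] lemma TEb_apply (P : Params q t) (hM : IsInterpFamily q t M) (u : Fin (m + 1) → ℕ) :
    TEb P hM u = TE q t M u := Module.Basis.mk_apply _ _ _

/-- The rotation of exponent vectors. -/
def rotC (u : Fin (m + 1) → ℕ) : Fin (m + 1) → ℕ := Fin.snoc (fun i => u i.succ) (u 0)

lemma rotC_injective : Function.Injective (rotC (m := m)) := by
  intro u v h
  funext i
  refine Fin.cases ?_ (fun i => ?_) i
  · simpa [rotC] using congrFun h (Fin.last m)
  · simpa [rotC] using congrFun h i.castSucc

lemma rotA_monomial (q a : ℂ) (u : Fin (m + 1) → ℕ) :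
    rotA q (monomial (expo u) a) = monomial (expo (rotC u)) (a * q⁻¹ ^ u 0) := by
  rw [monomial_eq, monomial_eq, Finsupp.prod_fintype _ _ (by simp),
    Finsupp.prod_fintype _ _ (by simp), Fin.prod_univ_succ, Fin.prod_univ_castSucc]
  simp only [Finsupp.coe_equivFunOnFinite_symm, map_mul, map_pow, map_prod, rotA_X_zero,
    rotA_X_succ, rotC, Fin.snoc_castSucc, Fin.snoc_last, mul_pow]
  rw [← algebraMap_eq, AlgHom.commutes]
  ring

lemma coeff_rotA (q : ℂ) (u : Fin (m + 1) → ℕ) (f : Pol m) :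
    coeff (expo (rotC u)) (rotA q f) = q⁻¹ ^ u 0 * coeff (expo u) f := by
  induction f using MvPolynomial.induction_on' with
  | monomial d a =>
    obtain ⟨w, rfl⟩ := Finsupp.equivFunOnFinite.symm.surjective d
    rw [rotA_monomial, coeff_monomial, coeff_monomial]
    simp only [expo, EmbeddingLike.apply_eq_iff_eq, rotC_injective.eq_iff]
    split_ifs with h
    · rw [h]; ring
    · simp
  | add p r hp hr => rw [map_add, coeff_add, coeff_add, hp, hr, mul_add]

lemma expo_Phi (u : Fin (m + 1) → ℕ) :
    expo (Phi u) = Finsupp.single (Fin.last m) 1 + expo (rotC u) := by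
  ext i
  refine Fin.lastCases ?_ (fun i => ?_) i
  · simp [rotC, add_comm]
  · simp [rotC]

lemma degree_expo (u : Fin (m + 1) → ℕ) : (expo u).degree = wt u := by
  rw [Finsupp.degree_eq_sum]; rfl

lemma coeff_eq_zero_of_wt_lt {f : Pol m} {u : Fin (m + 1) → ℕ} (h : f.totalDegree < wt u) :
    coeff (expo u) f = 0 := by
  apply coeff_eq_zero_of_totalDegree_lt
  rw [← degree_expo u] at h
  exact h

lemma MM_Phi (P : Params q t) (hM : IsInterpFamily q t M) (u : Fin (m + 1) → ℕ) :
    MM q t M (Phi u) = C (spec q t u 0 / (1 - q * spec q t u 0)) *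
      ((X (Fin.last m) - 1) * rotA q (MM q t M u)) := by
  set f := (X (Fin.last m) - 1) * rotA q (MM q t M u) with hf
  have hdA : (rotA q (MM q t M u)).totalDegree ≤ wt u :=
    (totalDegree_rotA_le q _).trans (totalDegree_MM_le hM u)
  have h1 := eq_smul_MM P hM (u := Phi u) (f := f) ?_ ?_
  · have h2 := congrArg (coeff (expo (Phi u))) h1
    have h3 : coeff (expo (Phi u)) (rotA q (MM q t M u)) = 0 :=
      coeff_eq_zero_of_wt_lt (by rw [wt_Phi]; omega)
    have hL : coeff (expo (Phi u)) f = q⁻¹ ^ u 0 * (nrm q t u * (q ^ nstat' u)⁻¹) := by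
      rw [hf, sub_mul, coeff_sub, one_mul, h3, sub_zero, expo_Phi, coeff_X_mul, coeff_rotA,
        coeff_MM hM]
    rw [hL, coeff_C_mul, coeff_MM hM, nstat'_Phi] at h2
    have hq := P.q_ne
    have ht := P.t_ne
    have hn := nrm_ne_zero P u
    have h5 := one_sub_q_spec_ne u P
    have h4 : nrm q t (Phi u) * (1 - q * spec q t u 0) = spec q t u 0 * nrm q t u := by
      have hc := cp_ne_zero P u
      rw [nrm, nrm, nstat'_Phi, nstat_Phi, cp_Phi]
      nth_rw 3 [spec_eq]
      field_simp
      ring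
    have h6 : eval (spec q t (Phi u)) f / zet q t M (Phi u) * nrm q t (Phi u) = nrm q t u := by
      have : (q ^ nstat' u)⁻¹ * q⁻¹ ^ u 0 ≠ 0 :=
        mul_ne_zero (inv_ne_zero (pow_ne_zero _ hq)) (pow_ne_zero _ (inv_ne_zero hq))
      apply mul_right_cancel₀ this
      rw [pow_add, mul_inv] at h2
      rw [← inv_pow] at *
      linear_combination -h2
    rw [h1, ← mul_assoc, ← C_mul]
    have h7 : spec q t u 0 / (1 - q * spec q t u 0) *
        (eval (spec q t (Phi u)) f / zet q t M (Phi u)) = 1 := by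
      have hn' := nrm_ne_zero P (Phi u)
      apply mul_right_cancel₀ hn'
      rw [mul_assoc, h6, one_mul, div_mul_eq_mul_div, ← h4, mul_div_assoc, div_self h5, mul_one]
    rw [h7, C_1, one_mul]
  · rw [wt_Phi, add_comm (wt u) 1]
    refine (totalDegree_mul _ _).trans (Nat.add_le_add ?_ hdA)
    refine (totalDegree_sub _ _).trans (max_le (totalDegree_X _).le ?_)
    simp
  · intro v hv hvu
    rw [hf, map_mul, map_sub, eval_X, map_one]
    by_cases hl : v (Fin.last m) = 0
    · rw [spec_last_of_zero v q t hl, sub_self, zero_mul]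
    · obtain ⟨w, rfl⟩ := exists_Phi v hl
      rw [wt_Phi, wt_Phi] at hv
      rw [eval_rotA_spec_Phi P.q_ne, eval_MM_of_ne hM (by omega) (by rintro rfl; exact hvu rfl),
        mul_zero]

lemma TE_Phi (P : Params q t) (hM : IsInterpFamily q t M) (u : Fin (m + 1) → ℕ) :
    TE q t M (Phi u) = C (spec q t u 0 / (1 - q * spec q t u 0)) *
      (X (Fin.last m) * rotA q (TE q t M u)) := by
  have hdA : (rotA q (MM q t M u)).totalDegree ≤ wt u :=
    (totalDegree_rotA_le q _).trans (totalDegree_MM_le hM u)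
  have h1 := ((mulOp_raises (isHomogeneous_X ℂ (Fin.last m))).comp (rotA_raises q)).hc (wt u)
    (MM q t M u)
  rw [TE, MM_Phi P hM, homogeneousComponent_C_mul, wt_Phi, sub_mul, one_mul, map_sub,
    homogeneousComponent_eq_zero (wt u + 1) (rotA q (MM q t M u)) (by omega), sub_zero]
  rw [zero_add] at h1
  exact congrArg _ h1

/-- The diagonal coefficient of `T_i`. -/
def alp (q t : ℂ) (u : Fin (m + 1) → ℕ) (i : Fin m) : ℂ :=
  (t - 1) * spec q t u i.castSucc / (spec q t u i.castSucc - spec q t u i.succ)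

/-- The off-diagonal coefficient of `T_i`. -/
def gam (q t : ℂ) (u : Fin (m + 1) → ℕ) (i : Fin m) : ℂ :=
  (spec q t u i.castSucc - t * spec q t u i.succ) / (spec q t u i.castSucc - spec q t u i.succ)

lemma gam_of_eq {u : Fin (m + 1) → ℕ} {i : Fin m} (h : u i.castSucc = u i.succ) :
    gam q t u i = 0 := by
  rw [gam, spec_of_eq u q t h, sub_self, zero_div]

lemma gam_ne_zero (P : Params q t) {u : Fin (m + 1) → ℕ} {i : Fin m}
    (h : u i.castSucc ≠ u i.succ) : gam q t u i ≠ 0 :=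
  div_ne_zero (sub_ne_zero.2 (spec_adj_ne_mul u P h)) (sub_ne_zero.2 (spec_adj_ne u P i))

lemma alp_add_gam (P : Params q t) (u : Fin (m + 1) → ℕ) (i : Fin m) :
    alp q t u i + gam q t u i = t := by
  have := sub_ne_zero.2 (spec_adj_ne u P i)
  rw [alp, gam]
  field_simp
  ring

lemma eval_heckeT_spec (P : Params q t) (u : Fin (m + 1) → ℕ) (i : Fin m) (f : Pol m) :
    eval (spec q t u) (heckeT t i f) = alp q t u i * eval (spec q t u) f +
      gam q t u i * eval (spec q t (u ∘ sw i)) f := by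
  rw [eval_heckeT t i (spec_adj_ne u P i)]
  by_cases h : u i.castSucc = u i.succ
  · have h0 : gam q t u i = 0 := gam_of_eq h
    have h1 := h0
    rw [gam] at h1
    rw [h0, h1, zero_mul, zero_mul, alp]
  · rw [spec_comp_sw u q t h]; rfl

lemma heckeT_vanishes (P : Params q t) {N : ℕ} (i : Fin m) {f : Pol m}
    (h : ∀ v, wt v ≤ N → eval (spec q t v) f = 0) :
    ∀ v, wt v ≤ N → eval (spec q t v) (heckeT t i f) = 0 := by
  intro v hv
  rw [eval_heckeT_spec P, h v hv, h _ (by rwa [wt_comp_sw]), mul_zero, mul_zero, add_zero]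

lemma cycInv_vanishes (P : Params q t) {N : ℕ} (k : Fin (m + 1)) {f : Pol m}
    (h : ∀ v, wt v ≤ N → eval (spec q t v) f = 0) :
    ∀ v, wt v ≤ N → eval (spec q t v) (cycInv t k f) = 0 := by
  induction k using Fin.induction with
  | zero => simpa [cycInv_zero] using h
  | succ i ih =>
    intro v hv
    rw [cycInv_succ, Module.End.mul_apply, heckeTinv, LinearMap.smul_apply, LinearMap.sub_apply,
      smul_eval, map_sub, heckeT_vanishes P i ih v hv, LinearMap.smul_apply, smul_eval]
    simp [ih v hv]

/-- Knop's recursion at the level of interpolation polynomials. -/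
theorem knop_MM (P : Params q t) (hM : IsInterpFamily q t M) (u : Fin (m + 1) → ℕ) :
    (X (Fin.last m) - 1) * rotA q (MM q t M u) =
      C (spec q t u 0)⁻¹ * (X (Fin.last m) * cyc t (Fin.last m) (MM q t M u)) -
        C (t ^ m) * cycInv t (Fin.last m) (MM q t M u) := by
  set f := MM q t M u with hf
  set y := spec q t u 0 with hy
  have hy0 : y ≠ 0 := spec_ne_zero P u 0
  set τ' := cycInv (m := m) t (Fin.last m) with hτ
  have hX := X_mul_cyc P.t_ne (Fin.last m) f
  rw [Fin.val_last] at hX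
  set h := (X (Fin.last m) - 1) * rotA q f - C (y⁻¹ * t ^ m) * τ' ((X 0 - C y) * f) with hh
  have e1 : τ' ((X 0 - C y) * f) = τ' (X 0 * f) - C y * τ' f := by
    rw [sub_mul, map_sub, ← smul_eq_C_mul, map_smul, smul_eq_C_mul]
  have hC : C y⁻¹ * C y = (1 : Pol m) := by rw [← C_mul, inv_mul_cancel₀ hy0, C_1]
  have e2 : h = (X (Fin.last m) - 1) * rotA q f -
      (C y⁻¹ * (X (Fin.last m) * cyc t (Fin.last m) f) - C (t ^ m) * τ' f) := by
    rw [hh, e1, hX, C_mul]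
    linear_combination (C (t ^ m) * τ' f) * hC
  rw [← sub_eq_zero, ← e2]
  obtain ⟨g, hg⟩ := X_last_dvd_rotA_sub (q := q) P.t_ne f
  have e3 : h = X (Fin.last m) * (rotA q f - C y⁻¹ * cyc t (Fin.last m) f - g) := by
    rw [e2]; linear_combination -hg
  have hv : ∀ v, wt v ≤ wt u → eval (spec q t v) h = 0 := by
    intro v hv
    have h1 : eval (spec q t v) ((X (Fin.last m) - 1) * rotA q f) = 0 := by
      rw [map_mul, map_sub, eval_X, map_one]
      by_cases hl : v (Fin.last m) = 0
      · rw [spec_last_of_zero v q t hl, sub_self, zero_mul]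
      · obtain ⟨w, rfl⟩ := exists_Phi v hl
        rw [wt_Phi] at hv
        rw [eval_rotA_spec_Phi P.q_ne, eval_MM_of_ne hM (by omega) (by rintro rfl; omega), mul_zero]
    have h2 := cycInv_vanishes P (N := wt u) (Fin.last m) (f := (X 0 - C y) * f) ?_ v hv
    · rw [hh, map_sub, map_mul _ (C _), h1, h2, mul_zero, sub_zero]
    · intro w hw
      rw [map_mul, map_sub, eval_X, eval_C]
      by_cases hwu : w = u
      · rw [hwu, sub_self, zero_mul]
      · rw [eval_MM_of_ne hM hw hwu, mul_zero]
  have hdeg : h.totalDegree ≤ 1 + wt u := by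
    have d0 : f.totalDegree ≤ wt u := totalDegree_MM_le hM u
    have d1 : (rotA q f).totalDegree ≤ wt u := (totalDegree_rotA_le q f).trans d0
    have d2 : (cyc t (Fin.last m) f).totalDegree ≤ wt u :=
      ((cyc_raises t _).totalDegree_le f).trans d0
    have d3 : (τ' f).totalDegree ≤ wt u := ((cycInv_raises t _).totalDegree_le f).trans d0
    have hX1 : (X (Fin.last m) - 1 : Pol m).totalDegree ≤ 1 :=
      (totalDegree_sub _ _).trans (max_le (totalDegree_X _).le (by simp))
    have hCm : ∀ (c : ℂ) (p : Pol m), (C c * p).totalDegree ≤ p.totalDegree := fun c p =>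
      (totalDegree_mul _ _).trans (by rw [totalDegree_C, zero_add])
    rw [e2]
    refine (totalDegree_sub _ _).trans (max_le ?_ ((totalDegree_sub _ _).trans (max_le ?_ ?_)))
    · exact (totalDegree_mul _ _).trans (Nat.add_le_add hX1 d1)
    · exact (hCm _ _).trans ((totalDegree_mul _ _).trans
        (Nat.add_le_add (totalDegree_X _).le d2))
    · exact (hCm _ _).trans (d3.trans (Nat.le_add_left _ _))
  set g' := rotA q f - C y⁻¹ * cyc t (Fin.last m) f - g
  have hg' : g' = 0 := by
    by_cases hn : g' = 0
    · exact hn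
    refine eq_zero_of_vanishes_spec P (N := wt u) ?_ fun v hw => ?_
    · rw [e3, totalDegree_mul_of_isDomain (X_ne_zero _) hn, totalDegree_X] at hdeg
      omega
    · have := hv v hw
      rw [e3, map_mul, eval_X] at this
      exact (mul_eq_zero.1 this).resolve_left (spec_ne_zero P v _)
  rw [e3, hg', mul_zero]

end

/-- The closed form of `𝖬_u(⟨u⟩)`. -/
def kap (q t : ℂ) (u : Fin n → ℕ) : ℂ :=
  ∏ i, ∏ j ∈ Finset.range (u i), (-(q ^ j * t ^ mp u i))

section
variable {m : ℕ} {q t : ℂ} {M : (Fin (m + 1) → ℕ) → Pol m}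

lemma kap_Phi (q t : ℂ) (u : Fin (m + 1) → ℕ) : kap q t (Phi u) = -spec q t u 0 * kap q t u := by
  unfold kap
  rw [Fin.prod_univ_castSucc, Fin.prod_univ_succ, spec_eq]
  simp only [Phi_castSucc, Phi_last, mp_Phi_last, mp_Phi_castSucc, Finset.prod_range_succ]
  ring

lemma kap_comp_sw (q t : ℂ) (u : Fin (m + 1) → ℕ) (i : Fin m) :
    kap q t (u ∘ sw i) = kap q t u := by
  by_cases h : u i.castSucc = u i.succ
  · rw [comp_sw_of_eq u h]
  · unfold kap
    simp only [mp_comp_sw u h, Function.comp]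
    exact Equiv.prod_comp (sw i) fun j => ∏ k ∈ Finset.range (u j), (-(q ^ k * t ^ mp u j))

lemma heckeT_MM_aux (P : Params q t) (hM : IsInterpFamily q t M) (w : Fin (m + 1) → ℕ)
    (i : Fin m) : heckeT t i (MM q t M w) = C (alp q t w i) * MM q t M w +
      C (gam q t (w ∘ sw i) i * zet q t M w / zet q t M (w ∘ sw i)) * MM q t M (w ∘ sw i) := by
  have hCm : ∀ (c : ℂ) (p : Pol m), (C c * p).totalDegree ≤ p.totalDegree := fun c p =>
    (totalDegree_mul _ _).trans (by rw [totalDegree_C, zero_add])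
  have hd := totalDegree_MM_le hM w
  have hd' := totalDegree_MM_le hM (w ∘ sw i)
  rw [wt_comp_sw] at hd'
  rw [← sub_eq_zero]
  refine eq_zero_of_vanishes_spec P (N := wt w) ?_ fun v hv => ?_
  · refine (totalDegree_sub _ _).trans (max_le ((totalDegree_heckeT_le t i _).trans hd)
      ((totalDegree_add _ _).trans (max_le ((hCm _ _).trans hd) ((hCm _ _).trans hd'))))
  · rw [map_sub, map_add, map_mul, map_mul, eval_C, eval_C, eval_heckeT_spec P]
    by_cases he : w i.castSucc = w i.succ
    · have hs := comp_sw_of_eq w he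
      rw [hs, gam_of_eq he, zero_mul, zero_div, zero_mul, add_zero]
      by_cases hvw : v = w
      · subst hvw
        rw [gam_of_eq he, zero_mul, add_zero, sub_self]
      · rw [eval_MM_of_ne hM hv hvw, eval_MM_of_ne hM (by rwa [wt_comp_sw])]
        · simp
        · intro h
          apply hvw
          rw [← comp_sw_sw i v, h, hs]
    · have hne : w ∘ sw i ≠ w := by
        intro h
        have := congrFun h i.castSucc
        simp only [Function.comp, sw_castSucc] at this
        exact he this.symm
      by_cases hvw : v = w
      · subst hvw
        rw [eval_MM_of_ne hM (by rw [wt_comp_sw]) hne,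
          eval_MM_of_ne hM (by rw [wt_comp_sw]) hne.symm]
        ring
      · by_cases hvs : v = w ∘ sw i
        · subst hvs
          rw [eval_MM_of_ne hM hv hvw, comp_sw_sw]
          change _ + gam q t _ i * zet q t M w - (_ + _ * zet q t M (w ∘ sw i)) = 0
          rw [div_mul_cancel₀ _ (zet_ne_zero P hM _)]
          ring
        · rw [eval_MM_of_ne hM hv hvw, eval_MM_of_ne hM (by rwa [wt_comp_sw]),
            eval_MM_of_ne hM (by rwa [wt_comp_sw]) hvs]
          · simp
          · intro h
            apply hvs
            rw [← h, comp_sw_sw]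

lemma heckeT_TE_of_MM {w : Fin (m + 1) → ℕ} {i : Fin m} {a b : ℂ}
    (h : heckeT t i (MM q t M w) = C a * MM q t M w + C b * MM q t M (w ∘ sw i)) :
    heckeT t i (TE q t M w) = C a * TE q t M w + C b * TE q t M (w ∘ sw i) := by
  have h1 := (heckeT_raises t i).hc (wt w) (MM q t M w)
  rw [add_zero, h, map_add, homogeneousComponent_C_mul, homogeneousComponent_C_mul] at h1
  have h2 : homogeneousComponent (wt w) (MM q t M (w ∘ sw i)) = TE q t M (w ∘ sw i) := by
    rw [TE, wt_comp_sw]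
  rw [h2] at h1
  exact h1.symm

lemma expo_mapDomain (i : Fin m) (w : Fin (m + 1) → ℕ) :
    Finsupp.mapDomain (sw i) (expo (w ∘ sw i)) = expo w := by
  ext j
  have h : j = sw i (sw i j) := (sw_sw i j).symm
  rw [h, Finsupp.mapDomain_apply (sw i).injective]
  simp

lemma coeff_sP (i : Fin m) (w : Fin (m + 1) → ℕ) (f : Pol m) :
    coeff (expo w) (sP i f) = coeff (expo (w ∘ sw i)) f := by
  rw [← expo_mapDomain i w]
  exact coeff_rename_mapDomain _ (sw i).injective _ _

lemma coeff_TE_eq_zero (P : Params q t) (hM : IsInterpFamily q t M) (p : Fin (m + 1)) :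
    ∀ u : Fin (m + 1) → ℕ, u p ≠ 0 → (∀ j, p < j → u j = 0) →
      ∀ w : Fin (m + 1) → ℕ, (∀ j, p ≤ j → w j = 0) → coeff (expo w) (TE q t M u) = 0 := by
  induction p using Fin.reverseInduction with
  | last =>
    intro u hu _ w hw
    obtain ⟨u', rfl⟩ := exists_Phi u hu
    rw [TE_Phi P hM, coeff_C_mul, coeff_X_mul', if_neg, mul_zero]
    simp [hw _ le_rfl]
  | cast p ih =>
    intro u hu h0 w hw
    have hws : w ∘ sw p = w := comp_sw_of_eq w
      (by rw [hw _ le_rfl, hw _ Fin.castSucc_lt_succ.le])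
    have hz := ih (u ∘ sw p) (by simpa using hu) (fun j hj => by
      have : p.castSucc < j := Fin.castSucc_lt_succ.trans hj
      simp only [Function.comp]
      rw [sw_of_ne p this.ne' hj.ne']
      exact h0 j this) w (fun j hj => hw j (Fin.castSucc_lt_succ.le.trans hj))
    have h1 := congrArg (coeff (expo w))
      (heckeT_TE_of_MM (heckeT_MM_aux P hM (u ∘ sw p) p))
    rw [coeff_heckeT t p _ _ (by simpa using hw _ Fin.castSucc_lt_succ.le), coeff_sP, hws,
      coeff_add, coeff_C_mul, coeff_C_mul, hz, comp_sw_sw] at h1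
    have hg : gam q t u p ≠ 0 := gam_ne_zero P (by rw [h0 _ Fin.castSucc_lt_succ]; exact hu)
    have hb : gam q t u p * zet q t M (u ∘ sw p) / zet q t M u ≠ 0 :=
      div_ne_zero (mul_ne_zero hg (zet_ne_zero P hM _)) (zet_ne_zero P hM _)
    simp only [mul_zero, zero_add] at h1
    exact (mul_eq_zero.1 h1.symm).resolve_left hb

lemma nrm_comp_sw_special (P : Params q t) {u : Fin (m + 1) → ℕ} {p : Fin m}
    (hp : u p.castSucc ≠ 0) (h0 : ∀ j, p.castSucc < j → u j = 0) :
    nrm q t (u ∘ sw p) = gam q t u p * nrm q t u := by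
  have h1 := cp_comp_sw_special q t hp h0
  have h2 := spec_special q t hp h0
  have h3 := spec_ne_zero P u p.succ
  have c1 := cp_ne_zero P u
  have c2 := cp_ne_zero P (u ∘ sw p)
  have hd := sub_ne_zero.2 (spec_adj_ne u P p)
  rw [nrm, nrm, gam, nstat'_comp_sw, nstat_comp_sw_special hp h0, div_mul_div_comm,
    div_eq_div_iff c2 (mul_ne_zero hd c1), h2]
  linear_combination (q ^ nstat' u * t ^ (nstat u + 1) * spec q t u p.succ) * h1

lemma coeff_TE (hM : IsInterpFamily q t M) (u : Fin (m + 1) → ℕ) :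
    coeff (expo u) (TE q t M u) = nrm q t u * (q ^ nstat' u)⁻¹ := by
  rw [TE, coeff_homogeneousComponent, if_pos (degree_expo u), coeff_MM hM]

lemma zet_comp_sw_special (P : Params q t) (hM : IsInterpFamily q t M) {u : Fin (m + 1) → ℕ}
    {p : Fin m} (hp : u p.castSucc ≠ 0) (h0 : ∀ j, p.castSucc < j → u j = 0) :
    zet q t M (u ∘ sw p) = zet q t M u := by
  have hz := coeff_TE_eq_zero P hM p.succ (u ∘ sw p) (by simpa using hp) (fun j hj => by
      have : p.castSucc < j := Fin.castSucc_lt_succ.trans hj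
      simp only [Function.comp]
      rw [sw_of_ne p this.ne' hj.ne']
      exact h0 j this) u (fun j hj => h0 j (Fin.castSucc_lt_succ.trans_le hj))
  have h1 := congrArg (coeff (expo u))
    (heckeT_TE_of_MM (heckeT_MM_aux P hM (u ∘ sw p) p))
  rw [coeff_heckeT t p _ _ (by simpa using h0 _ Fin.castSucc_lt_succ), coeff_sP,
    coeff_add, coeff_C_mul, coeff_C_mul, hz, comp_sw_sw, coeff_TE hM, coeff_TE hM,
    nstat'_comp_sw, nrm_comp_sw_special P hp h0, mul_zero, mul_zero, zero_add, zero_add] at h1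
  have hg : gam q t u p ≠ 0 := gam_ne_zero P (by rw [h0 _ Fin.castSucc_lt_succ]; exact hp)
  have hn : nrm q t u * (q ^ nstat' u)⁻¹ ≠ 0 :=
    mul_ne_zero (nrm_ne_zero P u) (inv_ne_zero (pow_ne_zero _ P.q_ne))
  have hz0 := zet_ne_zero P hM u
  rw [mul_assoc] at h1
  have h2 := mul_right_cancel₀ hn h1
  rw [eq_div_iff hz0] at h2
  exact (mul_left_cancel₀ hg h2).symm

lemma MM_zero (hM : IsInterpFamily q t M) : MM q t M 0 = 1 := by
  have h0 := (hM 0).1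
  rw [wt_zero, Nat.le_zero] at h0
  have h1 := totalDegree_eq_zero_iff_eq_C.1 h0
  have h2 := (hM 0).2.1
  have h3 : (Finsupp.equivFunOnFinite.symm (0 : Fin (m + 1) → ℕ)) = 0 := by ext; simp
  rw [h3] at h2
  rw [MM_eq, h1, h2, ← C_mul, ← C_1]
  simp [nrm, nstat', nstat, cp]

lemma zet_eq_kap (P : Params q t) (hM : IsInterpFamily q t M) (u : Fin (m + 1) → ℕ) :
    zet q t M u = kap q t u := by
  induction u using path_induction with
  | zero => simp [zet, MM_zero hM, kap]
  | phi u ih =>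
    rw [kap_Phi, ← ih, zet, MM_Phi P hM, map_mul, map_mul, map_sub, eval_X, map_one, eval_C,
      spec_Phi_last, eval_rotA_spec_Phi P.q_ne]
    have := one_sub_q_spec_ne u P
    change _ * (_ * zet q t M u) = _
    rw [div_mul_eq_mul_div, div_eq_iff this]
    ring
  | special u p hp h0 ih => rw [← zet_comp_sw_special P hM hp h0, ih, kap_comp_sw]

theorem heckeT_MM (P : Params q t) (hM : IsInterpFamily q t M) (w : Fin (m + 1) → ℕ)
    (i : Fin m) : heckeT t i (MM q t M w) = C (alp q t w i) * MM q t M w +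
      C (gam q t (w ∘ sw i) i) * MM q t M (w ∘ sw i) := by
  rw [heckeT_MM_aux P hM, mul_div_assoc, zet_eq_kap P hM, zet_eq_kap P hM, kap_comp_sw, div_self,
    mul_one]
  rw [← zet_eq_kap P hM]
  exact zet_ne_zero P hM w

theorem heckeT_TE (P : Params q t) (hM : IsInterpFamily q t M) (w : Fin (m + 1) → ℕ)
    (i : Fin m) : heckeT t i (TE q t M w) = alp q t w i • TE q t M w +
      gam q t (w ∘ sw i) i • TE q t M (w ∘ sw i) := by
  rw [smul_eq_C_mul, smul_eq_C_mul]
  exact heckeT_TE_of_MM (heckeT_MM P hM w i)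

/-- Knop's recursion for the homogeneous polynomials. -/
theorem knop_TE (P : Params q t) (hM : IsInterpFamily q t M) (u : Fin (m + 1) → ℕ) :
    spec q t u 0 • rotA q (TE q t M u) = cyc t (Fin.last m) (TE q t M u) := by
  have h := congrArg (homogeneousComponent (wt u + 1)) (knop_MM P hM u)
  have hd := totalDegree_MM_le hM u
  have hA := ((rotA_raises q).totalDegree_le (MM q t M u)).trans hd
  have hI := ((cycInv_raises t (Fin.last m)).totalDegree_le (MM q t M u)).trans hd
  have h1 := ((mulOp_raises (isHomogeneous_X ℂ (Fin.last m))).comp (rotA_raises q)).hc (wt u)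
    (MM q t M u)
  have h2 := ((mulOp_raises (isHomogeneous_X ℂ (Fin.last m))).comp
    (cyc_raises t (Fin.last m))).hc (wt u) (MM q t M u)
  rw [zero_add] at h1 h2
  simp only [Module.End.mul_apply, mulOp_apply, AlgHom.toLinearMap_apply] at h1 h2 hA
  rw [sub_mul, one_mul, map_sub, map_sub, homogeneousComponent_C_mul, homogeneousComponent_C_mul,
    h1, h2, homogeneousComponent_eq_zero (wt u + 1) (rotA q (MM q t M u)) (by omega),
    homogeneousComponent_eq_zero (wt u + 1) (cycInv t (Fin.last m) (MM q t M u)) (by omega),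
    sub_zero, mul_zero, sub_zero] at h
  have hy := spec_ne_zero P u 0
  have hC : C (spec q t u 0) * C (spec q t u 0)⁻¹ = (1 : Pol m) := by
    rw [← C_mul, mul_inv_cancel₀ hy, C_1]
  apply mul_left_cancel₀ (X_ne_zero (R := ℂ) (Fin.last m))
  rw [smul_eq_C_mul]
  change X _ * rotA q (TE q t M u) = _ * (_ * cyc t _ (TE q t M u)) at h
  linear_combination (C (spec q t u 0)) * h +
    (X (Fin.last m) * cyc t (Fin.last m) (TE q t M u)) * hC

lemma heckeT_eval_zero (P : Params q t) (i : Fin m) (f : Pol m) :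
    eval (spec q t 0) (heckeT t i f) = t * eval (spec q t 0) f := by
  have h0 : (0 : Fin (m + 1) → ℕ) i.castSucc = (0 : Fin (m + 1) → ℕ) i.succ := rfl
  rw [eval_heckeT_spec P, comp_sw_of_eq _ h0, ← add_mul, alp_add_gam P]

/-- The principal specialization of `TE`. -/
def hev (q t : ℂ) (M : (Fin (m + 1) → ℕ) → Pol m) (u : Fin (m + 1) → ℕ) : ℂ :=
  eval (spec q t 0) (TE q t M u)

lemma cyc_eval_zero (P : Params q t) (k : Fin (m + 1)) (f : Pol m) :
    eval (spec q t 0) (cyc t k f) = t ^ (k : ℕ) * eval (spec q t 0) f := by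
  induction k using Fin.induction with
  | zero => simp [cyc_zero]
  | succ i ih =>
    rw [cyc_succ, Module.End.mul_apply, heckeT_eval_zero P, ih, Fin.val_succ, Fin.val_castSucc]
    ring

lemma hev_Phi (P : Params q t) (hM : IsInterpFamily q t M) (u : Fin (m + 1) → ℕ) :
    hev q t M (Phi u) * (1 - q * spec q t u 0) = t ^ m * hev q t M u := by
  have h1 := congrArg (eval (spec q t 0)) (knop_TE P hM u)
  rw [cyc_eval_zero P, smul_eval, Fin.val_last] at h1
  have := one_sub_q_spec_ne u P
  rw [hev, TE_Phi P hM, map_mul, map_mul, eval_C, eval_X, spec_last_of_zero _ _ _ rfl, one_mul,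
    hev, ← h1,
    mul_right_comm, div_mul_cancel₀ _ this]

lemma hev_comp_sw (P : Params q t) (hM : IsInterpFamily q t M) (u : Fin (m + 1) → ℕ)
    (i : Fin m) : gam q t (u ∘ sw i) i * hev q t M (u ∘ sw i) = gam q t u i * hev q t M u := by
  have h1 := congrArg (eval (spec q t 0)) (heckeT_TE P hM u i)
  rw [heckeT_eval_zero P, map_add, smul_eval, smul_eval] at h1
  unfold hev
  linear_combination -h1 - (eval (spec q t 0) (TE q t M u)) * alp_add_gam P u i

lemma TE_zero (hM : IsInterpFamily q t M) : TE q t M 0 = 1 := by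
  rw [TE, MM_zero hM, wt_zero, homogeneousComponent_zero]
  simp

lemma hev_ne_zero (P : Params q t) (hM : IsInterpFamily q t M) (u : Fin (m + 1) → ℕ) :
    hev q t M u ≠ 0 := by
  induction u using path_induction with
  | zero => simp [hev, TE_zero hM]
  | phi u ih =>
    have h := hev_Phi P hM u
    intro h0
    rw [h0, zero_mul] at h
    exact mul_ne_zero (pow_ne_zero _ P.t_ne) ih h.symm
  | special u p hp h0 ih =>
    have h := hev_comp_sw P hM u p
    intro hu
    rw [hu, mul_zero] at h
    refine mul_ne_zero (gam_ne_zero P ?_) ih h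
    simp only [Function.comp, sw_castSucc, sw_succ]
    rw [h0 _ Fin.castSucc_lt_succ]
    exact hp.symm

end

/-- Scaling of all variables. -/
def scl {m : ℕ} (c : ℂ) : Pol m →ₐ[ℂ] Pol m := aeval fun i => C c * X i

section
variable {m : ℕ} {q t : ℂ} {M : (Fin (m + 1) → ℕ) → Pol m}

lemma scl_of_homogeneous (c : ℂ) {d : ℕ} {f : Pol m} (hf : f.IsHomogeneous d) :
    scl c f = c ^ d • f := by
  conv_lhs => rw [f.as_sum]
  conv_rhs => rw [f.as_sum]
  rw [map_sum, Finset.smul_sum]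
  refine Finset.sum_congr rfl fun s hs => ?_
  have hd : s.degree = d := by
    have := hf (mem_support_iff.1 hs)
    rwa [Pi.one_def, ← Finsupp.degree_eq_weight_one] at this
  rw [scl, aeval_monomial, monomial_eq, algebraMap_eq, smul_eq_C_mul]
  have : (s.prod fun i k => (C c * X i : Pol m) ^ k) = C (c ^ d) * s.prod fun i k => X i ^ k := by
    simp only [mul_pow]
    rw [Finsupp.prod_mul, ← hd, Finsupp.degree_apply, ← Finset.prod_pow_eq_pow_sum, map_prod]
    simp [Finsupp.prod]
  rw [this]
  ring

lemma rotA_pow_X (q : ℂ) (j : ℕ) : ∀ (i k : Fin (m + 1)), (k : ℕ) = i + j →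
    ((rotA q) ^ j) (X k) = (X i : Pol m) := by
  induction j with
  | zero =>
    intro i k h
    have : k = i := Fin.ext (by simpa using h)
    rw [this, pow_zero, AlgHom.one_apply]
  | succ j ih =>
    intro i k h
    have hk : k ≠ 0 := by rintro rfl; simp at h
    obtain ⟨k', rfl⟩ := Fin.exists_succ_eq.2 hk
    rw [pow_succ, AlgHom.mul_apply, rotA_X_succ]
    refine ih i _ ?_
    rw [Fin.val_succ] at h
    rw [Fin.val_castSucc]
    omega

lemma rotA_pow (q : ℂ) : (rotA (m := m) q) ^ (m + 1) = scl q⁻¹ := by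
  refine MvPolynomial.algHom_ext fun i => ?_
  have h1 : (rotA (m := m) q) ^ (m + 1) = rotA q ^ ((m - i) + (1 + (i : ℕ))) := by
    congr 1; have := i.2; omega
  rw [h1, pow_add, pow_add, pow_one, AlgHom.mul_apply, AlgHom.mul_apply,
    rotA_pow_X q i 0 i (by simp), rotA_X_zero, map_mul, ← algebraMap_eq, AlgHom.commutes,
    rotA_pow_X q (m - i) i (Fin.last m) (by have := i.2; rw [Fin.val_last]; omega)]
  simp [scl, algebraMap_eq]

/-- The operator `φ`. -/
def phiOp (q : ℂ) : Module.End ℂ (Pol m) := (rotA q).toLinearMap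

/-- The operator `ψ = φ⁻¹`. -/
def psiOp (q : ℂ) : Module.End ℂ (Pol m) := (rotB q).toLinearMap

@[simp] lemma phiOp_apply (q : ℂ) (f : Pol m) : phiOp q f = rotA q f := rfl

@[simp] lemma psiOp_apply (q : ℂ) (f : Pol m) : psiOp q f = rotB q f := rfl

lemma phiOp_mul_psiOp (hq : q ≠ 0) : phiOp (m := m) q * psiOp q = 1 :=
  LinearMap.ext fun f => rotA_rotB hq f

lemma phiOp_pow (q : ℂ) : (phiOp (m := m) q) ^ (m + 1) = (scl q⁻¹).toLinearMap := by
  rw [← rotA_pow]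
  have : ∀ j : ℕ, (phiOp (m := m) q) ^ j = ((rotA q) ^ j).toLinearMap := by
    intro j
    induction j with
    | zero => rfl
    | succ j ih => rw [pow_succ, pow_succ, ih]; rfl
  exact this _

/-- The Cherednik-type operator `Y = ψ τ`. -/
def Yop (q t : ℂ) : Module.End ℂ (Pol m) := psiOp q * cyc t (Fin.last m)

lemma Yop_TE (P : Params q t) (hM : IsInterpFamily q t M) (u : Fin (m + 1) → ℕ) :
    Yop q t (TE q t M u) = spec q t u 0 • TE q t M u := by
  rw [Yop, Module.End.mul_apply, ← knop_TE P hM, map_smul, psiOp_apply, rotB_rotA P.q_ne]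

lemma cyc_surjective (ht : t ≠ 0) (k : Fin (m + 1)) : Function.Surjective (cyc t k) := by
  induction k using Fin.induction with
  | zero => exact Function.surjective_id
  | succ i ih =>
    rw [cyc_succ]
    exact Function.Surjective.comp (g := heckeT t i)
      (fun f => ⟨heckeTinv t i f, heckeT_heckeTinv ht i f⟩) ih

lemma Yop_surjective (P : Params q t) : Function.Surjective (Yop (m := m) q t) :=
  Function.Surjective.comp (g := psiOp q) (fun f => ⟨rotA q f, rotB_rotA P.q_ne f⟩)
    (cyc_surjective P.t_ne _)

lemma commute_cyc {K : Module.End ℂ (Pol m)} (hT : ∀ i, Commute K (heckeT t i))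
    (k : Fin (m + 1)) : Commute K (cyc t k) := by
  induction k using Fin.induction with
  | zero => exact Commute.one_right _
  | succ i ih => rw [cyc_succ]; exact (hT i).mul_right ih

lemma commute_heckeTinv {K : Module.End ℂ (Pol m)} {i : Fin m} (hT : Commute K (heckeT t i)) :
    Commute K (heckeTinv t i) := by
  rw [heckeTinv]
  exact ((hT.sub_right ((Commute.one_right _).smul_right _)).smul_right _)

lemma commute_cycInv {K : Module.End ℂ (Pol m)} (hT : ∀ i, Commute K (heckeT t i))
    (k : Fin (m + 1)) : Commute K (cycInv t k) := by
  induction k using Fin.induction with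
  | zero => exact Commute.one_right _
  | succ i ih => rw [cycInv_succ]; exact (commute_heckeTinv (hT i)).mul_right ih

lemma commute_phiOp (P : Params q t) {K : Module.End ℂ (Pol m)}
    (hT : ∀ i, Commute K (heckeT t i)) (hY : Commute K (Yop q t)) : Commute K (phiOp q) := by
  have h1 : phiOp q * Yop q t = cyc (m := m) t (Fin.last m) := by
    rw [Yop, ← mul_assoc, phiOp_mul_psiOp P.q_ne, one_mul]
  have h2 : K * phiOp q * Yop q t = phiOp q * K * Yop q t := by
    rw [mul_assoc, h1, (commute_cyc hT _).eq, mul_assoc, hY.eq, ← mul_assoc, h1]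
  refine LinearMap.ext fun f => ?_
  obtain ⟨g, rfl⟩ := Yop_surjective P f
  exact LinearMap.congr_fun h2 g

lemma eq_zero_of_commute_Yop (P : Params q t) {K : Module.End ℂ (Pol m)} {k : ℕ}
    (hk : k ≠ 0) (hK : Raises k K) (hT : ∀ i, Commute K (heckeT t i))
    (hY : Commute K (Yop q t)) : K = 0 := by
  have h1 := (commute_phiOp P hT hY).pow_right (m + 1)
  rw [phiOp_pow] at h1
  have key : ∀ d (f : Pol m), f.IsHomogeneous d → K f = 0 := by
    intro d f hf
    have h2 := LinearMap.congr_fun h1.eq f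
    rw [Module.End.mul_apply, Module.End.mul_apply, AlgHom.toLinearMap_apply,
      AlgHom.toLinearMap_apply, scl_of_homogeneous _ hf, map_smul,
      scl_of_homogeneous _ (hK d f hf), pow_add, mul_smul] at h2
    have h3 := smul_right_injective _ (pow_ne_zero d (inv_ne_zero P.q_ne)) h2
    by_contra h4
    have h5 : (q⁻¹ ^ k - 1) • K f = 0 := by
      rw [_root_.sub_smul, one_smul, ← h3, sub_self]
    have h6 := (smul_eq_zero.1 h5).resolve_right h4
    have h7 : q ^ k * t ^ 0 = 1 := by
      rw [inv_pow, sub_eq_zero, inv_eq_one] at h6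
      rw [h6, pow_zero, one_mul]
    exact P.monomial_ne_one hk h7
  refine LinearMap.ext fun f => ?_
  rw [← sum_homogeneousComponent f, map_sum]
  exact Finset.sum_eq_zero fun d _ => key d _ (homogeneousComponent_isHomogeneous d f)

/-- An intertwining sequence of operators is determined by its initial term. -/
theorem eq_of_intertwine (P : Params q t) {K L : ℕ → Module.End ℂ (Pol m)} {c : ℂ} (hc : c ≠ 0)
    {A A' : Module.End ℂ (Pol m)} (hK : ∀ k, Raises k (K k)) (hL : ∀ k, Raises k (L k))
    (h0 : K 0 = L 0)
    (hKT : ∀ i k, Commute (K k) (heckeT t i)) (hLT : ∀ i k, Commute (L k) (heckeT t i))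
    (hKY : ∀ k, K (k + 1) * (c • Yop q t) + K k * A = (c • Yop q t) * K (k + 1) + A' * K k)
    (hLY : ∀ k, L (k + 1) * (c • Yop q t) + L k * A = (c • Yop q t) * L (k + 1) + A' * L k)
    (k : ℕ) : K k = L k := by
  induction k with
  | zero => exact h0
  | succ k ih =>
    rw [← sub_eq_zero]
    refine eq_zero_of_commute_Yop P (Nat.succ_ne_zero k) ?_ (fun i => (hKT i _).sub_left (hLT i _))
      ?_
    · have : K (k + 1) - L (k + 1) = K (k + 1) + (-1 : ℂ) • L (k + 1) := by
        rw [sub_eq_add_neg]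
        congr 1
        exact (neg_one_smul ℂ _).symm
      rw [this]
      exact (hK _).add ((hL _).smul _)
    · have h1 := hKY k
      have h2 := hLY k
      rw [ih] at h1
      have h3 : c • ((K (k + 1) - L (k + 1)) * Yop q t) =
          c • (Yop q t * (K (k + 1) - L (k + 1))) := by
        rw [mul_sub, sub_mul, smul_sub, smul_sub]
        rw [mul_smul_comm, smul_mul_assoc] at h1 h2
        have := congrArg₂ (· - ·) h1 h2
        simpa using this
      exact smul_right_injective _ hc h3

end

/-- The Taylor coefficients of `(bz; q)_∞ / (az; q)_∞`. -/
def pco (a b q : ℂ) : ℕ → ℂ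
  | 0 => 1
  | k + 1 => (a - b * q ^ k) / (1 - q ^ (k + 1)) * pco a b q k

section
variable {R S : Type*} [CommRing R] [Algebra ℂ R] [CommRing S] [Algebra ℂ S]

/-- The formal series of `(bzx; q)_∞ / (azx; q)_∞` in `z`. -/
def fsr (a b q : ℂ) (x : R) : PowerSeries R :=
  PowerSeries.mk fun k => algebraMap ℂ R (pco a b q k) * x ^ k

@[simp] lemma coeff_fsr (a b q : ℂ) (x : R) (k : ℕ) :
    PowerSeries.coeff k (fsr a b q x) = algebraMap ℂ R (pco a b q k) * x ^ k :=
  PowerSeries.coeff_mk _ _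

lemma map_fsr (a b q : ℂ) (g : R →ₐ[ℂ] S) (x : R) :
    PowerSeries.map (g : R →+* S) (fsr a b q x) = fsr a b q (g x) := by
  ext k
  simp

lemma fsr_q (a b : ℂ) {q : ℂ} (hq : ∀ k : ℕ, 1 - q ^ (k + 1) ≠ 0) (x : R) :
    fsr a b q x * (1 - PowerSeries.C (algebraMap ℂ R a * x) * PowerSeries.X) =
      fsr a b q (algebraMap ℂ R q * x) *
        (1 - PowerSeries.C (algebraMap ℂ R b * x) * PowerSeries.X) := by
  ext k
  rw [mul_sub, mul_sub, mul_one, mul_one, ← mul_assoc, ← mul_assoc, map_sub, map_sub]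
  cases k with
  | zero => simp
  | succ k =>
    rw [PowerSeries.coeff_succ_mul_X, PowerSeries.coeff_succ_mul_X, PowerSeries.coeff_mul_C,
      PowerSeries.coeff_mul_C]
    simp only [coeff_fsr, mul_pow, ← map_pow]
    have h : pco a b q (k + 1) - a * pco a b q k =
        q ^ (k + 1) * pco a b q (k + 1) - b * (q ^ k * pco a b q k) := by
      have h1 : pco a b q (k + 1) * (1 - q ^ (k + 1)) = (a - b * q ^ k) * pco a b q k := by
        rw [pco, div_mul_eq_mul_div, div_mul_cancel₀ _ (hq k)]
      linear_combination h1
    have h2 := congrArg (fun z => algebraMap ℂ R z * x ^ (k + 1)) h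
    simp only [map_sub, map_mul] at h2
    linear_combination h2

end

section
variable {m : ℕ} {q t : ℂ}

/-- The generating series of the kernel `∏ (b z x_i; q)_∞ / (a z x_i; q)_∞`. -/
def Fser (a b q : ℂ) : PowerSeries (Pol m) := ∏ j, fsr a b q (X j : Pol m)

/-- The homogeneous components of the kernel. -/
def Fc (a b q : ℂ) (k : ℕ) : Pol m := PowerSeries.coeff k (Fser a b q)

lemma Fc_zero (a b q : ℂ) : Fc (m := m) a b q 0 = 1 := by
  rw [Fc, Fser, PowerSeries.coeff_zero_eq_constantCoeff, map_prod]
  refine Finset.prod_eq_one fun j _ => ?_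
  rw [← PowerSeries.coeff_zero_eq_constantCoeff, coeff_fsr]
  simp [pco]

lemma Fc_isHomogeneous (a b q : ℂ) (k : ℕ) : (Fc (m := m) a b q k).IsHomogeneous k := by
  have key : ∀ s : Finset (Fin (m + 1)), ∀ k,
      (PowerSeries.coeff k (∏ j ∈ s, fsr a b q (X j : Pol m))).IsHomogeneous k := by
    intro s
    induction s using Finset.induction_on with
    | empty =>
      intro k
      rw [Finset.prod_empty, PowerSeries.coeff_one]
      split_ifs with h
      · rw [h]; exact isHomogeneous_one _ _
      · exact isHomogeneous_zero _ _ _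
    | insert j s hj ih =>
      intro k
      rw [Finset.prod_insert hj, PowerSeries.coeff_mul]
      refine IsHomogeneous.sum _ _ _ fun p hp => ?_
      rw [← Finset.HasAntidiagonal.mem_antidiagonal.1 hp]
      refine IsHomogeneous.mul ?_ (ih p.2)
      rw [coeff_fsr, algebraMap_eq]
      have := (isHomogeneous_C (Fin (m + 1)) (pco a b q p.1)).mul ((isHomogeneous_X ℂ j).pow p.1)
      rwa [zero_add, one_mul] at this
  exact key _ k

lemma sP_Fc (a b q : ℂ) (k : ℕ) (i : Fin m) : sP i (Fc a b q k) = Fc a b q k := by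
  have h : PowerSeries.map ((sP i : Pol m →ₐ[ℂ] Pol m) : Pol m →+* Pol m) (Fser a b q) =
      Fser a b q := by
    rw [Fser, map_prod]
    simp only [map_fsr, rename_X]
    exact Equiv.prod_comp (sw i) fun j => fsr a b q (X j : Pol m)
  have h1 := congrArg (PowerSeries.coeff k) h
  rw [PowerSeries.coeff_map] at h1
  exact h1

lemma Params.one_sub_pow_ne (P : Params q t) (k : ℕ) : 1 - q ^ (k + 1) ≠ 0 := by
  have h := P.monomial_ne_one (Nat.succ_ne_zero k) (b := 0)
  rw [pow_zero, mul_one] at h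
  exact sub_ne_zero.2 h.symm

lemma Fser_rotB (P : Params q t) (a b : ℂ) :
    Fser (m := m) a b q * (1 - PowerSeries.C (C a * X 0) * PowerSeries.X) =
      PowerSeries.map ((rotB q : Pol m →ₐ[ℂ] Pol m) : Pol m →+* Pol m) (Fser a b q) *
        (1 - PowerSeries.C (C b * X 0) * PowerSeries.X) := by
  have h := fsr_q a b P.one_sub_pow_ne (X 0 : Pol m)
  simp only [algebraMap_eq] at h
  rw [Fser, map_prod]
  conv_lhs => rw [Fin.prod_univ_succ]
  conv_rhs => rw [Fin.prod_univ_castSucc]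
  simp only [map_fsr, rotB_X_last, rotB_X_castSucc]
  rw [mul_right_comm, h]
  ring

lemma Fc_succ_rotB (P : Params q t) (a b : ℂ) (k : ℕ) :
    Fc (m := m) a b q (k + 1) - Fc a b q k * (C a * X 0) =
      rotB q (Fc a b q (k + 1)) - rotB q (Fc a b q k) * (C b * X 0) := by
  have h := congrArg (PowerSeries.coeff (k + 1)) (Fser_rotB (m := m) P a b)
  rw [mul_sub, mul_sub, mul_one, mul_one, ← mul_assoc, ← mul_assoc, map_sub, map_sub,
    PowerSeries.coeff_succ_mul_X, PowerSeries.coeff_succ_mul_X, PowerSeries.coeff_mul_C,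
    PowerSeries.coeff_mul_C, PowerSeries.coeff_map, PowerSeries.coeff_map] at h
  exact h

lemma commute_mulOp_Fc (a b q t : ℂ) (k : ℕ) (i : Fin m) :
    Commute (mulOp (Fc a b q k)) (heckeT t i) :=
  LinearMap.ext fun f => (heckeT_mul_of_symm t i (sP_Fc a b q k i) f).symm

lemma mulOp_Fc_raises (a b q : ℂ) (k : ℕ) : Raises (m := m) k (mulOp (Fc a b q k)) :=
  mulOp_raises (Fc_isHomogeneous a b q k)

lemma mulOp_commute (f g : Pol m) : Commute (mulOp f) (mulOp g) :=
  LinearMap.ext fun h => by simp [mul_left_comm]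

lemma mulOp_Fc_Yop (P : Params q t) (a b : ℂ) (k : ℕ) :
    mulOp (Fc (m := m) a b q (k + 1)) * Yop q t -
        a • (mulOp (Fc a b q k) * (mulOp (X 0) * Yop q t)) =
      Yop q t * mulOp (Fc a b q (k + 1)) - b • (mulOp (X 0) * Yop q t * mulOp (Fc a b q k)) := by
  refine LinearMap.ext fun f => ?_
  have hc : ∀ k, Yop q t (Fc a b q k * f) = rotB q (Fc a b q k) * Yop q t f := by
    intro k
    have := LinearMap.congr_fun (commute_cyc (fun i => commute_mulOp_Fc a b q t k i)
      (Fin.last m)).eq f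
    simp only [Module.End.mul_apply, mulOp_apply] at this
    rw [Yop, Module.End.mul_apply, Module.End.mul_apply, ← this, psiOp_apply, map_mul, psiOp_apply]
  simp only [LinearMap.sub_apply, LinearMap.smul_apply, Module.End.mul_apply, mulOp_apply, hc,
    smul_eq_C_mul]
  linear_combination (Yop q t f) * Fc_succ_rotB P a b k

end

section
variable {m : ℕ} {q t : ℂ} {M : (Fin (m + 1) → ℕ) → Pol m}

lemma ext_TE (P : Params q t) (hM : IsInterpFamily q t M) {A B : Module.End ℂ (Pol m)}
    (h : ∀ u, A (TE q t M u) = B (TE q t M u)) : A = B :=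
  (TEb P hM).ext fun u => by simpa using h u

/-- The operator with eigenvectors `TE u` and eigenvalues `g u`. -/
def dia (P : Params q t) (hM : IsInterpFamily q t M) (g : (Fin (m + 1) → ℕ) → ℂ) :
    Module.End ℂ (Pol m) := (TEb P hM).constr ℂ fun u => g u • TE q t M u

@[simp] lemma dia_TE (P : Params q t) (hM : IsInterpFamily q t M) (g : (Fin (m + 1) → ℕ) → ℂ)
    (u : Fin (m + 1) → ℕ) : dia P hM g (TE q t M u) = g u • TE q t M u := by
  rw [dia, ← TEb_apply P hM u, Module.Basis.constr_basis, TEb_apply]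

lemma raises_of_TE (P : Params q t) (hM : IsInterpFamily q t M) {k : ℕ} {A : Module.End ℂ (Pol m)}
    (h : ∀ u, (A (TE q t M u)).IsHomogeneous (wt u + k)) : Raises k A := by
  intro d f hf
  have h1 := Submodule.mem_map_of_mem (f := A) (mem_span_TE P hM hf)
  rw [Submodule.map_span] at h1
  have h2 : A f ∈ homogeneousSubmodule (Fin (m + 1)) ℂ (d + k) := by
    refine Submodule.span_le.2 ?_ h1
    rintro _ ⟨_, ⟨w, hw, rfl⟩, rfl⟩
    have := h w
    rw [hw] at this
    exact this
  exact h2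

lemma isHomogeneous_smul {f : Pol m} {d : ℕ} (hf : f.IsHomogeneous d) (c : ℂ) :
    (c • f).IsHomogeneous d := (homogeneousSubmodule (Fin (m + 1)) ℂ d).smul_mem c hf

lemma dia_raises (P : Params q t) (hM : IsInterpFamily q t M) (g : (Fin (m + 1) → ℕ) → ℂ) :
    Raises 0 (dia P hM g) := by
  refine raises_of_TE P hM fun u => ?_
  rw [dia_TE, add_zero]
  exact isHomogeneous_smul (TE_isHomogeneous u) _

lemma dia_commute (P : Params q t) (hM : IsInterpFamily q t M) (g h : (Fin (m + 1) → ℕ) → ℂ) :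
    Commute (dia P hM g) (dia P hM h) :=
  ext_TE P hM fun u => by simp [smul_smul, mul_comm]

lemma dia_commute_heckeT (P : Params q t) (hM : IsInterpFamily q t M)
    {g : (Fin (m + 1) → ℕ) → ℂ} {i : Fin m} (hg : ∀ u, g (u ∘ sw i) = g u) :
    Commute (dia P hM g) (heckeT t i) :=
  ext_TE P hM fun u => by
    simp only [Module.End.mul_apply, heckeT_TE P hM, map_add, map_smul, dia_TE, hg]
    module

lemma Yop_eq_dia (P : Params q t) (hM : IsInterpFamily q t M) :
    Yop q t = dia P hM fun u => spec q t u 0 :=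
  ext_TE P hM fun u => by rw [Yop_TE P hM, dia_TE]

lemma dia_mul_inv (P : Params q t) (hM : IsInterpFamily q t M) {g : (Fin (m + 1) → ℕ) → ℂ}
    (hg : ∀ u, g u ≠ 0) : dia P hM g * dia P hM (fun u => (g u)⁻¹) = 1 :=
  ext_TE P hM fun u => by simp [smul_smul, hg u]

lemma dia_inv_mul (P : Params q t) (hM : IsInterpFamily q t M) {g : (Fin (m + 1) → ℕ) → ℂ}
    (hg : ∀ u, g u ≠ 0) : dia P hM (fun u => (g u)⁻¹) * dia P hM g = 1 :=
  ext_TE P hM fun u => by simp [smul_smul, hg u]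

/-- The rescaled operator `t^{-m} Y`. -/
def yop (q t : ℂ) : Module.End ℂ (Pol m) := (t ^ m)⁻¹ • Yop q t

lemma yop_TE (P : Params q t) (hM : IsInterpFamily q t M) (u : Fin (m + 1) → ℕ) :
    yop q t (TE q t M u) = (q ^ u 0 / t ^ lp u 0) • TE q t M u := by
  rw [yop, LinearMap.smul_apply, Yop_TE P hM, smul_smul, spec_eq]
  congr 1
  have h1 : m = lp u 0 + mp u 0 := by have := lp_add_mp u 0; omega
  have ht := P.t_ne
  have h2 : t ^ m = t ^ lp u 0 * t ^ mp u 0 := by rw [← pow_add, ← h1]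
  rw [h2]
  field_simp

lemma dia_qfac_X_phi (P : Params q t) (hM : IsInterpFamily q t M) (z : ℂ) :
    dia P hM (qfac q t z) * (mulOp (X (Fin.last m)) * phiOp q) =
      mulOp (X (Fin.last m)) * phiOp q * ((1 - z • yop q t) * dia P hM (qfac q t z)) := by
  refine ext_TE P hM fun u => ?_
  have hs : spec q t u 0 / (1 - q * spec q t u 0) ≠ 0 :=
    div_ne_zero (spec_ne_zero P u 0) (one_sub_q_spec_ne u P)
  have h1 := TE_Phi P hM u
  rw [← smul_eq_C_mul] at h1
  have h2 : X (Fin.last m) * rotA q (TE q t M u) =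
      (spec q t u 0 / (1 - q * spec q t u 0))⁻¹ • TE q t M (Phi u) := by
    rw [h1, smul_smul, inv_mul_cancel₀ hs, one_smul]
  set B : Module.End ℂ (Pol m) := mulOp (X (Fin.last m)) * phiOp q with hB
  have h3 : B (TE q t M u) = (spec q t u 0 / (1 - q * spec q t u 0))⁻¹ • TE q t M (Phi u) := by
    rw [← h2, hB, Module.End.mul_apply, mulOp_apply, phiOp_apply]
  clear_value B
  rw [Module.End.mul_apply, Module.End.mul_apply, Module.End.mul_apply, h3]
  simp only [dia_TE, map_smul, LinearMap.sub_apply, LinearMap.smul_apply, Module.End.one_apply,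
    yop_TE P hM, map_sub, h3, qfac_Phi]
  module

lemma X_phi_Yop (P : Params q t) :
    mulOp (X (Fin.last m)) * phiOp q * Yop q t =
      t ^ m • (cycInv t (Fin.last m) * mulOp (X 0)) := by
  refine LinearMap.ext fun f => ?_
  have := X_mul_cyc P.t_ne (Fin.last m) f
  rw [Fin.val_last] at this
  simp only [Yop, Module.End.mul_apply, phiOp_apply, psiOp_apply, rotA_rotB P.q_ne, mulOp_apply,
    LinearMap.smul_apply, smul_eq_C_mul, this]

lemma cycInv_injective (ht : t ≠ 0) (k : Fin (m + 1)) : Function.Injective (cycInv t k) := by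
  induction k using Fin.induction with
  | zero => exact Function.injective_id
  | succ i ih =>
    intro f g h
    rw [cycInv_succ, Module.End.mul_apply, Module.End.mul_apply] at h
    refine ih ?_
    rw [← heckeT_heckeTinv ht i (cycInv t i.castSucc f), h, heckeT_heckeTinv ht]

lemma cycInv_cancel (ht : t ≠ 0) {A B : Module.End ℂ (Pol m)}
    (h : cycInv t (Fin.last m) * A = cycInv t (Fin.last m) * B) : A = B :=
  LinearMap.ext fun f => cycInv_injective ht (Fin.last m) (LinearMap.congr_fun h f)

lemma smul_cancel {c : ℂ} (hc : c ≠ 0) {A B : Module.End ℂ (Pol m)} (h : c • A = c • B) :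
    A = B := by
  rw [← inv_smul_smul₀ hc A, h, inv_smul_smul₀ hc]

lemma dia_qfac_X_zero (P : Params q t) (hM : IsInterpFamily q t M) (z : ℂ) :
    dia P hM (qfac q t z) * mulOp (X 0) =
      mulOp (X 0) * ((1 - z • yop q t) * dia P hM (qfac q t z)) := by
  have htm : t ^ m ≠ 0 := pow_ne_zero _ P.t_ne
  suffices h : t ^ m • (cycInv t (Fin.last m) * (dia P hM (qfac q t z) * mulOp (X 0))) =
      t ^ m • (cycInv t (Fin.last m) *
        (mulOp (X 0) * ((1 - z • yop q t) * dia P hM (qfac q t z)))) from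
    cycInv_cancel P.t_ne (smul_cancel htm h)
  have h1 := X_phi_Yop (m := m) P
  have h2 := dia_qfac_X_phi P hM z
  have h3 : Commute (dia P hM (qfac q t z)) (cycInv t (Fin.last m)) :=
    commute_cycInv (fun i => dia_commute_heckeT P hM fun u => qfac_comp_sw u q t z i) _
  have h4 : Commute (dia P hM (qfac q t z)) (Yop q t) := by
    rw [Yop_eq_dia P hM]; exact dia_commute P hM _ _
  have h5 : Commute (1 - z • yop q t) (Yop (m := m) q t) :=
    (Commute.one_left _).sub_left
      (((Commute.refl (Yop q t)).smul_left (t ^ m)⁻¹).smul_left z)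
  rw [← mul_assoc, ← h3.eq, mul_assoc, ← mul_smul_comm, ← h1, ← mul_assoc, h2, mul_assoc,
    mul_assoc (1 - z • yop q t), h4.eq, ← mul_assoc (1 - z • yop q t), h5.eq, mul_assoc (Yop q t),
    ← mul_assoc, h1, smul_mul_assoc, mul_assoc]

/-- The operator `y + z x₀` as a power series in `z`. -/
def Xi (q t : ℂ) : PowerSeries (Module.End ℂ (Pol m)) :=
  PowerSeries.C (yop q t) + PowerSeries.C (mulOp (X 0)) * PowerSeries.X

/-- The operator `y + z x₀ (1 - a y)` as a power series in `z`. -/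
def Xia (q t a : ℂ) : PowerSeries (Module.End ℂ (Pol m)) :=
  PowerSeries.C (yop q t) + PowerSeries.C (mulOp (X 0) - a • (mulOp (X 0) * yop q t)) *
    PowerSeries.X

/-- Multiplication by the kernel. -/
def FO (a b q : ℂ) : PowerSeries (Module.End ℂ (Pol m)) :=
  PowerSeries.mk fun k => mulOp (Fc a b q k)

lemma commute_yop_dia (P : Params q t) (hM : IsInterpFamily q t M)
    (g : (Fin (m + 1) → ℕ) → ℂ) : Commute (yop q t) (dia P hM g) := by
  rw [yop, Yop_eq_dia P hM]
  exact (dia_commute P hM _ _).smul_left _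

lemma dia_Xi (P : Params q t) (hM : IsInterpFamily q t M) (a : ℂ) :
    PowerSeries.C (dia P hM (qfac q t a)) * Xi q t =
      Xia q t a * PowerSeries.C (dia P hM (qfac q t a)) := by
  have h := dia_qfac_X_zero P hM a
  rw [← mul_assoc, mul_sub, mul_one, mul_smul_comm] at h
  rw [Xi, Xia, mul_add, add_mul, ← map_mul, ← mul_assoc, ← map_mul, h,
    ← (commute_yop_dia P hM (qfac q t a)).eq, mul_assoc _ PowerSeries.X,
    PowerSeries.X_mul, ← mul_assoc,
    ← map_mul, ← map_mul]

lemma dia_inv_Xia (P : Params q t) (hM : IsInterpFamily q t M) {c : ℂ}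
    (hc : ∀ u : Fin (m + 1) → ℕ, qfac q t c u ≠ 0) :
    PowerSeries.C (dia P hM fun u => (qfac q t c u)⁻¹) * Xia q t c =
      Xi q t * PowerSeries.C (dia P hM fun u => (qfac q t c u)⁻¹) := by
  have h := congrArg (fun A => PowerSeries.C (dia P hM fun u => (qfac q t c u)⁻¹) * A *
    PowerSeries.C (dia P hM fun u => (qfac q t c u)⁻¹)) (dia_Xi P hM c)
  simp only [← mul_assoc] at h
  rw [← map_mul, dia_inv_mul P hM hc, map_one, one_mul, mul_assoc (_ * Xia q t c), ← map_mul,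
    dia_mul_inv P hM hc, map_one, mul_one] at h
  exact h.symm

lemma FO_Xia (P : Params q t) (a b : ℂ) :
    FO (m := m) a b q * Xia q t a = Xia q t b * FO a b q := by
  ext1 k
  rw [Xia, Xia, mul_add, add_mul, ← mul_assoc, mul_assoc _ PowerSeries.X, PowerSeries.X_mul,
    ← mul_assoc, map_add, map_add, PowerSeries.coeff_mul_C, PowerSeries.coeff_C_mul]
  cases k with
  | zero =>
    simp only [FO, PowerSeries.coeff_mk, Fc_zero, PowerSeries.coeff_zero_mul_X, add_zero]
    exact LinearMap.ext fun f => by simp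
  | succ k =>
    rw [PowerSeries.coeff_succ_mul_X, PowerSeries.coeff_succ_mul_X, PowerSeries.coeff_mul_C,
      PowerSeries.coeff_C_mul]
    simp only [FO, PowerSeries.coeff_mk]
    have h := congrArg (fun A => (t ^ m)⁻¹ • A) (mulOp_Fc_Yop (m := m) P a b k)
    have h1 := (mulOp_commute (Fc a b q k) (X 0 : Pol m)).eq
    simp only [smul_sub, smul_comm (t ^ m)⁻¹ a, smul_comm (t ^ m)⁻¹ b] at h
    simp only [yop, mul_sub, sub_mul, mul_smul_comm, smul_mul_assoc, h1]
    rw [sub_eq_sub_iff_add_eq_add] at h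
    rw [← sub_eq_zero] at h ⊢
    rw [← h]
    abel

/-- A power series of operators whose coefficients raise degrees accordingly. -/
def SRaises (K : PowerSeries (Module.End ℂ (Pol m))) : Prop :=
  ∀ k, Raises k (PowerSeries.coeff k K)

lemma raises_zero (k : ℕ) : Raises (m := m) k 0 := fun _ _ _ => isHomogeneous_zero _ _ _

lemma SRaises.mul {K L : PowerSeries (Module.End ℂ (Pol m))} (hK : SRaises K) (hL : SRaises L) :
    SRaises (K * L) := fun k => by
  rw [PowerSeries.coeff_mul]
  intro d f hf
  rw [LinearMap.sum_apply]
  refine IsHomogeneous.sum _ _ _ fun p hp => ?_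
  have := (hK p.1).comp (hL p.2) d f hf
  rwa [add_comm p.2 p.1, Finset.HasAntidiagonal.mem_antidiagonal.1 hp] at this

lemma sraises_C {A : Module.End ℂ (Pol m)} (hA : Raises 0 A) : SRaises (PowerSeries.C A) :=
  fun k => by
    rw [PowerSeries.coeff_C]
    split_ifs with h
    · rw [h]; exact hA
    · exact raises_zero k

lemma sraises_FO (a b q : ℂ) : SRaises (m := m) (FO a b q) := fun k => by
  rw [FO, PowerSeries.coeff_mk]
  exact mulOp_Fc_raises a b q k

lemma commute_FO (a b q t : ℂ) (i : Fin m) : Commute (FO a b q) (PowerSeries.C (heckeT t i)) := by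
  ext1 k
  rw [PowerSeries.coeff_mul_C, PowerSeries.coeff_C_mul, FO, PowerSeries.coeff_mk]
  exact commute_mulOp_Fc a b q t k i

lemma commute_C_C {A B : Module.End ℂ (Pol m)} (h : Commute A B) :
    Commute (PowerSeries.C A) (PowerSeries.C B) := h.map PowerSeries.C

lemma eq_of_Xi (P : Params q t) {K L : PowerSeries (Module.End ℂ (Pol m))} {a : ℂ}
    (hK : SRaises K) (hL : SRaises L)
    (h0 : PowerSeries.coeff 0 K = PowerSeries.coeff 0 L)
    (hKT : ∀ i, Commute K (PowerSeries.C (heckeT t i)))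
    (hLT : ∀ i, Commute L (PowerSeries.C (heckeT t i)))
    (hKX : K * Xi q t = Xia q t a * K) (hLX : L * Xi q t = Xia q t a * L) : K = L := by
  have hT : ∀ {K : PowerSeries (Module.End ℂ (Pol m))},
      (∀ i, Commute K (PowerSeries.C (heckeT t i))) →
      ∀ i k, Commute (PowerSeries.coeff k K) (heckeT t i) := by
    intro K h i k
    have := congrArg (PowerSeries.coeff k) (h i).eq
    rwa [PowerSeries.coeff_mul_C, PowerSeries.coeff_C_mul] at this
  have hX : ∀ {K : PowerSeries (Module.End ℂ (Pol m))}, K * Xi q t = Xia q t a * K → ∀ k,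
      PowerSeries.coeff (k + 1) K * ((t ^ m)⁻¹ • Yop q t) + PowerSeries.coeff k K * mulOp (X 0) =
      ((t ^ m)⁻¹ • Yop q t) * PowerSeries.coeff (k + 1) K +
        (mulOp (X 0) - a • (mulOp (X 0) * yop q t)) * PowerSeries.coeff k K := by
    intro K h k
    have := congrArg (PowerSeries.coeff (k + 1)) h
    rw [Xi, Xia, mul_add, add_mul, ← mul_assoc, mul_assoc _ PowerSeries.X K, PowerSeries.X_mul,
      ← mul_assoc, map_add, map_add, PowerSeries.coeff_mul_C, PowerSeries.coeff_C_mul,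
      PowerSeries.coeff_succ_mul_X, PowerSeries.coeff_succ_mul_X, PowerSeries.coeff_mul_C,
      PowerSeries.coeff_C_mul] at this
    exact this
  ext1 k
  exact eq_of_intertwine P (inv_ne_zero (pow_ne_zero m P.t_ne)) hK hL h0 (hT hKT) (hT hLT)
    (hX hKX) (hX hLX) k

/-- The operator form of the Euler transformation. -/
theorem euler_operator (P : Params q t) (hM : IsInterpFamily q t M) (a b : ℂ) {c : ℂ}
    (hc : ∀ u : Fin (m + 1) → ℕ, qfac q t c u ≠ 0) :
    PowerSeries.C (dia P hM (qfac q t a)) * (PowerSeries.C (dia P hM fun u => (qfac q t c u)⁻¹) *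
        (FO b c q * PowerSeries.C (dia P hM (qfac q t b)))) =
      FO b a q * (PowerSeries.C (dia P hM (qfac q t b)) *
        (PowerSeries.C (dia P hM fun u => (qfac q t c u)⁻¹) *
          (FO a c q * PowerSeries.C (dia P hM (qfac q t a))))) := by
  have r : ∀ g, SRaises (PowerSeries.C (dia P hM g)) := fun g => sraises_C (dia_raises P hM g)
  have cT : ∀ z i, Commute (PowerSeries.C (dia P hM (qfac q t z))) (PowerSeries.C (heckeT t i)) :=
    fun z i => commute_C_C (dia_commute_heckeT P hM fun u => qfac_comp_sw u q t z i)
  have cT' : ∀ i, Commute (PowerSeries.C (dia P hM fun u => (qfac q t c u)⁻¹))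
      (PowerSeries.C (heckeT t i)) :=
    fun i => commute_C_C (dia_commute_heckeT P hM fun u => by rw [qfac_comp_sw])
  refine eq_of_Xi P (a := a) ((r _).mul ((r _).mul ((sraises_FO _ _ _).mul (r _))))
    ((sraises_FO _ _ _).mul ((r _).mul ((r _).mul ((sraises_FO _ _ _).mul (r _))))) ?_
    (fun i => (cT _ i).mul_left ((cT' i).mul_left ((commute_FO _ _ _ _ i).mul_left (cT _ i))))
    (fun i => (commute_FO _ _ _ _ i).mul_left ((cT _ i).mul_left ((cT' i).mul_left
      ((commute_FO _ _ _ _ i).mul_left (cT _ i))))) ?_ ?_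
  · have h1 : mulOp (1 : Pol m) = 1 := LinearMap.ext fun f => by simp
    simp only [PowerSeries.coeff_zero_eq_constantCoeff, map_mul, PowerSeries.constantCoeff_C]
    simp only [← PowerSeries.coeff_zero_eq_constantCoeff, FO, PowerSeries.coeff_mk, Fc_zero, h1,
      one_mul]
    refine ext_TE P hM fun u => ?_
    simp only [Module.End.mul_apply, dia_TE, map_smul]
    module
  · simp only [mul_assoc]
    rw [dia_Xi, ← mul_assoc (FO b c q), FO_Xia P, mul_assoc, ← mul_assoc _ (Xia q t c),
      dia_inv_Xia P hM hc, mul_assoc, ← mul_assoc _ (Xi q t), dia_Xi, mul_assoc]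
  · simp only [mul_assoc]
    rw [dia_Xi, ← mul_assoc (FO a c q), FO_Xia P, mul_assoc, ← mul_assoc _ (Xia q t c),
      dia_inv_Xia P hM hc, mul_assoc, ← mul_assoc _ (Xi q t), dia_Xi, mul_assoc,
      ← mul_assoc _ (Xia q t b), FO_Xia P, mul_assoc]

end

/-- The compositions of weight at most `N`. -/
def compsLE (n N : ℕ) : Finset (Fin n → ℕ) := (Finset.range (N + 1)).biUnion (comps n)

@[simp] lemma mem_compsLE {N : ℕ} {u : Fin n → ℕ} : u ∈ compsLE n N ↔ wt u ≤ N := by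
  simp [compsLE]

section
variable {m : ℕ} {q t : ℂ} {M : (Fin (m + 1) → ℕ) → Pol m}

/-- The bilinear form for which the `TE u` are orthogonal of square norm `hev u`. -/
def pr (P : Params q t) (hM : IsInterpFamily q t M) : Pol m →ₗ[ℂ] Pol m →ₗ[ℂ] ℂ :=
  (TEb P hM).constr ℂ fun u => hev q t M u • (TEb P hM).coord u

lemma pr_TE (P : Params q t) (hM : IsInterpFamily q t M) (u : Fin (m + 1) → ℕ) (f : Pol m) :
    pr P hM (TE q t M u) f = hev q t M u * (TEb P hM).repr f u := by
  have h := (TEb P hM).constr_basis ℂ (fun u => hev q t M u • (TEb P hM).coord u) u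
  rw [TEb_apply] at h
  rw [pr, h, LinearMap.smul_apply, Module.Basis.coord_apply, smul_eq_mul]

lemma repr_TE (P : Params q t) (hM : IsInterpFamily q t M) (u v : Fin (m + 1) → ℕ) :
    (TEb P hM).repr (TE q t M u) v = if u = v then 1 else 0 := by
  rw [← TEb_apply P hM u, Module.Basis.repr_self, Finsupp.single_apply]

lemma pr_TE_TE (P : Params q t) (hM : IsInterpFamily q t M) (u v : Fin (m + 1) → ℕ) :
    pr P hM (TE q t M u) (TE q t M v) = if v = u then hev q t M u else 0 := by
  rw [pr_TE, repr_TE, mul_ite, mul_one, mul_zero]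

lemma eq_of_pr (P : Params q t) (hM : IsInterpFamily q t M) {f g : Pol m}
    (h : ∀ u, pr P hM (TE q t M u) f = pr P hM (TE q t M u) g) : f = g := by
  refine (TEb P hM).ext_elem fun u => ?_
  have := h u
  rw [pr_TE, pr_TE] at this
  exact mul_left_cancel₀ (hev_ne_zero P hM u) this

lemma ext_pr (P : Params q t) (hM : IsInterpFamily q t M) {B B' : Pol m →ₗ[ℂ] Pol m →ₗ[ℂ] ℂ}
    (h : ∀ u v, B (TE q t M u) (TE q t M v) = B' (TE q t M u) (TE q t M v)) (f g : Pol m) :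
    B f g = B' f g := by
  have : B = B' := (TEb P hM).ext fun u => (TEb P hM).ext fun v => by simpa using h u v
  rw [this]

/-- `A'` is adjoint to `A`. -/
def Adj (P : Params q t) (hM : IsInterpFamily q t M) (A A' : Module.End ℂ (Pol m)) : Prop :=
  ∀ f g, pr P hM (A f) g = pr P hM f (A' g)

lemma adj_of_TE (P : Params q t) (hM : IsInterpFamily q t M) {A A' : Module.End ℂ (Pol m)}
    (h : ∀ u v, pr P hM (A (TE q t M u)) (TE q t M v) = pr P hM (TE q t M u) (A' (TE q t M v))) :
    Adj P hM A A' :=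
  ext_pr P hM (B := (pr P hM).comp A) (B' := (pr P hM).compl₂ A') h

lemma adj_heckeT (P : Params q t) (hM : IsInterpFamily q t M) (i : Fin m) :
    Adj P hM (heckeT t i) (heckeT t i) := by
  refine adj_of_TE P hM fun u v => ?_
  have key : (v = u ∘ sw i) ↔ (v ∘ sw i = u) :=
    ⟨fun h => by rw [h, comp_sw_sw], fun h => by rw [← h, comp_sw_sw]⟩
  simp only [heckeT_TE P hM, map_add, map_smul, LinearMap.add_apply, LinearMap.smul_apply,
    pr_TE_TE, smul_eq_mul]
  by_cases h1 : v = u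
  · subst h1
    by_cases h2 : v ∘ sw i = v
    · simp [h2]
    · rw [if_neg h2, if_neg fun h => h2 (key.1 h)]
  · rw [if_neg h1]
    by_cases h2 : v = u ∘ sw i
    · subst h2
      rw [comp_sw_sw, if_pos rfl, if_pos rfl, hev_comp_sw P hM]
      simp
    · rw [if_neg h2, if_neg fun h => h2 (key.2 h)]
      simp

lemma adj_Yop (P : Params q t) (hM : IsInterpFamily q t M) :
    Adj P hM (Yop q t) (Yop q t) := by
  refine adj_of_TE P hM fun u v => ?_
  simp only [Yop_TE P hM, map_smul, LinearMap.smul_apply, pr_TE_TE]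
  split_ifs with h
  · rw [h]
  · simp

lemma pr_cyc_cycInv (P : Params q t) (hM : IsInterpFamily q t M) (k : Fin (m + 1)) (f g : Pol m) :
    pr P hM (cyc t k f) (cycInv t k g) = pr P hM f g := by
  induction k using Fin.induction with
  | zero => rfl
  | succ i ih =>
    rw [cyc_succ, cycInv_succ, Module.End.mul_apply, Module.End.mul_apply, adj_heckeT,
      heckeT_heckeTinv P.t_ne, ih]

lemma adj_psiOp (P : Params q t) (hM : IsInterpFamily q t M) :
    Adj P hM (psiOp q) (cycInv t (Fin.last m) * Yop q t) := by
  intro f g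
  obtain ⟨f, rfl⟩ := cyc_surjective P.t_ne (Fin.last m) f
  rw [Module.End.mul_apply, pr_cyc_cycInv, ← adj_Yop P hM]
  rfl

open Classical in
/-- The lowering operator inverse to the affine raising operator. -/
def ell (P : Params q t) (hM : IsInterpFamily q t M) : Module.End ℂ (Pol m) :=
  (TEb P hM).constr ℂ fun w => if h : ∃ u, Phi u = w then
    spec q t h.choose 0 • TE q t M h.choose else 0

lemma ell_Phi (P : Params q t) (hM : IsInterpFamily q t M) (u : Fin (m + 1) → ℕ) :
    ell P hM (TE q t M (Phi u)) = spec q t u 0 • TE q t M u := by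
  have h : ∃ w, Phi w = Phi u := ⟨u, rfl⟩
  have h1 : h.choose = u := Phi_injective h.choose_spec
  rw [ell, ← TEb_apply P hM (Phi u), Module.Basis.constr_basis, dif_pos h, h1]

lemma ell_of_last (P : Params q t) (hM : IsInterpFamily q t M) {w : Fin (m + 1) → ℕ}
    (hw : w (Fin.last m) = 0) : ell P hM (TE q t M w) = 0 := by
  have h : ¬∃ u, Phi u = w := by
    rintro ⟨u, rfl⟩
    simp at hw
  rw [ell, ← TEb_apply P hM w, Module.Basis.constr_basis, dif_neg h]

lemma X_phi_TE (P : Params q t) (hM : IsInterpFamily q t M) (u : Fin (m + 1) → ℕ) :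
    spec q t u 0 • (mulOp (X (Fin.last m)) * phiOp q : Module.End ℂ (Pol m)) (TE q t M u) =
      (1 - q * spec q t u 0) • TE q t M (Phi u) := by
  have h := one_sub_q_spec_ne u P
  rw [TE_Phi P hM, ← smul_eq_C_mul, smul_smul, mul_div_cancel₀ _ h]
  rfl

lemma X_phi_ell (P : Params q t) (hM : IsInterpFamily q t M) (w : Fin (m + 1) → ℕ) :
    (mulOp (X (Fin.last m)) * phiOp q : Module.End ℂ (Pol m)) (ell P hM (TE q t M w)) =
      (1 - spec q t w (Fin.last m)) • TE q t M w := by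
  by_cases hw : w (Fin.last m) = 0
  · rw [ell_of_last P hM hw, map_zero, spec_last_of_zero w q t hw, sub_self, zero_smul]
  · obtain ⟨u, rfl⟩ := exists_Phi w hw
    rw [ell_Phi, map_smul, X_phi_TE P hM, spec_Phi_last]

lemma adj_ell (P : Params q t) (hM : IsInterpFamily q t M) :
    Adj P hM (ell P hM) (cycInv t (Fin.last m) * (mulOp (X 0) * Yop q t)) := by
  have htm : t ^ m ≠ 0 := pow_ne_zero _ P.t_ne
  refine adj_of_TE P hM fun w u => ?_
  have h1 : t ^ m • (cycInv t (Fin.last m) * (mulOp (X 0) * Yop q t) : Module.End ℂ (Pol m))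
      (TE q t M u) =
      (spec q t u 0 * (1 - q * spec q t u 0)) • TE q t M (Phi u) := by
    rw [← mul_assoc, ← LinearMap.smul_apply, ← smul_mul_assoc, ← X_phi_Yop P,
      Module.End.mul_apply, Module.End.mul_apply, Yop_TE P hM, map_smul, map_smul, Yop_TE P hM,
      map_smul, X_phi_TE P hM, smul_smul]
  refine mul_left_cancel₀ htm ?_
  have h2 := congrArg (pr P hM (TE q t M w)) h1
  rw [map_smul, map_smul, pr_TE_TE, smul_eq_mul] at h2
  rw [h2]
  by_cases hw : w (Fin.last m) = 0
  · have h3 : Phi u ≠ w := by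
      rintro rfl
      simp at hw
    rw [ell_of_last P hM hw, if_neg h3]
    simp
  · obtain ⟨w, rfl⟩ := exists_Phi w hw
    rw [ell_Phi, map_smul, LinearMap.smul_apply, pr_TE_TE]
    by_cases h3 : u = w
    · subst h3
      have h4 := hev_Phi P hM u
      simp only [if_true, smul_eq_mul]
      linear_combination -spec q t u 0 * h4
    · rw [if_neg h3, if_neg fun h => h3 (Phi_injective h)]
      simp

/-- The operator taking `TE u` to `MM u`. -/
def Bop (P : Params q t) (hM : IsInterpFamily q t M) : Module.End ℂ (Pol m) :=
  (TEb P hM).constr ℂ (MM q t M)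

@[simp] lemma Bop_TE (P : Params q t) (hM : IsInterpFamily q t M) (u : Fin (m + 1) → ℕ) :
    Bop P hM (TE q t M u) = MM q t M u := by
  rw [Bop, ← TEb_apply P hM u, Module.Basis.constr_basis]

lemma Bop_heckeT (P : Params q t) (hM : IsInterpFamily q t M) (i : Fin m) :
    Commute (Bop P hM) (heckeT t i) :=
  ext_TE P hM fun u => by
    simp only [Module.End.mul_apply, heckeT_TE P hM, map_add, map_smul, Bop_TE, heckeT_MM P hM]
    simp only [smul_eq_C_mul]

lemma Bop_homogeneous (P : Params q t) (hM : IsInterpFamily q t M) {d : ℕ} {f : Pol m}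
    (hf : f.IsHomogeneous d) : (Bop P hM f).totalDegree ≤ d ∧
      homogeneousComponent d (Bop P hM f) = f ∧
      ∀ v, wt v < d → eval (spec q t v) (Bop P hM f) = 0 := by
  refine Submodule.span_induction (p := fun f _ => (Bop P hM f).totalDegree ≤ d ∧
      homogeneousComponent d (Bop P hM f) = f ∧
      ∀ v, wt v < d → eval (spec q t v) (Bop P hM f) = 0) ?_ ?_ ?_ ?_ (mem_span_TE P hM hf)
  · rintro _ ⟨w, hw, rfl⟩
    have hw : wt w = d := hw
    subst hw
    rw [Bop_TE]
    refine ⟨totalDegree_MM_le hM w, rfl, fun v hv => eval_MM_of_ne hM hv.le ?_⟩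
    rintro rfl
    exact lt_irrefl _ hv
  · simp
  · rintro f g - - ⟨h1, h2, h3⟩ ⟨h4, h5, h6⟩
    refine ⟨?_, by rw [map_add, map_add, h2, h5], fun v hv => by
      rw [map_add, map_add, h3 v hv, h6 v hv, add_zero]⟩
    rw [map_add]
    exact (totalDegree_add _ _).trans (max_le h1 h4)
  · rintro c f - ⟨h1, h2, h3⟩
    refine ⟨?_, by rw [map_smul, map_smul, h2], fun v hv => by
      rw [map_smul, smul_eval, h3 v hv, mul_zero]⟩
    rw [map_smul]
    exact (totalDegree_smul_le _ _).trans h1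

lemma Bop_injective (P : Params q t) (hM : IsInterpFamily q t M) :
    Function.Injective (Bop P hM) := by
  refine (injective_iff_map_eq_zero _).2 fun f hf => ?_
  have key : ∀ N u, wt u = N → (TEb P hM).repr f u = 0 := by
    intro N
    induction N using Nat.strong_induction_on with
    | _ N ih =>
      intro u hu
      have h1 := congrArg (eval (spec q t u)) hf
      rw [← (TEb P hM).linearCombination_repr f, Finsupp.linearCombination_apply, Finsupp.sum,
        map_sum, map_sum, map_zero, Finset.sum_eq_single u] at h1
      · rw [map_smul, TEb_apply, Bop_TE, smul_eval] at h1
        exact (mul_eq_zero.1 h1).resolve_right (zet_ne_zero P hM u)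
      · intro v _ hv
        rw [map_smul, TEb_apply, Bop_TE, smul_eval]
        rcases lt_or_ge (wt v) N with h | h
        · rw [ih _ h v rfl, zero_mul]
        · rw [eval_MM_of_ne hM (by omega) hv.symm, mul_zero]
      · intro h
        rw [Finsupp.notMem_support_iff.1 h]
        simp
  exact (TEb P hM).ext_elem fun u => by rw [key _ u rfl]; simp

lemma Bop_X_last (P : Params q t) (hM : IsInterpFamily q t M) (w : Fin (m + 1) → ℕ) :
    Bop P hM (X (Fin.last m) * TE q t M w) =
      (X (Fin.last m) - C (spec q t w (Fin.last m))) * MM q t M w := by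
  have hX : (X (Fin.last m) * TE q t M w).IsHomogeneous (1 + wt w) :=
    (isHomogeneous_X _ _).mul (TE_isHomogeneous w)
  obtain ⟨h1, h2, h3⟩ := Bop_homogeneous P hM hX
  have h4 : homogeneousComponent (1 + wt w)
      ((X (Fin.last m) - C (spec q t w (Fin.last m))) * MM q t M w) =
      X (Fin.last m) * TE q t M w := by
    rw [sub_mul, map_sub, ← smul_eq_C_mul, map_smul, hc_MM hM (by omega), if_neg (by omega),
      smul_zero, sub_zero]
    have := (mulOp_raises (isHomogeneous_X ℂ (Fin.last m))).hc (wt w) (MM q t M w)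
    rwa [add_comm (wt w) 1] at this
  have h5 : ((X (Fin.last m) - C (spec q t w (Fin.last m))) * MM q t M w).totalDegree ≤
      1 + wt w := by
    refine (totalDegree_mul _ _).trans (add_le_add ?_ (totalDegree_MM_le hM w))
    refine (totalDegree_sub _ _).trans (max_le ?_ ?_)
    · rw [totalDegree_X]
    · rw [totalDegree_C]; exact Nat.zero_le _
  rw [← sub_eq_zero]
  have h6 := (totalDegree_sub _ _).trans (max_le h1 h5)
  have h7 : homogeneousComponent (1 + wt w) (Bop P hM (X (Fin.last m) * TE q t M w) -
      (X (Fin.last m) - C (spec q t w (Fin.last m))) * MM q t M w) = 0 := by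
    rw [map_sub, h2, h4, sub_self]
  rcases totalDegree_lt_or_eq_zero h6 h7 with h8 | h8
  · exact h8
  refine eq_zero_of_vanishes_spec P (N := wt w) (by omega) fun v hv => ?_
  rw [map_sub, h3 v (by omega), map_mul, map_sub, eval_X, eval_C]
  by_cases h9 : v = w
  · rw [h9]; ring
  · rw [eval_MM_of_ne hM hv h9]; ring

lemma Bop_X_phi (P : Params q t) (hM : IsInterpFamily q t M) :
    Bop P hM * (mulOp (X (Fin.last m)) * phiOp q) =
      mulOp (X (Fin.last m) - 1) * phiOp q * Bop P hM := by
  refine ext_TE P hM fun u => ?_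
  have h0 := spec_ne_zero P u 0
  have h1 := congrArg (Bop P hM) (X_phi_TE P hM u)
  rw [map_smul, map_smul, Bop_TE, MM_Phi P hM, ← smul_eq_C_mul, smul_smul,
    mul_div_cancel₀ _ (one_sub_q_spec_ne u P)] at h1
  have h2 := congrArg (fun g => (spec q t u 0)⁻¹ • g) h1
  simp only [inv_smul_smul₀ h0] at h2
  rw [Module.End.mul_apply, h2]
  simp

lemma psiOp_Bop (P : Params q t) (hM : IsInterpFamily q t M) :
    psiOp q * Bop P hM = Bop P hM * (psiOp q - ell P hM) := by
  have hX1 : (X (Fin.last m) - 1 : Pol m) ≠ 0 := by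
    intro h
    have := congrArg (eval (fun _ => (0 : ℂ))) h
    simp at this
  have hinj : ∀ f g : Pol m,
      (mulOp (X (Fin.last m) - 1) * phiOp q : Module.End ℂ (Pol m)) f =
      (mulOp (X (Fin.last m) - 1) * phiOp q : Module.End ℂ (Pol m)) g → f = g := by
    intro f g h
    simp only [Module.End.mul_apply, mulOp_apply, phiOp_apply] at h
    have := congrArg (rotB q) (mul_left_cancel₀ hX1 h)
    rwa [rotB_rotA P.q_ne, rotB_rotA P.q_ne] at this
  refine ext_TE P hM fun w => hinj _ _ ?_
  rw [← Module.End.mul_apply, ← Module.End.mul_apply, ← mul_assoc, ← mul_assoc, ← Bop_X_phi P hM,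
    mul_assoc (mulOp _), phiOp_mul_psiOp P.q_ne, mul_one,
    Module.End.mul_apply, Bop_TE, mul_assoc, mul_sub, Module.End.mul_apply, LinearMap.sub_apply,
    Module.End.mul_apply _ (ell P hM), X_phi_ell, mul_assoc, phiOp_mul_psiOp P.q_ne, mul_one,
    map_sub, map_smul, Bop_TE, mulOp_apply, mulOp_apply, Bop_X_last P hM, smul_eq_C_mul, C_sub, C_1]
  ring

end

section
variable {m : ℕ} {q t : ℂ} {M : (Fin (m + 1) → ℕ) → Pol m}

lemma scl_scl (c d : ℂ) (f : Pol m) : scl c (scl d f) = scl (c * d) f := by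
  have : (scl c).comp (scl d) = (scl (c * d) : Pol m →ₐ[ℂ] Pol m) :=
    algHom_ext fun i => by simp [scl]; ring
  exact DFunLike.congr_fun this f

lemma scl_rotB (c : ℂ) (f : Pol m) : scl c (rotB q f) = rotB q (scl c f) := by
  have : (scl c).comp (rotB q) = (rotB q).comp (scl c : Pol m →ₐ[ℂ] Pol m) :=
    algHom_ext fun i => by
      refine Fin.lastCases ?_ (fun i => ?_) i
      · simp [scl]; ring
      · simp [scl]
  exact DFunLike.congr_fun this f

/-- The scaling operator `f(x) ↦ f(c x)`. -/
def sOp (c : ℂ) : Module.End ℂ (Pol m) := (scl c).toLinearMap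

@[simp] lemma sOp_apply (c : ℂ) (f : Pol m) : sOp c f = scl c f := rfl

lemma scl_TE (c : ℂ) (u : Fin (m + 1) → ℕ) : scl c (TE q t M u) = c ^ wt u • TE q t M u :=
  scl_of_homogeneous c (TE_isHomogeneous u)

lemma sOp_mul_inv (P : Params q t) (hM : IsInterpFamily q t M) {c : ℂ} (hc : c ≠ 0) :
    sOp (m := m) c * sOp c⁻¹ = 1 :=
  ext_TE P hM fun u => by
    rw [Module.End.mul_apply, sOp_apply, sOp_apply, scl_scl, mul_inv_cancel₀ hc, scl_TE]; simp

lemma commute_sOp_heckeT (P : Params q t) (hM : IsInterpFamily q t M) (c : ℂ) (i : Fin m) :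
    Commute (sOp c) (heckeT t i) :=
  ext_TE P hM fun u => by
    simp only [Module.End.mul_apply, sOp_apply, scl_TE, heckeT_TE P hM, map_add, map_smul,
      wt_comp_sw]
    module

lemma ell_sOp (P : Params q t) (hM : IsInterpFamily q t M) (c : ℂ) :
    ell P hM * sOp c = c • (sOp c * ell P hM) := by
  refine ext_TE P hM fun w => ?_
  rw [LinearMap.smul_apply, Module.End.mul_apply, Module.End.mul_apply, sOp_apply, scl_TE, map_smul]
  by_cases hw : w (Fin.last m) = 0
  · rw [ell_of_last P hM hw]; simp
  · obtain ⟨u, rfl⟩ := exists_Phi w hw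
    rw [ell_Phi, map_smul, sOp_apply, scl_TE, wt_Phi, pow_succ]
    module

/-- The operator taking `TE u` to a multiple of `MM u (x / a)`. -/
def Bs (P : Params q t) (hM : IsInterpFamily q t M) (a : ℂ) : Module.End ℂ (Pol m) :=
  sOp a⁻¹ * Bop P hM * sOp a

lemma Bs_TE (P : Params q t) (hM : IsInterpFamily q t M) (a : ℂ) (u : Fin (m + 1) → ℕ) :
    Bs P hM a (TE q t M u) = a ^ wt u • scl a⁻¹ (MM q t M u) := by
  simp only [Bs, Module.End.mul_apply, sOp_apply, scl_TE, map_smul, Bop_TE]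

lemma Bs_injective (P : Params q t) (hM : IsInterpFamily q t M) {a : ℂ} (ha : a ≠ 0) :
    Function.Injective (Bs P hM a) := by
  have h : ∀ {c : ℂ}, c ≠ 0 → Function.Injective (sOp (m := m) c) := by
    intro c hc f g hfg
    have h1 := congrArg (scl c⁻¹) hfg
    simp only [sOp_apply, scl_scl, inv_mul_cancel₀ hc] at h1
    have h2 : ∀ f : Pol m, scl 1 f = f := fun f => by
      have := LinearMap.congr_fun (sOp_mul_inv (m := m) P hM one_ne_zero) f
      rwa [Module.End.mul_apply, sOp_apply, sOp_apply, scl_scl, mul_inv_cancel₀ one_ne_zero] at this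
    rwa [h2, h2] at h1
  intro f g hfg
  simp only [Bs, Module.End.mul_apply] at hfg
  exact h ha (Bop_injective P hM (h (inv_ne_zero ha) hfg))

lemma commute_Bs_heckeT (P : Params q t) (hM : IsInterpFamily q t M) (a : ℂ) (i : Fin m) :
    Commute (Bs P hM a) (heckeT t i) :=
  ((commute_sOp_heckeT P hM _ i).mul_left (Bop_heckeT P hM i)).mul_left
    (commute_sOp_heckeT P hM _ i)

lemma psiOp_Bs (P : Params q t) (hM : IsInterpFamily q t M) (a : ℂ) :
    psiOp q * Bs P hM a = Bs P hM a * (psiOp q - a • ell P hM) := by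
  have h : ∀ c : ℂ, psiOp q * sOp c = sOp c * psiOp (m := m) q := fun c =>
    LinearMap.ext fun f => (scl_rotB c f).symm
  rw [Bs, ← mul_assoc, ← mul_assoc, h, mul_assoc (sOp a⁻¹), psiOp_Bop, mul_assoc, mul_assoc,
    sub_mul, h, ell_sOp, mul_assoc, mul_assoc, mul_sub (sOp a),
    mul_smul_comm]

lemma connection_sum {a b : ℂ} {cc : (Fin (m + 1) → ℕ) → (Fin (m + 1) → ℕ) → ℂ}
    (h : IsConnection q t M a b cc) (u : Fin (m + 1) → ℕ) :
    scl a (MM q t M u) = ∑ v ∈ compsLE (m + 1) (wt u), cc u v • scl b (MM q t M v) := by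
  refine (h.2 u).trans (finsum_eq_sum_of_support_subset _ fun v hv => ?_)
  rw [Finset.mem_coe, mem_compsLE]
  by_contra hlt
  exact hv (by simp only [h.1 u v (not_le.1 hlt), zero_smul])

/-- The operator form of the connection coefficients. -/
def GamOp (P : Params q t) (hM : IsInterpFamily q t M) (a b : ℂ)
    (cc : (Fin (m + 1) → ℕ) → (Fin (m + 1) → ℕ) → ℂ) : Module.End ℂ (Pol m) :=
  (TEb P hM).constr ℂ fun u => ∑ v ∈ compsLE (m + 1) (wt u),
    (b ^ wt u * a⁻¹ ^ wt v * cc u v) • TE q t M v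

lemma GamOp_TE (P : Params q t) (hM : IsInterpFamily q t M) (a b : ℂ)
    (cc : (Fin (m + 1) → ℕ) → (Fin (m + 1) → ℕ) → ℂ) (u : Fin (m + 1) → ℕ) :
    GamOp P hM a b cc (TE q t M u) = ∑ v ∈ compsLE (m + 1) (wt u),
      (b ^ wt u * a⁻¹ ^ wt v * cc u v) • TE q t M v := by
  rw [GamOp, ← TEb_apply P hM u, Module.Basis.constr_basis]

variable {a b : ℂ} {cc : (Fin (m + 1) → ℕ) → (Fin (m + 1) → ℕ) → ℂ}

lemma Bs_GamOp (P : Params q t) (hM : IsInterpFamily q t M) (ha : a ≠ 0) (hb : b ≠ 0)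
    (h : IsConnection q t M a b cc) : Bs P hM a * GamOp P hM a b cc = Bs P hM b := by
  refine ext_TE P hM fun u => ?_
  have h1 := congrArg (scl (a⁻¹ * b⁻¹)) (connection_sum h u)
  rw [map_sum, scl_scl, mul_right_comm, inv_mul_cancel₀ ha, one_mul] at h1
  rw [Module.End.mul_apply, GamOp_TE, map_sum, Bs_TE, h1, Finset.smul_sum]
  refine Finset.sum_congr rfl fun v _ => ?_
  rw [map_smul, map_smul, Bs_TE, scl_scl, mul_assoc a⁻¹, inv_mul_cancel₀ hb, mul_one, smul_smul,
    smul_smul, mul_right_comm, mul_assoc (b ^ wt u), ← mul_pow, inv_mul_cancel₀ ha, one_pow,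
    mul_one]

lemma GamOp_psi (P : Params q t) (hM : IsInterpFamily q t M) (ha : a ≠ 0) (hb : b ≠ 0)
    (h : IsConnection q t M a b cc) :
    GamOp P hM a b cc * (psiOp q - b • ell P hM) =
      (psiOp q - a • ell P hM) * GamOp P hM a b cc := by
  refine LinearMap.ext fun f => Bs_injective P hM ha ?_
  rw [← Module.End.mul_apply, ← Module.End.mul_apply, ← mul_assoc, ← mul_assoc,
    Bs_GamOp P hM ha hb h,
    ← psiOp_Bs, ← psiOp_Bs, mul_assoc, Bs_GamOp P hM ha hb h]

lemma commute_GamOp (P : Params q t) (hM : IsInterpFamily q t M) (ha : a ≠ 0) (hb : b ≠ 0)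
    (h : IsConnection q t M a b cc) (i : Fin m) : Commute (GamOp P hM a b cc) (heckeT t i) := by
  refine LinearMap.ext fun f => Bs_injective P hM ha ?_
  rw [← Module.End.mul_apply, ← Module.End.mul_apply, ← mul_assoc, ← mul_assoc,
    Bs_GamOp P hM ha hb h,
    (commute_Bs_heckeT P hM b i).eq, (commute_Bs_heckeT P hM a i).eq, mul_assoc,
    Bs_GamOp P hM ha hb h]

lemma GamOp_top (P : Params q t) (hM : IsInterpFamily q t M) (ha : a ≠ 0) (hb : b ≠ 0)
    (h : IsConnection q t M a b cc) {u v : Fin (m + 1) → ℕ} (hv : wt v = wt u) :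
    (TEb P hM).repr (GamOp P hM a b cc (TE q t M u)) v = if u = v then 1 else 0 := by
  have hB : ∀ {c : ℂ}, c ≠ 0 → ∀ w, wt w ≤ wt u → homogeneousComponent (wt u)
      (Bs P hM c (TE q t M w)) = homogeneousComponent (wt u) (TE q t M w) := by
    intro c hc w hw
    have hs : Raises 0 (sOp (m := m) c⁻¹) := raises_of_TE P hM fun x => by
      rw [sOp_apply, scl_TE]; exact isHomogeneous_smul (TE_isHomogeneous x) _
    have h1 : Bs P hM c (TE q t M w) = c ^ wt w • sOp c⁻¹ (MM q t M w) := Bs_TE P hM c w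
    have h2 := hs.hc (wt u) (MM q t M w)
    rw [add_zero] at h2
    rw [h1, map_smul, h2, hc_MM hM hw]
    split_ifs with h3
    · rw [sOp_apply, scl_TE, smul_smul, ← mul_pow, mul_inv_cancel₀ hc, one_pow, one_smul]
      exact (homogeneousComponent_of_mem (h3 ▸ TE_isHomogeneous w)).trans (by simp) |>.symm
    · rw [map_zero, smul_zero]
      exact ((homogeneousComponent_of_mem (TE_isHomogeneous w)).trans
        (if_neg fun h => h3 h.symm)).symm
  have h1 := congrArg (homogeneousComponent (wt u))
    (LinearMap.congr_fun (Bs_GamOp P hM ha hb h) (TE q t M u))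
  rw [hB hb u le_rfl, Module.End.mul_apply] at h1
  have h2 : homogeneousComponent (wt u) (Bs P hM a (GamOp P hM a b cc (TE q t M u))) =
      homogeneousComponent (wt u) (GamOp P hM a b cc (TE q t M u)) := by
    rw [GamOp_TE, map_sum, map_sum, map_sum]
    refine Finset.sum_congr rfl fun w hw => ?_
    rw [map_smul, map_smul, map_smul, hB ha w (mem_compsLE.1 hw)]
  rw [h2] at h1
  have h3 : ∀ f : Pol m, (TEb P hM).repr (homogeneousComponent (wt u) f) v =
      (TEb P hM).repr f v := by
    intro f
    have : (TEb P hM).coord v ∘ₗ homogeneousComponent (wt u) = (TEb P hM).coord v :=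
      (TEb P hM).ext fun w => by
        rw [LinearMap.comp_apply, TEb_apply, homogeneousComponent_of_mem (TE_isHomogeneous w)]
        split_ifs with h4
        · rfl
        · rw [map_zero, Module.Basis.coord_apply, repr_TE, if_neg]
          rintro rfl
          exact h4 hv.symm
    exact LinearMap.congr_fun this f
  rw [← h3, h1, h3, repr_TE]

/-- The degree `k` part of the transpose of `GamOp`. -/
def GOp (P : Params q t) (hM : IsInterpFamily q t M) (a b : ℂ)
    (cc : (Fin (m + 1) → ℕ) → (Fin (m + 1) → ℕ) → ℂ) (k : ℕ) : Module.End ℂ (Pol m) :=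
  (TEb P hM).constr ℂ fun v => ∑ u ∈ comps (m + 1) (wt v + k),
    (b ^ wt u * a⁻¹ ^ wt v * cc u v * hev q t M v / hev q t M u) • TE q t M u

lemma GOp_TE (P : Params q t) (hM : IsInterpFamily q t M) (a b : ℂ)
    (cc : (Fin (m + 1) → ℕ) → (Fin (m + 1) → ℕ) → ℂ) (k : ℕ) (v : Fin (m + 1) → ℕ) :
    GOp P hM a b cc k (TE q t M v) = ∑ u ∈ comps (m + 1) (wt v + k),
      (b ^ wt u * a⁻¹ ^ wt v * cc u v * hev q t M v / hev q t M u) • TE q t M u := by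
  rw [GOp, ← TEb_apply P hM v, Module.Basis.constr_basis]

lemma GOp_raises (P : Params q t) (hM : IsInterpFamily q t M) (k : ℕ) :
    Raises k (GOp P hM a b cc k) := by
  refine raises_of_TE P hM fun v => ?_
  rw [GOp_TE]
  refine IsHomogeneous.sum _ _ _ fun u hu => isHomogeneous_smul ?_ _
  rw [← mem_comps.1 hu]
  exact TE_isHomogeneous u

lemma pr_GOp_TE (P : Params q t) (hM : IsInterpFamily q t M) {k : ℕ} {u v : Fin (m + 1) → ℕ}
    (h : wt u = wt v + k) : pr P hM (TE q t M u) (GOp P hM a b cc k (TE q t M v)) =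
      pr P hM (GamOp P hM a b cc (TE q t M u)) (TE q t M v) := by
  rw [GOp_TE, GamOp_TE, map_sum, map_sum, LinearMap.sum_apply,
    Finset.sum_eq_single_of_mem u (mem_comps.2 h), Finset.sum_eq_single_of_mem v]
  · rw [map_smul, map_smul, LinearMap.smul_apply, pr_TE_TE, pr_TE_TE, if_pos rfl, if_pos rfl,
      smul_eq_mul, smul_eq_mul, div_mul_cancel₀ _ (hev_ne_zero P hM u)]
  · rw [mem_compsLE]; omega
  · intro w _ hw
    rw [map_smul, LinearMap.smul_apply, pr_TE_TE, if_neg hw.symm, smul_zero]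
  · intro w _ hw
    rw [map_smul, pr_TE_TE, if_neg hw, smul_zero]

lemma pr_GOp (P : Params q t) (hM : IsInterpFamily q t M) {k d : ℕ} {f g : Pol m}
    (hf : f.IsHomogeneous (d + k)) (hg : g.IsHomogeneous d) :
    pr P hM f (GOp P hM a b cc k g) = pr P hM (GamOp P hM a b cc f) g := by
  refine Submodule.span_induction (p := fun f _ => pr P hM f (GOp P hM a b cc k g) =
    pr P hM (GamOp P hM a b cc f) g) ?_ (by simp) ?_ ?_ (mem_span_TE P hM hf)
  · rintro _ ⟨u, hu, rfl⟩
    have hu : wt u = d + k := hu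
    refine Submodule.span_induction (p := fun g _ => pr P hM (TE q t M u) (GOp P hM a b cc k g) =
      pr P hM (GamOp P hM a b cc (TE q t M u)) g) ?_ (by simp) ?_ ?_ (mem_span_TE P hM hg)
    · rintro _ ⟨v, hv, rfl⟩
      have hv : wt v = d := hv
      exact pr_GOp_TE P hM (by omega)
    · intro x y _ _ hx hy
      simp only [map_add, hx, hy]
    · intro c x _ hx
      simp only [map_smul, hx]
  · intro x y _ _ hx hy
    simp only [map_add, LinearMap.add_apply, hx, hy]
  · intro c x _ hx
    simp only [map_smul, LinearMap.smul_apply, hx]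

lemma pr_of_ne (P : Params q t) (hM : IsInterpFamily q t M) {d : ℕ} {u : Fin (m + 1) → ℕ}
    {f : Pol m} (hf : f.IsHomogeneous d) (h : wt u ≠ d) : pr P hM (TE q t M u) f = 0 := by
  refine Submodule.span_induction (p := fun f _ => pr P hM (TE q t M u) f = 0) ?_ (by simp) ?_ ?_
    (mem_span_TE P hM hf)
  · rintro _ ⟨v, hv, rfl⟩
    rw [pr_TE_TE, if_neg]
    rintro rfl
    exact h hv
  · intro x y _ _ hx hy
    simp only [map_add, hx, hy, add_zero]
  · intro c x _ hx
    simp only [map_smul, hx, smul_zero]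

lemma eq_of_pr_raises (P : Params q t) (hM : IsInterpFamily q t M) {k : ℕ}
    {A B : Module.End ℂ (Pol m)} (hA : Raises k A) (hB : Raises k B)
    (h : ∀ u w, wt u = wt w + k →
      pr P hM (TE q t M u) (A (TE q t M w)) = pr P hM (TE q t M u) (B (TE q t M w))) : A = B := by
  refine ext_TE P hM fun w => eq_of_pr P hM fun u => ?_
  by_cases hu : wt u = wt w + k
  · exact h u w hu
  · rw [pr_of_ne P hM (hA _ _ (TE_isHomogeneous w)) hu,
      pr_of_ne P hM (hB _ _ (TE_isHomogeneous w)) hu]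

lemma commute_GOp (P : Params q t) (hM : IsInterpFamily q t M) (ha : a ≠ 0) (hb : b ≠ 0)
    (h : IsConnection q t M a b cc) (k : ℕ) (i : Fin m) :
    Commute (GOp P hM a b cc k) (heckeT t i) := by
  refine eq_of_pr_raises P hM (k := k) ?_ ?_ fun u w hu => ?_
  · have := (GOp_raises (a := a) (b := b) (cc := cc) P hM k).comp (heckeT_raises t i)
    rwa [zero_add] at this
  · have := (heckeT_raises t i).comp (GOp_raises (a := a) (b := b) (cc := cc) P hM k)
    rwa [add_zero] at this
  have hu' := TE_isHomogeneous (q := q) (t := t) (M := M) u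
  rw [hu] at hu'
  have hw := TE_isHomogeneous (q := q) (t := t) (M := M) w
  have h1 := heckeT_raises t i _ _ hw
  have h2 := heckeT_raises t i _ _ hu'
  rw [add_zero] at h1 h2
  rw [Module.End.mul_apply, Module.End.mul_apply, pr_GOp P hM hu' h1, ← adj_heckeT P hM i,
    ← adj_heckeT P hM i, pr_GOp P hM h2 hw]
  have := LinearMap.congr_fun (commute_GamOp P hM ha hb h i).eq (TE q t M u)
  rw [Module.End.mul_apply, Module.End.mul_apply] at this
  rw [this]

lemma GOp_zero (P : Params q t) (hM : IsInterpFamily q t M) (ha : a ≠ 0) (hb : b ≠ 0)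
    (h : IsConnection q t M a b cc) : GOp P hM a b cc 0 = 1 := by
  refine eq_of_pr_raises P hM (GOp_raises P hM 0) Raises.one fun u w hu => ?_
  have h1 : ∀ f, pr P hM f (TE q t M w) = (TEb P hM).repr f w * hev q t M w := by
    intro f
    have : (pr P hM).flip (TE q t M w) = hev q t M w • (TEb P hM).coord w :=
      (TEb P hM).ext fun x => by
        rw [TEb_apply, LinearMap.flip_apply, pr_TE_TE, LinearMap.smul_apply,
          Module.Basis.coord_apply, repr_TE, smul_eq_mul]
        by_cases hx : x = w
        · subst hx; simp
        · simp [hx, Ne.symm hx]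
    have := LinearMap.congr_fun this f
    rwa [LinearMap.flip_apply, LinearMap.smul_apply, Module.Basis.coord_apply, smul_eq_mul,
      mul_comm] at this
  rw [add_zero] at hu
  rw [pr_GOp_TE P hM hu, Module.End.one_apply, h1, GamOp_top P hM ha hb h hu.symm, h1, repr_TE]

end

section
variable {m : ℕ} {q t : ℂ} {M : (Fin (m + 1) → ℕ) → Pol m}
variable {a b : ℂ} {cc : (Fin (m + 1) → ℕ) → (Fin (m + 1) → ℕ) → ℂ}

lemma Yop_raises (q t : ℂ) : Raises (m := m) 0 (Yop q t) :=
  (rotB_raises q).comp (cyc_raises t (Fin.last m))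

lemma X_zero_Yop_raises (q t : ℂ) : Raises (m := m) 1 (mulOp (X 0) * Yop q t) := by
  have := (mulOp_raises (isHomogeneous_X ℂ (0 : Fin (m + 1)))).comp (Yop_raises (m := m) q t)
  rwa [zero_add] at this

lemma ell_isHomogeneous (P : Params q t) (hM : IsInterpFamily q t M) {d : ℕ}
    (u : Fin (m + 1) → ℕ) (hu : wt u = d + 1) : (ell P hM (TE q t M u)).IsHomogeneous d := by
  by_cases h : u (Fin.last m) = 0
  · rw [ell_of_last P hM h]
    exact isHomogeneous_zero _ _ _
  · obtain ⟨w, rfl⟩ := exists_Phi u h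
    rw [wt_Phi] at hu
    obtain rfl : wt w = d := by omega
    rw [ell_Phi]
    exact isHomogeneous_smul (TE_isHomogeneous w) _

lemma Yop_GOp (P : Params q t) (hM : IsInterpFamily q t M) (ha : a ≠ 0) (hb : b ≠ 0)
    (h : IsConnection q t M a b cc) (k : ℕ) :
    GOp P hM a b cc (k + 1) * Yop q t - a • (GOp P hM a b cc k * (mulOp (X 0) * Yop q t)) =
      Yop q t * GOp P hM a b cc (k + 1) - b • (mulOp (X 0) * Yop q t * GOp P hM a b cc k) := by
  have hG : ∀ j, Raises j (GOp P hM a b cc j) := fun j => GOp_raises P hM j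
  have hc : ∀ j, Commute (GOp P hM a b cc j) (cycInv t (Fin.last m)) := fun j =>
    commute_cycInv (fun i => commute_GOp P hM ha hb h j i) (Fin.last m)
  have hci := cycInv_raises (m := m) t (Fin.last m)
  have hY := Yop_raises (m := m) q t
  have hX := X_zero_Yop_raises (m := m) q t
  apply cycInv_cancel P.t_ne
  have hneg : ∀ A B : Module.End ℂ (Pol m), A - B = A + (-1 : ℂ) • B := fun A B => by module
  refine eq_of_pr_raises P hM (k := k + 1) ?_ ?_ fun u w hu => ?_
  · rw [hneg]
    refine hci.comp (Raises.add ?_ (Raises.smul (Raises.smul ?_ _) _))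
    · have := (hG (k + 1)).comp hY
      rwa [zero_add] at this
    · have := (hG k).comp hX
      rwa [add_comm 1 k] at this
  · rw [hneg]
    exact hci.comp (Raises.add (hY.comp (hG (k + 1)))
      (Raises.smul (Raises.smul (hX.comp (hG k)) _) _))
  have hTw := TE_isHomogeneous (q := q) (t := t) (M := M) w
  have hTu := TE_isHomogeneous (q := q) (t := t) (M := M) u
  rw [hu] at hTu
  have e1 : pr P hM (TE q t M u) ((cycInv t (Fin.last m) *
      (GOp P hM a b cc (k + 1) * Yop q t) : Module.End ℂ (Pol m)) (TE q t M w)) =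
      pr P hM (psiOp q (GamOp P hM a b cc (TE q t M u))) (TE q t M w) := by
    rw [← mul_assoc, ← (hc (k + 1)).eq, mul_assoc, Module.End.mul_apply,
      pr_GOp P hM hTu (by simpa using hci.comp hY _ _ hTw), adj_psiOp P hM]
  have e2 : pr P hM (TE q t M u) ((cycInv t (Fin.last m) *
      (GOp P hM a b cc k * (mulOp (X 0) * Yop q t)) : Module.End ℂ (Pol m)) (TE q t M w)) =
      pr P hM (ell P hM (GamOp P hM a b cc (TE q t M u))) (TE q t M w) := by
    have h2 := hci.comp hX _ _ hTw
    rw [add_zero] at h2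
    rw [← mul_assoc, ← (hc k).eq, mul_assoc, Module.End.mul_apply,
      pr_GOp P hM (d := wt w + 1) (by rwa [add_assoc, add_comm 1 k]) h2, adj_ell P hM]
  have e3 : pr P hM (TE q t M u) ((cycInv t (Fin.last m) *
      (Yop q t * GOp P hM a b cc (k + 1)) : Module.End ℂ (Pol m)) (TE q t M w)) =
      pr P hM (GamOp P hM a b cc (psiOp q (TE q t M u))) (TE q t M w) := by
    rw [← mul_assoc, Module.End.mul_apply, ← adj_psiOp P hM,
      pr_GOp P hM (show IsHomogeneous (psiOp q (TE q t M u)) (wt w + (k + 1)) from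
      rotB_raises q _ _ hTu) hTw]
  have e4 : pr P hM (TE q t M u) ((cycInv t (Fin.last m) *
      (mulOp (X 0) * Yop q t * GOp P hM a b cc k) : Module.End ℂ (Pol m)) (TE q t M w)) =
      pr P hM (GamOp P hM a b cc (ell P hM (TE q t M u))) (TE q t M w) := by
    rw [← mul_assoc, Module.End.mul_apply, ← adj_ell P hM,
      pr_GOp P hM (ell_isHomogeneous P hM u hu) hTw]
  have key := LinearMap.congr_fun (GamOp_psi P hM ha hb h) (TE q t M u)
  simp only [Module.End.mul_apply, LinearMap.sub_apply, LinearMap.smul_apply, map_sub,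
    map_smul] at key
  have key' := congrArg (fun f => pr P hM f (TE q t M w)) key
  simp only [map_sub, map_smul, LinearMap.sub_apply, LinearMap.smul_apply] at key'
  rw [mul_sub, mul_sub, mul_smul_comm, mul_smul_comm, LinearMap.sub_apply, LinearMap.sub_apply,
    LinearMap.smul_apply, LinearMap.smul_apply, map_sub, map_sub, map_smul, map_smul, e1, e2, e3,
    e4, key']

/-- The transposed connection coefficients are multiplication by the symmetric series. -/
theorem GOp_eq (P : Params q t) (hM : IsInterpFamily q t M) (ha : a ≠ 0) (hb : b ≠ 0)
    (h : IsConnection q t M a b cc) (k : ℕ) :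
    GOp P hM a b cc k = mulOp (Fc a b q k) := by
  have hn : ∀ (A B : Module.End ℂ (Pol m)) (c : ℂ), A + (-c) • B = A - c • B :=
    fun A B c => by module
  refine eq_of_intertwine P one_ne_zero (K := GOp P hM a b cc) (L := fun k => mulOp (Fc a b q k))
    (A := (-a) • (mulOp (X 0) * Yop q t))
    (A' := (-b) • (mulOp (X 0) * Yop q t)) (fun k => GOp_raises P hM k) (mulOp_Fc_raises a b q)
    ?_ (fun i k => commute_GOp P hM ha hb h k i) (fun i k => commute_mulOp_Fc a b q t k i) ?_ ?_ k
  · rw [GOp_zero P hM ha hb h]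
    show 1 = mulOp (Fc a b q 0)
    rw [Fc_zero]
    exact LinearMap.ext fun f => (one_mul f).symm
  · intro k
    have := Yop_GOp P hM ha hb h k
    rw [one_smul, mul_smul_comm, smul_mul_assoc, hn, hn]
    exact this
  · intro k
    have := mulOp_Fc_Yop (m := m) P a b k
    rw [one_smul, mul_smul_comm, smul_mul_assoc, hn, hn]
    exact this

end

section
variable {m : ℕ} {q t : ℂ} {M : (Fin (m + 1) → ℕ) → Pol m}

/-- The coefficients of multiplication by the symmetric series in the basis `TE`. -/
def smat (q t : ℂ) (M : (Fin (m + 1) → ℕ) → Pol m) (a b : ℂ)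
    (cc : (Fin (m + 1) → ℕ) → (Fin (m + 1) → ℕ) → ℂ) (u v : Fin (m + 1) → ℕ) : ℂ :=
  b ^ wt u * a⁻¹ ^ wt v * cc u v * hev q t M v / hev q t M u

lemma mulOp_Fc_TE (P : Params q t) (hM : IsInterpFamily q t M) {a b : ℂ} (ha : a ≠ 0) (hb : b ≠ 0)
    {cc : (Fin (m + 1) → ℕ) → (Fin (m + 1) → ℕ) → ℂ} (h : IsConnection q t M a b cc) (k : ℕ)
    (v : Fin (m + 1) → ℕ) : mulOp (Fc a b q k) (TE q t M v) =
      ∑ u ∈ comps (m + 1) (wt v + k), smat q t M a b cc u v • TE q t M u := by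
  rw [← GOp_eq P hM ha hb h, GOp_TE]
  rfl

lemma EE_eq (P : Params q t) (u : Fin (m + 1) → ℕ) :
    EE q t M u = C (q ^ nstat' u)⁻¹ * TE q t M u := by
  have h : ∀ r : ℂ, homogeneousComponent (wt u) (C r * M u) =
      C r * homogeneousComponent (wt u) (M u) := fun r => by
    rw [← smul_eq_C_mul, map_smul, smul_eq_C_mul]
  rw [EE, TE, MM, h, ← mul_assoc, ← C_mul]
  congr 2
  rw [mul_div_assoc, ← mul_assoc, inv_mul_cancel₀ (pow_ne_zero _ P.q_ne), one_mul]

lemma eval_scl (c : ℂ) (x : Fin (m + 1) → ℂ) (f : Pol m) :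
    eval x (scl c f) = eval (fun i => c * x i) f := by
  have : (aeval x).comp (scl c) = (aeval (fun i => c * x i) : Pol m →ₐ[ℂ] ℂ) :=
    algHom_ext fun i => by simp [scl]
  have := DFunLike.congr_fun this f
  rwa [AlgHom.comp_apply, aeval_eq_eval, aeval_eq_eval] at this

lemma eval_spec0div (P : Params q t) (a : ℂ) (u : Fin (m + 1) → ℕ) :
    eval (spec0div q t a) (EE q t M u) = (q ^ nstat' u)⁻¹ * (a⁻¹ ^ wt u * hev q t M u) := by
  have h : spec0div q t a = fun i => a⁻¹ * spec q t (0 : Fin (m + 1) → ℕ) i :=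
    funext fun i => by rw [spec0div, div_eq_inv_mul]; rfl
  rw [EE_eq P, map_mul, eval_C, hev, h, ← eval_scl, scl_TE, smul_eval]

lemma skew_mul_EE (P : Params q t) (hM : IsInterpFamily q t M) {a b : ℂ} (hb : b ≠ 0)
    (cc : (Fin (m + 1) → ℕ) → (Fin (m + 1) → ℕ) → ℂ) (u v : Fin (m + 1) → ℕ)
    (x : Fin (m + 1) → ℂ) : skew q t M a b cc u v * eval x (EE q t M u) =
      (q ^ nstat' v)⁻¹ * (smat q t M a b cc u v * eval x (TE q t M u)) := by
  rw [skew, eval_spec0div P, eval_spec0div P, EE_eq P, map_mul, eval_C, smat]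
  have h1 := hev_ne_zero P hM u
  have h2 := pow_ne_zero (nstat' u) P.q_ne
  have h3 := pow_ne_zero (nstat' v) P.q_ne
  have h4 := pow_ne_zero (wt u) hb
  rw [inv_pow b]
  field_simp

/-- The graded form of the transformation. -/
lemma graded_identity (P : Params q t) (hM : IsInterpFamily q t M) {a b c : ℂ}
    (ha : a ≠ 0) (hb : b ≠ 0) (hc : c ≠ 0) (hcu : ∀ u : Fin (m + 1) → ℕ, qfac q t c u ≠ 0)
    {ccbc ccac : (Fin (m + 1) → ℕ) → (Fin (m + 1) → ℕ) → ℂ}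
    (h1 : IsConnection q t M b c ccbc) (h2 : IsConnection q t M a c ccac)
    (v : Fin (m + 1) → ℕ) (x : Fin (m + 1) → ℂ) (N : ℕ) :
    qfac q t b v * ∑ u ∈ comps (m + 1) (wt v + N), qfac q t a u / qfac q t c u *
        (smat q t M b c ccbc u v * eval x (TE q t M u)) =
      qfac q t a v * ∑ p ∈ Finset.HasAntidiagonal.antidiagonal N, eval x (Fc b a q p.1) *
        ∑ u ∈ comps (m + 1) (wt v + p.2), qfac q t b u / qfac q t c u *
          (smat q t M a c ccac u v * eval x (TE q t M u)) := by
  have key := congrArg (PowerSeries.coeff N) (euler_operator P hM a b hcu)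
  rw [PowerSeries.coeff_C_mul, PowerSeries.coeff_C_mul, PowerSeries.coeff_mul_C,
    PowerSeries.coeff_mul] at key
  simp only [PowerSeries.coeff_C_mul, PowerSeries.coeff_mul_C, FO, PowerSeries.coeff_mk] at key
  have key2 := congrArg (eval x) (LinearMap.congr_fun key (TE q t M v))
  simp only [Module.End.mul_apply, LinearMap.sum_apply, dia_TE, map_smul, map_sum,
    mulOp_Fc_TE P hM hb hc h1, mulOp_Fc_TE P hM ha hc h2] at key2
  have hm : ∀ f g : Pol m, mulOp f g = f * g := fun _ _ => rfl
  simp only [hm, smul_eval, map_sum, map_mul] at key2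
  rw [Finset.mul_sum] at key2 ⊢
  rw [Finset.mul_sum]
  refine Eq.trans (Finset.sum_congr rfl fun u _ => by ring) (key2.trans
    (Finset.sum_congr rfl fun p _ => ?_))
  simp only [Finset.mul_sum]
  exact Finset.sum_congr rfl fun u _ => by ring

end

section
variable {m : ℕ} {q t : ℂ} {M : (Fin (m + 1) → ℕ) → Pol m}

lemma growth {Q : (Fin (m + 1) → ℕ) → ℝ → Prop} (mono : ∀ u B B', B ≤ B' → Q u B → Q u B')
    {C : ℝ} (hC : 1 ≤ C) (h0 : Q 0 1) (hPhi : ∀ u B, 0 ≤ B → Q u B → Q (Phi u) (C * B))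
    (hs : ∀ (u : Fin (m + 1) → ℕ) (p : Fin m), u p.castSucc ≠ 0 →
      (∀ j, p.castSucc < j → u j = 0) → ∀ B, 0 ≤ B → Q (u ∘ sw p) B → Q u (C * B))
    (u : Fin (m + 1) → ℕ) : Q u (C ^ ((m + 1) * wt u)) := by
  have hle : ∀ {j k : ℕ}, j ≤ k → C ^ j ≤ C ^ k := fun h => pow_le_pow_right₀ hC h
  have hC0 : ∀ k : ℕ, 0 ≤ C ^ k := fun k => pow_nonneg (by linarith) k
  have hpos : ∀ (u : Fin (m + 1) → ℕ) p, u p ≠ 0 → 1 ≤ wt u := fun u p hp =>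
    (Nat.pos_of_ne_zero hp).trans_le (Finset.single_le_sum (f := u) (fun _ _ => Nat.zero_le _)
      (Finset.mem_univ p))
  have key : Q u (C ^ ((m + 1) * wt u)) ∧
      ∀ p, u p ≠ 0 → Q u (C ^ ((m + 1) * wt u - (p : ℕ))) := by
    induction u using path_induction with
    | zero => exact ⟨by simpa [wt] using h0, fun p hp => absurd rfl hp⟩
    | phi u ih =>
      have h1 := hPhi u _ (hC0 _) ih.1
      rw [← pow_succ'] at h1
      refine ⟨mono _ _ _ (hle ?_) h1, fun p _ => mono _ _ _ (hle ?_) h1⟩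
      · rw [wt_Phi]; ring_nf; omega
      · have := p.is_lt
        rw [wt_Phi, mul_add]; omega
    | special u p hp hz ih =>
      have h1 := hs u p hp hz _ (hC0 _) (ih.2 p.succ (by
        rw [Function.comp, sw_succ]; exact hp))
      rw [← pow_succ', wt_comp_sw] at h1
      have h2 := hpos u _ hp
      have h3 := p.is_lt
      have h4 : m + 1 ≤ (m + 1) * wt u := Nat.le_mul_of_pos_right _ h2
      have h5 : (p.succ : ℕ) = p + 1 := Fin.val_succ p
      refine ⟨mono _ _ _ (hle (by omega)) h1, fun j hj => mono _ _ _ (hle ?_) h1⟩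
      have h6 : j ≤ p.castSucc := not_lt.1 fun h => hj (hz j h)
      have h7 : (j : ℕ) ≤ p := h6
      omega
  exact key.1

lemma exists_uniform_bound {ι : Type*} [Fintype ι] {α : Type*} {F : ι → α → ℂ}
    (h : ∀ i, ∃ B : ℝ, ∀ a, ‖F i a‖ ≤ B) : ∃ B : ℝ, 1 ≤ B ∧ ∀ i a, ‖F i a‖ ≤ B := by
  choose B hB using h
  refine ⟨1 + ∑ i, |B i|, ?_, fun i a => (hB i a).trans ?_⟩
  · have : 0 ≤ ∑ i, |B i| := Finset.sum_nonneg fun i _ => abs_nonneg _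
    linarith
  · have : |B i| ≤ ∑ i, |B i| :=
      Finset.single_le_sum (f := fun i => |B i|) (fun i _ => abs_nonneg _) (Finset.mem_univ i)
    have := le_abs_self (B i)
    linarith

lemma exists_bound_of_tendsto {F : ℕ → ℂ} {l : ℂ} (h : Filter.Tendsto F Filter.atTop (nhds l)) :
    ∃ B : ℝ, ∀ a, ‖F a‖ ≤ B := by
  obtain ⟨B, hB⟩ := (Metric.isBounded_range_of_tendsto F h).exists_norm_le
  exact ⟨B, fun a => hB _ ⟨a, rfl⟩⟩

lemma Params.tendsto_pow (P : Params q t) : Filter.Tendsto (fun a : ℕ => q ^ a) Filter.atTop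
    (nhds 0) := tendsto_pow_atTop_nhds_zero_of_norm_lt_one P.q_lt

lemma exists_spec_bound (P : Params q t) (k : ℕ) : ∃ B : ℝ, 1 ≤ B ∧ ∀ (i j : Fin k) (a : ℕ),
    ‖t ^ (j : ℕ) - q ^ a * t ^ (i : ℕ)‖ ≤ B ∧ ‖(t ^ (j : ℕ) - q ^ a * t ^ (i : ℕ))⁻¹‖ ≤ B ∧
      ‖q ^ a * t ^ (i : ℕ)‖ ≤ B := by
  have ht : ∀ i j : ℕ, Filter.Tendsto (fun a : ℕ => t ^ j - q ^ a * t ^ i) Filter.atTop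
      (nhds (t ^ j)) := fun i j => by
    simpa using (tendsto_const_nhds (x := t ^ j)).sub (P.tendsto_pow.mul_const (t ^ i))
  obtain ⟨B1, h1, h1'⟩ := exists_uniform_bound (ι := Fin k × Fin k)
    (F := fun p a => t ^ (p.2 : ℕ) - q ^ a * t ^ (p.1 : ℕ)) fun p =>
      exists_bound_of_tendsto (ht _ _)
  obtain ⟨B2, h2, h2'⟩ := exists_uniform_bound (ι := Fin k × Fin k)
    (F := fun p a => (t ^ (p.2 : ℕ) - q ^ a * t ^ (p.1 : ℕ))⁻¹) fun p =>
      exists_bound_of_tendsto ((ht _ _).inv₀ (pow_ne_zero _ P.t_ne))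
  obtain ⟨B3, h3, h3'⟩ := exists_uniform_bound (ι := Fin k)
    (F := fun i (a : ℕ) => q ^ a * t ^ (i : ℕ)) fun p =>
      exists_bound_of_tendsto (P.tendsto_pow.mul_const _)
  refine ⟨B1 + B2 + B3, by linarith, fun i j a => ?_⟩
  have e1 := h1' (i, j) a
  have e2 := h2' (i, j) a
  have e3 := h3' i a
  exact ⟨by linarith, by linarith, by linarith⟩

lemma mp_lt (u : Fin (m + 1) → ℕ) (i : Fin (m + 1)) : mp u i < m + 1 := by
  have := lp_add_mp u i
  omega

/-- Uniform bounds for the structure constants of the recursions. -/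
lemma exists_structure_bound (P : Params q t) (m : ℕ) : ∃ B : ℝ, 1 ≤ B ∧
    (∀ u : Fin (m + 1) → ℕ, ‖spec q t u 0‖ ≤ B ∧ ‖1 - q * spec q t u 0‖ ≤ B ∧
      ‖(1 - q * spec q t u 0)⁻¹‖ ≤ B) ∧
    ∀ (u : Fin (m + 1) → ℕ) (p : Fin m), u p.castSucc ≠ 0 → (∀ j, p.castSucc < j → u j = 0) →
      ‖gam q t u p‖ ≤ B ∧ ‖(gam q t u p)⁻¹‖ ≤ B ∧ ‖alp q t (u ∘ sw p) p‖ ≤ B ∧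
        ‖(gam q t (u ∘ sw p) p)⁻¹‖ ≤ B := by
  obtain ⟨B, hB, h⟩ := exists_spec_bound P (m + 2)
  have hB2 : B ≤ B * B := le_mul_of_one_le_left (by linarith) hB
  have hB0 : 0 ≤ B := by linarith
  have hBt : B * B ≤ B * B * (1 + ‖t - 1‖) :=
    le_mul_of_one_le_right (by positivity) (by linarith [norm_nonneg (t - 1)])
  have h' : ∀ (i j a : ℕ), i < m + 2 → j < m + 2 → ‖t ^ j - q ^ a * t ^ i‖ ≤ B ∧
      ‖(t ^ j - q ^ a * t ^ i)⁻¹‖ ≤ B ∧ ‖q ^ a * t ^ i‖ ≤ B := fun i j a hi hj =>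
    h ⟨i, hi⟩ ⟨j, hj⟩ a
  refine ⟨B * B * (1 + ‖t - 1‖), by linarith, fun u => ?_, fun u p hp hz => ?_⟩
  · have h0 := mp_lt u 0
    have e1 := h' (mp u 0) 0 (u 0) (by omega) (by omega)
    have e2 := h' (mp u 0) 0 (u 0 + 1) (by omega) (by omega)
    rw [pow_zero, pow_succ', mul_assoc] at e2
    rw [spec_eq]
    exact ⟨by linarith, by linarith, by linarith⟩
  · have hne : u p.castSucc ≠ u p.succ := by rw [hz _ Fin.castSucc_lt_succ]; exact hp
    have f1 := mp_lt u p.castSucc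
    have f2 := mp_lt u p.succ
    set i := mp u p.castSucc with hi
    set j := mp u p.succ with hj
    set a := u p.castSucc with ha
    have s1 : spec q t u p.castSucc = q ^ a * t ^ i := by rw [spec_eq]
    have s2 : spec q t u p.succ = t ^ j := by
      rw [spec_eq, hz _ Fin.castSucc_lt_succ, pow_zero, one_mul]
    have e1 := h' i j a (by omega) (by omega)
    have e2 := h' i (j + 1) a (by omega) (by omega)
    have e3 := h' (i + 1) j a (by omega) (by omega)
    have e4 := h' j j 0 (by omega) (by omega)
    rw [pow_zero, one_mul] at e4
    have hmul : ∀ x y : ℂ, ‖x‖ ≤ B → ‖y‖ ≤ B → ‖x * y‖ ≤ B * B * (1 + ‖t - 1‖) := fun x y hx hy =>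
      (norm_mul_le x y).trans ((mul_le_mul hx hy (norm_nonneg _) hB0).trans hBt)
    have g1 : gam q t u p = (t ^ (j + 1) - q ^ a * t ^ i) * (t ^ j - q ^ a * t ^ i)⁻¹ := by
      rw [gam, s1, s2, ← neg_sub (t * t ^ j), ← neg_sub (t ^ j), neg_div_neg_eq, div_eq_mul_inv,
        pow_succ']
    have g2 : gam q t (u ∘ sw p) p = (t ^ j - q ^ a * t ^ (i + 1)) * (t ^ j - q ^ a * t ^ i)⁻¹ := by
      rw [gam, spec_comp_sw u q t hne, Function.comp, Function.comp, sw_castSucc, sw_succ, s1, s2,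
        div_eq_mul_inv, pow_succ', mul_left_comm]
    have g3 : alp q t (u ∘ sw p) p = (t - 1) * (t ^ j * (t ^ j - q ^ a * t ^ i)⁻¹) := by
      rw [alp, spec_comp_sw u q t hne, Function.comp, Function.comp, sw_castSucc, sw_succ, s1, s2,
        div_eq_mul_inv, mul_assoc]
    refine ⟨?_, ?_, ?_, ?_⟩
    · rw [g1]; exact hmul _ _ e2.1 e1.2.1
    · rw [g1, mul_inv, inv_inv]; exact hmul _ _ e2.2.1 e1.1
    · rw [g3, norm_mul, norm_mul]
      have : ‖t ^ j‖ * ‖(t ^ j - q ^ a * t ^ i)⁻¹‖ ≤ B * B :=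
        mul_le_mul e4.2.2 e1.2.1 (norm_nonneg _) hB0
      calc _ ≤ ‖t - 1‖ * (B * B) := mul_le_mul_of_nonneg_left this (norm_nonneg _)
        _ ≤ _ := by nlinarith [norm_nonneg (t - 1)]
    · rw [g2, mul_inv, inv_inv]; exact hmul _ _ e3.2.1 e1.1

end

section
variable {m : ℕ} {q t : ℂ} {M : (Fin (m + 1) → ℕ) → Pol m}

/-- The bound `B` for `f` on the points of size at most `L` with separated coordinates. -/
def BdOn (L : ℝ) (f : Pol m) (B : ℝ) : Prop :=
  ∀ x : Fin (m + 1) → ℂ, (∀ i, ‖x i‖ ≤ L) → (∀ i j, i ≠ j → 1 ≤ ‖x i - x j‖) → ‖eval x f‖ ≤ B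

/-- An operator bounded by `D` with respect to `BdOn L`. -/
def BddOp (L D : ℝ) (A : Module.End ℂ (Pol m)) : Prop :=
  ∀ f B, 0 ≤ B → BdOn L f B → BdOn L (A f) (D * B)

lemma BdOn.mono {L : ℝ} {f : Pol m} {B B' : ℝ} (h : BdOn L f B) (hB : B ≤ B') : BdOn L f B' :=
  fun x h1 h2 => (h x h1 h2).trans hB

lemma BdOn.add {L : ℝ} {f g : Pol m} {B B' : ℝ} (h : BdOn L f B) (h' : BdOn L g B') :
    BdOn L (f + g) (B + B') := fun x h1 h2 => by
  rw [map_add]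
  exact (norm_add_le _ _).trans (add_le_add (h x h1 h2) (h' x h1 h2))

lemma BdOn.smul {L : ℝ} {f : Pol m} {B : ℝ} (h : BdOn L f B) (c : ℂ) :
    BdOn L (c • f) (‖c‖ * B) := fun x h1 h2 => by
  rw [smul_eval, norm_mul]
  exact mul_le_mul_of_nonneg_left (h x h1 h2) (norm_nonneg _)

lemma BddOp.mul {L D D' : ℝ} {A A' : Module.End ℂ (Pol m)} (hD' : 0 ≤ D')
    (h : BddOp L D A) (h' : BddOp L D' A') : BddOp L (D * D') (A * A') := fun f B hB hf => by
  rw [mul_assoc]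
  exact h _ _ (mul_nonneg hD' hB) (h' f B hB hf)

lemma BddOp.add {L D D' : ℝ} {A A' : Module.End ℂ (Pol m)}
    (h : BddOp L D A) (h' : BddOp L D' A') : BddOp L (D + D') (A + A') := fun f B hB hf => by
  rw [add_mul]
  exact (h _ _ hB hf).add (h' f B hB hf)

lemma BddOp.smul {L D : ℝ} {A : Module.End ℂ (Pol m)} (h : BddOp L D A) (c : ℂ) :
    BddOp L (‖c‖ * D) (c • A) := fun f B hB hf => by
  rw [mul_assoc]
  exact (h _ _ hB hf).smul c

lemma BddOp.one (L : ℝ) : BddOp (m := m) L 1 1 := fun f B _ hf => by rwa [one_mul]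

lemma bddOp_heckeT (t : ℂ) {L : ℝ} (hL : 0 ≤ L) (i : Fin m) :
    BddOp L ((‖t - 1‖ + 1 + ‖t‖) * L) (heckeT t i) := fun f B hB hf x h1 h2 => by
  have hne : i.castSucc ≠ i.succ := Fin.castSucc_lt_succ.ne
  have hd := h2 _ _ hne
  have hx : x i.castSucc ≠ x i.succ := fun h => by
    rw [h, sub_self, norm_zero] at hd; linarith
  have hf2 : ‖eval (x ∘ sw i) f‖ ≤ B :=
    hf _ (fun j => h1 _) fun j k hjk => h2 _ _ fun h => hjk ((sw i).injective h)
  have hdiv : ∀ z : ℂ, ‖z / (x i.castSucc - x i.succ)‖ ≤ ‖z‖ := fun z => by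
    rw [norm_div]; exact div_le_self (norm_nonneg _) hd
  rw [eval_heckeT t i hx]
  refine (norm_add_le _ _).trans ?_
  rw [norm_mul, norm_mul]
  have e1 : ‖(t - 1) * x i.castSucc / (x i.castSucc - x i.succ)‖ ≤ ‖t - 1‖ * L :=
    (hdiv _).trans (by rw [norm_mul]; exact mul_le_mul_of_nonneg_left (h1 _) (norm_nonneg _))
  have e2 : ‖(x i.castSucc - t * x i.succ) / (x i.castSucc - x i.succ)‖ ≤ L + ‖t‖ * L :=
    (hdiv _).trans ((norm_sub_le _ _).trans (add_le_add (h1 _) (by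
      rw [norm_mul]; exact mul_le_mul_of_nonneg_left (h1 _) (norm_nonneg _))))
  calc _ ≤ (‖t - 1‖ * L) * B + (L + ‖t‖ * L) * B :=
        add_le_add (mul_le_mul e1 (hf x h1 h2) (norm_nonneg _) (by positivity))
          (mul_le_mul e2 hf2 (norm_nonneg _) (by positivity))
    _ = _ := by ring

lemma exists_bddOp_heckeTinv (t : ℂ) {L : ℝ} (hL : 0 ≤ L) (i : Fin m) :
    ∃ D, 0 ≤ D ∧ BddOp L D (heckeTinv t i) := by
  have h := ((bddOp_heckeT t hL i).add ((BddOp.one L).smul (-(t - 1)))).smul t⁻¹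
  have e : heckeTinv t i = t⁻¹ • (heckeT t i + (-(t - 1)) • (1 : Module.End ℂ (Pol m))) := by
    rw [heckeTinv]; module
  rw [← e] at h
  exact ⟨_, by positivity, h⟩

lemma exists_bddOp_cyc (t : ℂ) {L : ℝ} (hL : 0 ≤ L) (k : Fin (m + 1)) :
    ∃ D, 0 ≤ D ∧ BddOp L D (cyc t k) := by
  induction k using Fin.induction with
  | zero => exact ⟨1, zero_le_one, BddOp.one L⟩
  | succ i ih =>
    obtain ⟨D, hD, h⟩ := ih
    exact ⟨_, by positivity, (bddOp_heckeT t hL i).mul hD h⟩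

lemma exists_bddOp_cycInv (t : ℂ) {L : ℝ} (hL : 0 ≤ L) (k : Fin (m + 1)) :
    ∃ D, 0 ≤ D ∧ BddOp L D (cycInv t k) := by
  induction k using Fin.induction with
  | zero => exact ⟨1, zero_le_one, BddOp.one L⟩
  | succ i ih =>
    obtain ⟨D, hD, h⟩ := ih
    obtain ⟨D', hD', h'⟩ := exists_bddOp_heckeTinv t hL i
    exact ⟨_, by positivity, h'.mul hD h⟩

lemma bddOp_X {L : ℝ} (hL : 0 ≤ L) (i : Fin (m + 1)) : BddOp L L (mulOp (X i)) :=
  fun f B hB hf x h1 h2 => by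
    have : mulOp (X i) f = X i * f := rfl
    rw [this, map_mul, eval_X, norm_mul]
    exact mul_le_mul (h1 i) (hf x h1 h2) (norm_nonneg _) hL

/-- Growth of a family satisfying the intertwiner recursions. -/
lemma exists_family_bound (P : Params q t) {f : (Fin (m + 1) → ℕ) → Pol m} (h0 : f 0 = 1)
    {A A' : Module.End ℂ (Pol m)} {L : ℝ} (hL : 0 ≤ L)
    (hA : ∃ D, 0 ≤ D ∧ BddOp L D A) (hA' : ∃ D, 0 ≤ D ∧ BddOp L D A')
    (hPhi : ∀ u, f (Phi u) = (1 - q * spec q t u 0)⁻¹ • (A (f u) + spec q t u 0 • A' (f u)))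
    (hT : ∀ w i, heckeT t i (f w) = alp q t w i • f w + gam q t (w ∘ sw i) i • f (w ∘ sw i)) :
    ∃ C : ℝ, 1 ≤ C ∧ ∀ u, BdOn L (f u) (C ^ wt u) := by
  obtain ⟨D, hD, hA⟩ := hA
  obtain ⟨D', hD', hA'⟩ := hA'
  obtain ⟨B, hB, hB1, hB2⟩ := exists_structure_bound P m
  have hB0 : 0 ≤ B := by linarith
  set T : ℝ := (‖t - 1‖ + 1 + ‖t‖) * L with hTdef
  have hT0 : 0 ≤ T := by positivity
  set C : ℝ := 1 + B * (D + B * D') + B * (T + B) with hC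
  have hC1 : 1 ≤ C := by
    have : 0 ≤ B * (D + B * D') + B * (T + B) := by positivity
    linarith
  refine ⟨C ^ (m + 1), one_le_pow₀ hC1, fun u => ?_⟩
  rw [← pow_mul]
  refine growth (Q := fun u B => BdOn L (f u) B) (fun u B B' h h' => h'.mono h) hC1 ?_ ?_ ?_ u
  · intro x _ _
    simp [h0]
  · intro u K hK h
    show BdOn L (f (Phi u)) (C * K)
    rw [hPhi]
    refine ((((hA _ _ hK h).add ((hA' _ _ hK h).smul _)).smul _)).mono ?_
    obtain ⟨e1, _, e3⟩ := hB1 u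
    calc _ ≤ B * (D * K + B * (D' * K)) := by gcongr
      _ = B * (D + B * D') * K := by ring
      _ ≤ C * K := mul_le_mul_of_nonneg_right (by
        have : 0 ≤ B * (T + B) := by positivity
        linarith) hK
  · intro u p hp hz K hK h
    have hne : u p.castSucc ≠ u p.succ := by rw [hz _ Fin.castSucc_lt_succ]; exact hp
    obtain ⟨_, e2, e3, _⟩ := hB2 u p hp hz
    have h1 := hT (u ∘ sw p) p
    rw [comp_sw_sw] at h1
    have h2 : f u = (gam q t u p)⁻¹ • (heckeT t p (f (u ∘ sw p)) +
        (-alp q t (u ∘ sw p) p) • f (u ∘ sw p)) := by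
      rw [h1, add_right_comm, ← add_smul, add_neg_cancel, zero_smul, zero_add, smul_smul,
        inv_mul_cancel₀ (gam_ne_zero P hne), one_smul]
    show BdOn L (f u) (C * K)
    rw [h2]
    refine (((bddOp_heckeT t hL p _ _ hK h).add (h.smul _)).smul _).mono ?_
    rw [norm_neg]
    calc _ ≤ B * (T * K + B * K) := by gcongr
      _ = B * (T + B) * K := by ring
      _ ≤ C * K := mul_le_mul_of_nonneg_right (by
        have : 0 ≤ B * (D + B * D') := by positivity
        linarith) hK

lemma MM_bound (P : Params q t) (hM : IsInterpFamily q t M) {L : ℝ} (hL : 0 ≤ L) :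
    ∃ C : ℝ, 1 ≤ C ∧ ∀ u, BdOn L (MM q t M u) (C ^ wt u) := by
  obtain ⟨D, hD, h⟩ := exists_bddOp_cyc (m := m) t hL (Fin.last m)
  obtain ⟨D', hD', h'⟩ := exists_bddOp_cycInv (m := m) t hL (Fin.last m)
  refine exists_family_bound P (f := MM q t M) (MM_zero hM)
    (A := mulOp (X (Fin.last m)) * cyc t (Fin.last m))
    (A' := (-t ^ m) • cycInv t (Fin.last m)) hL ⟨_, by positivity, (bddOp_X hL _).mul hD h⟩
    ⟨_, by positivity, h'.smul _⟩ (fun u => ?_) fun w i => ?_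
  · have hs := spec_ne_zero P u 0
    have e : (mulOp (X (Fin.last m)) * cyc t (Fin.last m) : Module.End ℂ (Pol m)) (MM q t M u) =
      X (Fin.last m) * cyc t (Fin.last m) (MM q t M u) := rfl
    rw [MM_Phi P hM, knop_MM P hM, e, LinearMap.smul_apply, ← smul_eq_C_mul, ← smul_eq_C_mul,
      ← smul_eq_C_mul, div_eq_inv_mul, ← smul_smul, smul_sub (spec q t u 0), smul_smul,
      mul_inv_cancel₀ hs]
    module
  · rw [heckeT_MM P hM, ← smul_eq_C_mul, ← smul_eq_C_mul]

lemma TE_bound (P : Params q t) (hM : IsInterpFamily q t M) {L : ℝ} (hL : 0 ≤ L) :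
    ∃ C : ℝ, 1 ≤ C ∧ ∀ u, BdOn L (TE q t M u) (C ^ wt u) := by
  obtain ⟨D, hD, h⟩ := exists_bddOp_cyc (m := m) t hL (Fin.last m)
  refine exists_family_bound P (f := TE q t M) (TE_zero hM)
    (A := mulOp (X (Fin.last m)) * cyc t (Fin.last m))
    (A' := 0) hL ⟨_, by positivity, (bddOp_X hL _).mul hD h⟩
    ⟨0, le_rfl, fun f B _ _ x _ _ => by simp⟩ (fun u => ?_) fun w i => heckeT_TE P hM w i
  have e : (mulOp (X (Fin.last m)) * cyc t (Fin.last m) : Module.End ℂ (Pol m)) (TE q t M u) =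
    X (Fin.last m) * cyc t (Fin.last m) (TE q t M u) := rfl
  rw [TE_Phi P hM, e, ← knop_TE P hM, LinearMap.zero_apply, smul_zero, add_zero, mul_smul_comm,
    smul_smul, div_eq_inv_mul, smul_eq_C_mul]

lemma norm_eval_le_of_torus {f : Pol m} {r : Fin (m + 1) → ℝ} (hr : ∀ i, 0 < r i) {B : ℝ}
    (h : ∀ x : Fin (m + 1) → ℂ, (∀ i, ‖x i‖ = r i) → ‖eval x f‖ ≤ B) (x : Fin (m + 1) → ℂ)
    (hx : ∀ i, ‖x i‖ ≤ r i) : ‖eval x f‖ ≤ B := by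
  have key : ∀ s : Finset (Fin (m + 1)), ∀ x : Fin (m + 1) → ℂ, (∀ i ∈ s, ‖x i‖ ≤ r i) →
      (∀ i ∉ s, ‖x i‖ = r i) → ‖eval x f‖ ≤ B := by
    intro s
    induction s using Finset.induction_on with
    | empty => exact fun x _ h2 => h x fun i => h2 i (Finset.notMem_empty i)
    | insert a s ha ih =>
      intro x h1 h2
      have hd : Differentiable ℂ fun z : ℂ => eval (Function.update x a z) f := by
        have : ∀ g : Pol m, Differentiable ℂ fun z : ℂ => eval (Function.update x a z) g := by
          intro g
          induction g using MvPolynomial.induction_on with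
          | C c => simp
          | add p q hp hq => simp only [map_add]; exact hp.fun_add hq
          | mul_X p i hp =>
            simp only [map_mul, eval_X]
            refine hp.mul ?_
            by_cases hi : i = a
            · subst hi; simp only [Function.update_self]; exact differentiable_id
            · simp only [Function.update_of_ne hi]; exact differentiable_const _
        exact this f
      have := Complex.norm_le_of_forall_mem_frontier_norm_le (U := Metric.ball 0 (r a))
        Metric.isBounded_ball hd.diffContOnCl (C := B) (fun z hz => ?_) (z := x a) ?_
      · simpa using this
      · rw [frontier_ball _ (hr a).ne', mem_sphere_zero_iff_norm] at hz
        refine ih _ (fun i hi => ?_) fun i hi => ?_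
        · rw [Function.update_of_ne (ne_of_mem_of_not_mem hi ha)]
          exact h1 i (Finset.mem_insert_of_mem hi)
        · by_cases hia : i = a
          · subst hia; rw [Function.update_self, hz]
          · rw [Function.update_of_ne hia]
            exact h2 i fun h => (Finset.mem_insert.1 h).elim hia hi
      · rw [closure_ball _ (hr a).ne', mem_closedBall_zero_iff]
        exact h1 a (Finset.mem_insert_self _ _)
  exact key Finset.univ x (fun i _ => hx i) fun i hi => absurd (Finset.mem_univ i) hi

lemma BdOn.polydisc {R : ℝ} (hR : 1 ≤ R) {f : Pol m} {B : ℝ} (h : BdOn ((m + 1) * R) f B)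
    (x : Fin (m + 1) → ℂ) (hx : ∀ i, ‖x i‖ ≤ R) : ‖eval x f‖ ≤ B := by
  refine norm_eval_le_of_torus (r := fun i => ((i : ℕ) + 1) * R) (fun i => by positivity)
    (fun y hy => h y (fun i => ?_) fun i j hij => ?_) x fun i => (hx i).trans ?_
  · rw [hy]
    have : ((i : ℕ) : ℝ) ≤ m := by exact_mod_cast Nat.lt_succ_iff.1 i.is_lt
    exact mul_le_mul_of_nonneg_right (by linarith) (by linarith)
  · refine le_trans ?_ (abs_norm_sub_norm_le (y i) (y j))
    rw [hy, hy, ← sub_mul, abs_mul, abs_of_nonneg (show (0 : ℝ) ≤ R by linarith)]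
    have : (1 : ℝ) ≤ |((i : ℕ) + 1 : ℝ) - ((j : ℕ) + 1)| := by
      have hij' : ((i : ℕ) : ℤ) - (j : ℕ) ≠ 0 := fun h => hij (Fin.ext (by omega))
      have := Int.one_le_abs hij'
      have h2 : ((1 : ℤ) : ℝ) ≤ ((|((i : ℕ) : ℤ) - (j : ℕ)| : ℤ) : ℝ) := Int.cast_le.2 this
      push_cast at h2
      rwa [add_sub_add_right_eq_sub]
    nlinarith
  · have : (0 : ℝ) ≤ ((i : ℕ) : ℝ) := Nat.cast_nonneg _
    nlinarith

lemma MM_eval_bound (P : Params q t) (hM : IsInterpFamily q t M) (y : Fin (m + 1) → ℂ) :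
    ∃ C : ℝ, 1 ≤ C ∧ ∀ u, ‖eval y (MM q t M u)‖ ≤ C ^ wt u := by
  set R : ℝ := 1 + ∑ i, ‖y i‖ with hR
  have hs : 0 ≤ ∑ i, ‖y i‖ := Finset.sum_nonneg fun i _ => norm_nonneg _
  obtain ⟨C, hC, h⟩ := MM_bound P hM (L := (m + 1) * R) (by positivity)
  refine ⟨C, hC, fun u => (h u).polydisc (by linarith) y fun i => ?_⟩
  have := Finset.single_le_sum (f := fun i => ‖y i‖) (fun i _ => norm_nonneg _) (Finset.mem_univ i)
  linarith

lemma TE_eval_bound (P : Params q t) (hM : IsInterpFamily q t M) :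
    ∃ C : ℝ, 1 ≤ C ∧ ∀ (δ : ℝ), 0 < δ → ∀ (u) (x : Fin (m + 1) → ℂ), (∀ i, ‖x i‖ ≤ δ) →
      ‖eval x (TE q t M u)‖ ≤ (δ * C) ^ wt u := by
  obtain ⟨C, hC, h⟩ := TE_bound P hM (L := (m + 1) * 1) (by positivity)
  refine ⟨C, hC, fun δ hδ u x hx => ?_⟩
  have hδ' : (δ : ℂ) ≠ 0 := by exact_mod_cast hδ.ne'
  have h1 := (h u).polydisc le_rfl (fun i => (δ : ℂ)⁻¹ * x i) fun i => by
    rw [norm_mul, norm_inv, Complex.norm_real, Real.norm_of_nonneg hδ.le]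
    exact inv_mul_le_one_of_le₀ (hx i) hδ.le
  have h2 : eval x (TE q t M u) = (δ : ℂ) ^ wt u *
      eval (fun i => (δ : ℂ)⁻¹ * x i) (TE q t M u) := by
    rw [← eval_scl, scl_TE, smul_eval, ← mul_assoc, ← mul_pow, mul_inv_cancel₀ hδ', one_pow,
      one_mul]
  rw [h2, norm_mul, norm_pow, Complex.norm_real, Real.norm_of_nonneg hδ.le, mul_pow]
  exact mul_le_mul_of_nonneg_left h1 (by positivity)

end

section
variable {m : ℕ} {q t : ℂ} {M : (Fin (m + 1) → ℕ) → Pol m}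

/-- Functions of a composition growing at most exponentially in the weight. -/
def ExpBdd (f : (Fin (m + 1) → ℕ) → ℂ) : Prop :=
  ∃ K C : ℝ, 0 ≤ K ∧ 1 ≤ C ∧ ∀ u, ‖f u‖ ≤ K * C ^ wt u

namespace ExpBdd
variable {f g : (Fin (m + 1) → ℕ) → ℂ}

lemma of_le {C : ℝ} (hC : 1 ≤ C) (h : ∀ u, ‖f u‖ ≤ C ^ wt u) : ExpBdd f :=
  ⟨1, C, zero_le_one, hC, fun u => by rw [one_mul]; exact h u⟩

lemma mono (hf : ExpBdd f) (h : ∀ u, ‖g u‖ ≤ ‖f u‖) : ExpBdd g := by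
  obtain ⟨K, C, hK, hC, hf⟩ := hf
  exact ⟨K, C, hK, hC, fun u => (h u).trans (hf u)⟩

lemma const (c : ℂ) : ExpBdd fun _ : Fin (m + 1) → ℕ => c :=
  ⟨‖c‖, 1, norm_nonneg _, le_rfl, fun u => by simp⟩

lemma mul (hf : ExpBdd f) (hg : ExpBdd g) : ExpBdd fun u => f u * g u := by
  obtain ⟨K, C, hK, hC, hf⟩ := hf
  obtain ⟨K', C', hK', hC', hg⟩ := hg
  refine ⟨K * K', C * C', by positivity, one_le_mul_of_one_le_of_one_le hC hC', fun u => ?_⟩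
  calc _ ≤ (K * C ^ wt u) * (K' * C' ^ wt u) := by
        rw [norm_mul]
        exact mul_le_mul (hf u) (hg u) (norm_nonneg _) (by positivity)
    _ = _ := by rw [mul_pow]; ring

lemma add (hf : ExpBdd f) (hg : ExpBdd g) : ExpBdd fun u => f u + g u := by
  obtain ⟨K, C, hK, hC, hf⟩ := hf
  obtain ⟨K', C', hK', hC', hg⟩ := hg
  refine ⟨K + K', C + C', by positivity, by linarith, fun u => ?_⟩
  calc _ ≤ K * C ^ wt u + K' * C' ^ wt u := (norm_add_le _ _).trans (add_le_add (hf u) (hg u))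
    _ ≤ K * (C + C') ^ wt u + K' * (C + C') ^ wt u := by gcongr <;> linarith
    _ = _ := by ring

lemma sum {ι : Type*} (s : Finset ι) {F : ι → (Fin (m + 1) → ℕ) → ℂ}
    (h : ∀ i ∈ s, ExpBdd (F i)) : ExpBdd fun u => ∑ i ∈ s, F i u := by
  classical
  induction s using Finset.induction_on with
  | empty => simpa using const 0
  | insert a s ha ih =>
    simp only [Finset.sum_insert ha]
    exact (h a (Finset.mem_insert_self _ _)).add
      (ih fun i hi => h i (Finset.mem_insert_of_mem hi))

lemma pow_wt (c : ℂ) : ExpBdd fun u : Fin (m + 1) → ℕ => c ^ wt u :=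
  of_le (C := 1 + ‖c‖) (by linarith [norm_nonneg c]) fun u => by
    rw [norm_pow]
    exact pow_le_pow_left₀ (norm_nonneg _) (by linarith) _

lemma prod_cells {F : ℕ → ℕ → ℂ} {l : ℕ → ℂ}
    (hF : ∀ k, Filter.Tendsto (F k) Filter.atTop (nhds (l k))) :
    ExpBdd fun u : Fin (m + 1) → ℕ => ∏ i, ∏ j ∈ Finset.range (u i), F (lp u i) j := by
  obtain ⟨B, hB, h⟩ := exists_uniform_bound (ι := Fin (m + 1)) (F := fun i a => F i a) fun i =>
    exists_bound_of_tendsto (hF i)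
  refine of_le hB fun u => ?_
  rw [norm_prod, wt, ← Finset.prod_pow_eq_pow_sum]
  refine Finset.prod_le_prod (fun _ _ => norm_nonneg _) fun i _ => ?_
  rw [norm_prod]
  refine (Finset.prod_le_prod (g := fun _ => B) (fun _ _ => norm_nonneg _) fun j _ => ?_).trans_eq
    (by rw [Finset.prod_const, Finset.card_range])
  have := lp_add_mp u i
  exact h ⟨lp u i, by omega⟩ j

end ExpBdd

lemma tendsto_cell (P : Params q t) (z : ℂ) (k : ℕ) :
    Filter.Tendsto (fun j : ℕ => 1 - z * q ^ j / t ^ k) Filter.atTop (nhds 1) := by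
  simpa using ((P.tendsto_pow.const_mul z).div_const (t ^ k)).const_sub 1

lemma expBdd_qfac (P : Params q t) (z : ℂ) :
    ExpBdd fun u : Fin (m + 1) → ℕ => qfac q t z u :=
  ExpBdd.prod_cells (F := fun k j => 1 - z * q ^ j / t ^ k) fun k => tendsto_cell P z k

lemma expBdd_qfac_inv (P : Params q t) (z : ℂ) :
    ExpBdd fun u : Fin (m + 1) → ℕ => (qfac q t z u)⁻¹ := by
  simp only [qfac, ← Finset.prod_inv_distrib]
  exact ExpBdd.prod_cells (F := fun k j => (1 - z * q ^ j / t ^ k)⁻¹) fun k =>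
    (tendsto_cell P z k).inv₀ one_ne_zero

lemma expBdd_hev_inv (P : Params q t) (hM : IsInterpFamily q t M) :
    ExpBdd fun u => (hev q t M u)⁻¹ := by
  obtain ⟨B, hB, hB1, hB2⟩ := exists_structure_bound P m
  have hB0 : 0 ≤ B := by linarith
  set C : ℝ := B * B * (1 + ‖(t ^ m)⁻¹‖) with hC
  have hBB : 1 ≤ B * B := one_le_mul_of_one_le_of_one_le hB hB
  have hBC : B * B ≤ C :=
    le_mul_of_one_le_right (by linarith) (by linarith [norm_nonneg (t ^ m)⁻¹])
  have hC1 : 1 ≤ C := hBB.trans hBC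
  refine ExpBdd.of_le (one_le_pow₀ (n := m + 1) hC1) fun u => ?_
  rw [← pow_mul]
  refine growth (Q := fun u B => ‖(hev q t M u)⁻¹‖ ≤ B) (fun u B B' h h' => h'.trans h) hC1
    (by simp [hev, TE_zero hM]) (fun u K hK h => ?_) (fun u p hp hz K hK h => ?_) u
  · have e : (hev q t M (Phi u))⁻¹ =
        (1 - q * spec q t u 0) * (t ^ m)⁻¹ * (hev q t M u)⁻¹ := by
      have h1 := hev_Phi P hM u
      have h2 := hev_ne_zero P hM u
      have h3 := hev_ne_zero P hM (Phi u)
      have h4 := pow_ne_zero m P.t_ne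
      field_simp
      linear_combination -h1
    rw [e, norm_mul, norm_mul]
    refine mul_le_mul ?_ h (norm_nonneg _) (by linarith)
    calc _ ≤ B * ‖(t ^ m)⁻¹‖ := mul_le_mul_of_nonneg_right (hB1 u).2.1 (norm_nonneg _)
      _ ≤ B * B * ‖(t ^ m)⁻¹‖ :=
        mul_le_mul_of_nonneg_right (le_mul_of_one_le_left hB0 hB) (norm_nonneg _)
      _ ≤ C := mul_le_mul_of_nonneg_left (by linarith) (by linarith)
  · have hne : u p.castSucc ≠ u p.succ := by rw [hz _ Fin.castSucc_lt_succ]; exact hp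
    obtain ⟨e1, _, _, e4⟩ := hB2 u p hp hz
    have e : (hev q t M u)⁻¹ =
        gam q t u p * (gam q t (u ∘ sw p) p)⁻¹ * (hev q t M (u ∘ sw p))⁻¹ := by
      rw [mul_assoc, ← mul_inv, hev_comp_sw P hM, mul_inv,
        mul_inv_cancel_left₀ (gam_ne_zero P hne)]
    rw [e, norm_mul, norm_mul]
    exact mul_le_mul ((mul_le_mul e1 e4 (norm_nonneg _) hB0).trans hBC) h (norm_nonneg _)
      (by linarith)

lemma expBdd_connection (P : Params q t) (hM : IsInterpFamily q t M) {a b : ℂ} (hb : b ≠ 0)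
    {cc : (Fin (m + 1) → ℕ) → (Fin (m + 1) → ℕ) → ℂ} (h : IsConnection q t M a b cc)
    (w : Fin (m + 1) → ℕ) : ExpBdd fun u => cc u w := by
  induction hN : wt w using Nat.strong_induction_on generalizing w with
  | _ N ih =>
  set S := (compsLE (m + 1) (wt w)).filter fun v => wt v < wt w with hS
  obtain ⟨C, hC, hCM⟩ := MM_eval_bound P hM fun i => a * (b⁻¹ * spec q t w i)
  have h1 : ExpBdd fun u => eval (fun i => a * (b⁻¹ * spec q t w i)) (MM q t M u) :=
    ExpBdd.of_le hC hCM
  have h2 : ExpBdd fun u => ∑ v ∈ S, cc u v * eval (spec q t w) (MM q t M v) :=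
    ExpBdd.sum S fun v hv => (ih (wt v) (by rw [← hN]; exact (Finset.mem_filter.1 hv).2) v rfl).mul
      (ExpBdd.const _)
  refine ((ExpBdd.const (zet q t M w)⁻¹).mul (h1.add ((ExpBdd.const (-1)).mul h2))).mono fun u => ?_
  rcases lt_or_ge (wt u) (wt w) with hlt | hle
  · rw [h.1 u w hlt, norm_zero]
    exact norm_nonneg _
  refine le_of_eq (congrArg _ ?_)
  have hb' : (fun i => b * (b⁻¹ * spec q t w i)) = spec q t w :=
    funext fun i => mul_inv_cancel_left₀ hb _
  have e := congrArg (eval fun i => b⁻¹ * spec q t w i) (connection_sum h u)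
  simp only [map_sum, smul_eval, eval_scl, hb'] at e
  have hw : w ∉ S := fun hw => lt_irrefl _ (Finset.mem_filter.1 hw).2
  rw [← Finset.sum_subset (s₁ := insert w S) (fun v hv => ?_) fun v _ hv => ?_,
    Finset.sum_insert hw] at e
  · rw [e, zet]
    have := zet_ne_zero P hM w
    rw [zet] at this
    field_simp
    ring
  · rcases Finset.mem_insert.1 hv with rfl | hv
    · exact mem_compsLE.2 hle
    · exact mem_compsLE.2 ((Finset.mem_filter.1 hv).2.le.trans hle)
  · rw [Finset.mem_insert, not_or] at hv
    have hwv : wt w ≤ wt v := not_lt.1 fun hlt =>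
      hv.2 (Finset.mem_filter.2 ⟨mem_compsLE.2 hlt.le, hlt⟩)
    rw [eval_MM_of_ne hM hwv (Ne.symm hv.1), mul_zero]

lemma expBdd_series (P : Params q t) (hM : IsInterpFamily q t M) {b c : ℂ} (hc : c ≠ 0)
    {cc : (Fin (m + 1) → ℕ) → (Fin (m + 1) → ℕ) → ℂ} (h : IsConnection q t M b c cc)
    (a : ℂ) (v : Fin (m + 1) → ℕ) :
    ExpBdd fun u => qfac q t a u / qfac q t c u * smat q t M b c cc u v := by
  simp only [smat, div_eq_mul_inv]
  exact ((expBdd_qfac P a).mul (expBdd_qfac_inv P c)).mul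
    (((((ExpBdd.pow_wt c).mul (ExpBdd.const _)).mul (expBdd_connection P hM hc h v)).mul
      (ExpBdd.const _)).mul (expBdd_hev_inv P hM))

lemma summable_pow_wt {r : ℝ} (h0 : 0 ≤ r) (h1 : r < 1) :
    Summable fun u : Fin (m + 1) → ℕ => r ^ wt u := by
  have hpos : 0 ≤ (1 - r)⁻¹ := inv_nonneg.2 (by linarith)
  refine summable_of_sum_le (c := (1 - r)⁻¹ ^ (m + 1)) (fun u => by positivity) fun s => ?_
  have hsub : s ⊆ Fintype.piFinset fun _ => Finset.range (s.sup wt + 1) := fun u hu => by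
    rw [Fintype.mem_piFinset]
    intro i
    rw [Finset.mem_range, Nat.lt_succ_iff]
    exact (Finset.single_le_sum (f := u) (fun _ _ => Nat.zero_le _) (Finset.mem_univ i)).trans
      (Finset.le_sup (f := wt) hu)
  refine (Finset.sum_le_sum_of_subset_of_nonneg hsub fun _ _ _ => by positivity).trans ?_
  simp only [wt, ← Finset.prod_pow_eq_pow_sum]
  rw [← Finset.prod_univ_sum (fun _ => Finset.range (s.sup wt + 1)) fun _ j => r ^ j,
    Finset.prod_const, Finset.card_univ, Fintype.card_fin]
  refine pow_le_pow_left₀ (Finset.sum_nonneg fun _ _ => by positivity) ?_ _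
  rw [← tsum_geometric_of_lt_one h0 h1]
  exact (summable_geometric_of_lt_one h0 h1).sum_le_tsum _ fun _ _ => by positivity

lemma ExpBdd.exists_summable (P : Params q t) (hM : IsInterpFamily q t M)
    {f : (Fin (m + 1) → ℕ) → ℂ} (hf : ExpBdd f) : ∃ ε > 0, ∀ x : Fin (m + 1) → ℂ,
      (∀ i, ‖x i‖ < ε) → Summable fun u => ‖f u * eval x (TE q t M u)‖ := by
  obtain ⟨K, C, hK, hC, hf⟩ := hf
  obtain ⟨D, hD, h⟩ := TE_eval_bound P hM
  have hCD : 0 < C * D := by nlinarith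
  refine ⟨(2 * (C * D))⁻¹, by positivity, fun x hx => ?_⟩
  refine Summable.of_nonneg_of_le (fun _ => norm_nonneg _) (fun u => ?_)
    ((summable_pow_wt (r := 1 / 2) (by norm_num) (by norm_num)).mul_left K)
  rw [norm_mul]
  calc _ ≤ (K * C ^ wt u) * ((2 * (C * D))⁻¹ * D) ^ wt u :=
        mul_le_mul (hf u) (h _ (by positivity) u x fun i => (hx i).le) (norm_nonneg _)
          (by positivity)
    _ = K * (1 / 2) ^ wt u := by
        rw [mul_assoc, ← mul_pow]
        congr 2
        have : D ≠ 0 := by linarith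
        field_simp

lemma tsum_eq_tsum_comps {f : (Fin (m + 1) → ℕ) → ℂ} (hf : Summable fun u => ‖f u‖) :
    (Summable fun N => ‖∑ u ∈ comps (m + 1) N, f u‖) ∧
      ∑' u, f u = ∑' N, ∑ u ∈ comps (m + 1) N, f u := by
  have key : ∀ {E : Type} [NormedAddCommGroup E] [CompleteSpace E] {g : (Fin (m + 1) → ℕ) → E}
      {s : E}, HasSum g s → HasSum (fun N => ∑ u ∈ comps (m + 1) N, g u) s := by
    intro E _ _ g s hg
    convert hg.tsum_fiberwise wt using 2 with N
    rw [← Finset.tsum_subtype (comps (m + 1) N) g]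
    have : (↑(comps (m + 1) N) : Set (Fin (m + 1) → ℕ)) = wt ⁻¹' {N} := by ext u; simp
    exact tsum_congr_set_coe g this
  exact ⟨Summable.of_nonneg_of_le (fun _ => norm_nonneg _) (fun N => norm_sum_le _ _)
    (key hf.hasSum).summable, (key hf.of_norm.hasSum).tsum_eq.symm⟩

end

/-- Power series whose coefficients are absolutely summable. -/
def AbsSum (p : PowerSeries ℂ) : Prop := Summable fun k => ‖PowerSeries.coeff k p‖

/-- The sum of the coefficients of a power series. -/
def csum (p : PowerSeries ℂ) : ℂ := ∑' k, PowerSeries.coeff k p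

lemma AbsSum.mul {f g : PowerSeries ℂ} (hf : AbsSum f) (hg : AbsSum g) : AbsSum (f * g) := by
  simpa only [AbsSum, PowerSeries.coeff_mul] using
    summable_norm_sum_mul_antidiagonal_of_summable_norm hf hg

lemma csum_mul {f g : PowerSeries ℂ} (hf : AbsSum f) (hg : AbsSum g) :
    csum (f * g) = csum f * csum g := by
  simp only [csum, PowerSeries.coeff_mul]
  exact (tsum_mul_tsum_eq_tsum_sum_antidiagonal_of_summable_norm hf hg).symm

lemma hasSum_coeff_linear (c : ℂ) {E : Type} [NormedAddCommGroup E] (F : ℂ → E) (hF : F 0 = 0) :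
    HasSum (fun k => F (PowerSeries.coeff k (1 - PowerSeries.C c * PowerSeries.X)))
      (F 1 + F (-c)) := by
  have h := hasSum_sum_of_ne_finset_zero (s := Finset.range 2)
    (f := fun k => F (PowerSeries.coeff k (1 - PowerSeries.C c * PowerSeries.X)))
    (L := SummationFilter.unconditional ℕ) fun k hk => by
      rw [Finset.mem_range, not_lt] at hk
      obtain ⟨j, rfl⟩ := Nat.exists_eq_add_of_le' hk
      simp [PowerSeries.coeff_one, hF]
  simpa [Finset.sum_range_succ, PowerSeries.coeff_one, PowerSeries.coeff_C_mul,
    PowerSeries.coeff_X] using h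

lemma absSum_linear (c : ℂ) : AbsSum (1 - PowerSeries.C c * PowerSeries.X) :=
  (hasSum_coeff_linear c (fun z => ‖z‖) norm_zero).summable

lemma csum_linear (c : ℂ) : csum (1 - PowerSeries.C c * PowerSeries.X) = 1 - c := by
  rw [csum, (hasSum_coeff_linear c (fun z => z) rfl).tsum_eq, sub_eq_add_neg]

lemma absSum_prod {ι : Type*} (s : Finset ι) {f : ι → PowerSeries ℂ} (h : ∀ i ∈ s, AbsSum (f i)) :
    AbsSum (∏ i ∈ s, f i) ∧ csum (∏ i ∈ s, f i) = ∏ i ∈ s, csum (f i) := by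
  classical
  induction s using Finset.induction_on with
  | empty =>
    have h1 := absSum_linear 0
    have h2 := csum_linear 0
    rw [map_zero, zero_mul, sub_zero] at h1 h2
    rw [sub_zero] at h2
    exact ⟨h1, h2⟩
  | insert a s ha ih =>
    obtain ⟨i1, i2⟩ := ih fun i hi => h i (Finset.mem_insert_of_mem hi)
    have ha' := h a (Finset.mem_insert_self _ _)
    rw [Finset.prod_insert ha, Finset.prod_insert ha]
    exact ⟨ha'.mul i1, by rw [csum_mul ha' i1, i2]⟩

section
variable {q t : ℂ}

lemma exists_absSum_fsr (P : Params q t) (a b : ℂ) :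
    ∃ ε > 0, ∀ z : ℂ, ‖z‖ < ε → AbsSum (fsr a b q z) := by
  have hl : Filter.Tendsto (fun k : ℕ => (a - b * q ^ k) / (1 - q ^ (k + 1))) Filter.atTop
      (nhds ((a - b * 0) / (1 - 0))) :=
    ((P.tendsto_pow.const_mul b).const_sub a).div
      (((Filter.tendsto_add_atTop_iff_nat 1).2 P.tendsto_pow).const_sub 1) (by simp)
  obtain ⟨B, hB⟩ := exists_bound_of_tendsto hl
  have hD : (0 : ℝ) < 1 + |B| := by positivity
  have hp : ∀ k, ‖pco a b q k‖ ≤ (1 + |B|) ^ k := by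
    intro k
    induction k with
    | zero => simp [pco]
    | succ k ih =>
      rw [pco, norm_mul, pow_succ' (1 + |B|)]
      exact mul_le_mul ((hB k).trans (by linarith [le_abs_self B])) ih (norm_nonneg _)
        hD.le
  refine ⟨(1 + |B|)⁻¹, by positivity, fun z hz => ?_⟩
  refine Summable.of_nonneg_of_le (fun _ => norm_nonneg _) (fun k => ?_)
    (summable_geometric_of_lt_one (r := (1 + |B|) * ‖z‖) (by positivity) ?_)
  · rw [coeff_fsr, norm_mul, norm_pow, mul_pow]
    exact mul_le_mul_of_nonneg_right (hp k) (by positivity)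
  · exact (mul_lt_mul_of_pos_left hz hD).trans_eq (mul_inv_cancel₀ hD.ne')

lemma tendsto_qpochInf (P : Params q t) (z : ℂ) : Filter.Tendsto
    (fun N : ℕ => ∏ j ∈ Finset.range N, (1 - z * q ^ j)) Filter.atTop (nhds (qpochInf z q)) := by
  have h : Summable fun j : ℕ => ‖-(z * q ^ j)‖ := by
    simp only [norm_neg, norm_mul, norm_pow]
    exact (summable_geometric_of_lt_one (norm_nonneg _) P.q_lt).mul_left _
  have := (multipliable_one_add_of_summable h).hasProd.tendsto_prod_nat
  simpa only [← sub_eq_add_neg, qpochInf] using this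

lemma csum_fsr_mul (P : Params q t) {a b z : ℂ}
    (h : ∀ N : ℕ, AbsSum (fsr a b q (q ^ N * z))) :
    csum (fsr a b q z) * qpochInf (a * z) q = qpochInf (b * z) q := by
  have hstep : ∀ N : ℕ, csum (fsr a b q z) * ∏ j ∈ Finset.range N, (1 - a * z * q ^ j) =
      csum (fsr a b q (q ^ N * z)) * ∏ j ∈ Finset.range N, (1 - b * z * q ^ j) := by
    intro N
    induction N with
    | zero => simp
    | succ N ih =>
      have e := congrArg csum (fsr_q a b P.one_sub_pow_ne (q ^ N * z))
      have h' := h (N + 1)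
      rw [pow_succ', mul_assoc] at h'
      simp only [Algebra.algebraMap_self, RingHom.id_apply] at e
      rw [csum_mul (h N) (absSum_linear _), csum_mul h' (absSum_linear _), csum_linear,
        csum_linear] at e
      rw [Finset.prod_range_succ, Finset.prod_range_succ, ← mul_assoc, ih, pow_succ' q, mul_assoc q]
      linear_combination (∏ j ∈ Finset.range N, (1 - b * z * q ^ j)) * e
  have hlim : Filter.Tendsto (fun N : ℕ => csum (fsr a b q (q ^ N * z))) Filter.atTop
      (nhds 1) := by
    have h1 : (1 : ℂ) = ∑' k, pco a b q k * 0 ^ k := by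
      rw [tsum_eq_single 0 fun k hk => by rw [zero_pow hk, mul_zero]]
      simp [pco]
    rw [h1]
    have h0 := h 0
    rw [pow_zero, one_mul] at h0
    refine tendsto_tsum_of_dominated_convergence h0 (fun k => ?_) (Filter.Eventually.of_forall
      fun N k => ?_)
    · simp only [coeff_fsr, Algebra.algebraMap_self, RingHom.id_apply]
      refine Filter.Tendsto.const_mul _ (Filter.Tendsto.pow ?_ k)
      simpa using P.tendsto_pow.mul_const z
    · simp only [coeff_fsr, norm_mul, norm_pow, mul_pow]
      have : (‖q‖ ^ N) ^ k ≤ 1 :=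
        pow_le_one₀ (by positivity) (pow_le_one₀ (norm_nonneg _) P.q_lt.le)
      exact mul_le_mul_of_nonneg_left (mul_le_of_le_one_left (by positivity) this) (norm_nonneg _)
  have h1 := (tendsto_qpochInf P (a * z)).const_mul (csum (fsr a b q z))
  have h2 := hlim.mul (tendsto_qpochInf P (b * z))
  simp only [hstep, one_mul] at h1 h2
  exact tendsto_nhds_unique h1 h2

/-- The one variable `q`-binomial theorem. -/
lemma exists_q_binomial (P : Params q t) (a b : ℂ) : ∃ ε > 0, ∀ z : ℂ, ‖z‖ < ε →
    AbsSum (fsr a b q z) ∧ csum (fsr a b q z) = qpochInf (b * z) q / qpochInf (a * z) q := by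
  obtain ⟨ε, hε, h⟩ := exists_absSum_fsr P a b
  obtain ⟨ε', hε', h'⟩ := exists_absSum_fsr P a 0
  have hq : ∀ (N : ℕ) (z : ℂ), ‖q ^ N * z‖ ≤ ‖z‖ := fun N z => by
    rw [norm_mul, norm_pow]
    exact mul_le_of_le_one_left (norm_nonneg _) (pow_le_one₀ (norm_nonneg _) P.q_lt.le)
  refine ⟨min ε ε', lt_min hε hε', fun z hz => ?_⟩
  obtain ⟨hz1, hz2⟩ := lt_min_iff.1 hz
  refine ⟨h z hz1, eq_div_of_mul_eq (fun h0 => ?_)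
    (csum_fsr_mul P fun N => h _ ((hq N z).trans_lt hz1))⟩
  have h1 := csum_fsr_mul P fun N => h' _ ((hq N z).trans_lt hz2)
  rw [h0, mul_zero, zero_mul, qpochInf] at h1
  simp at h1

lemma map_Fser {m : ℕ} (a b : ℂ) (x : Fin (m + 1) → ℂ) :
    PowerSeries.map (eval x) (Fser a b q) = ∏ i, fsr a b q (x i) := by
  rw [Fser, map_prod]
  refine Finset.prod_congr rfl fun i _ => ?_
  have := map_fsr a b q (aeval x : Pol m →ₐ[ℂ] ℂ) (X i)
  rw [aeval_X] at this
  rw [← this]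
  rfl

lemma exists_kernel_sum (P : Params q t) (m : ℕ) (a b : ℂ) : ∃ ε > 0, ∀ x : Fin (m + 1) → ℂ,
    (∀ i, ‖x i‖ < ε) → (Summable fun k => ‖eval x (Fc a b q k)‖) ∧
      ∑' k, eval x (Fc a b q k) = ∏ i, qpochInf (b * x i) q / qpochInf (a * x i) q := by
  obtain ⟨ε, hε, h⟩ := exists_q_binomial P a b
  refine ⟨ε, hε, fun x hx => ?_⟩
  obtain ⟨h1, h2⟩ := absSum_prod Finset.univ fun i _ => (h (x i) (hx i)).1
  have e : ∀ k, eval x (Fc a b q k) = PowerSeries.coeff k (∏ i, fsr a b q (x i)) := fun k => by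
    rw [← map_Fser, PowerSeries.coeff_map, Fc]
  simp only [e]
  exact ⟨h1, h2.trans (Finset.prod_congr rfl fun i _ => (h (x i) (hx i)).2)⟩

end

section
variable {m : ℕ} {q t : ℂ} {M : (Fin (m + 1) → ℕ) → Pol m}

lemma smat_eq_zero {a b : ℂ} {cc : (Fin (m + 1) → ℕ) → (Fin (m + 1) → ℕ) → ℂ}
    (h : IsConnection q t M a b cc) {u v : Fin (m + 1) → ℕ} (huv : wt u < wt v) :
    smat q t M a b cc u v = 0 := by
  rw [smat, h.1 u v huv, mul_zero, zero_mul, zero_div]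

/-- A sum over compositions of weight at least `k`, grouped by weight. -/
lemma tsum_eq_tsum_comps_add {f : (Fin (m + 1) → ℕ) → ℂ} (hf : Summable fun u => ‖f u‖) {k : ℕ}
    (h0 : ∀ u, wt u < k → f u = 0) :
    (Summable fun N => ‖∑ u ∈ comps (m + 1) (k + N), f u‖) ∧
      ∑' u, f u = ∑' N, ∑ u ∈ comps (m + 1) (k + N), f u := by
  obtain ⟨h1, h2⟩ := tsum_eq_tsum_comps hf
  have h3 := h1.of_norm.sum_add_tsum_nat_add k
  rw [Finset.sum_eq_zero fun N hN => Finset.sum_eq_zero fun u hu => h0 u (by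
    rw [mem_comps.1 hu]; exact Finset.mem_range.1 hN), zero_add] at h3
  simp only [Nat.add_comm k]
  exact ⟨(summable_nat_add_iff (f := fun N => ‖∑ u ∈ comps (m + 1) N, f u‖) k).2 h1,
    h2.trans h3.symm⟩

lemma euler_transformation_TE (P : Params q t) (hM : IsInterpFamily q t M) {a b c : ℂ}
    (ha : a ≠ 0) (hb : b ≠ 0) (hc : c ≠ 0) (hcu : ∀ u : Fin (m + 1) → ℕ, qfac q t c u ≠ 0)
    {ccbc ccac : (Fin (m + 1) → ℕ) → (Fin (m + 1) → ℕ) → ℂ}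
    (h1 : IsConnection q t M b c ccbc) (h2 : IsConnection q t M a c ccac)
    (v : Fin (m + 1) → ℕ) : ∃ ε > 0, ∀ x : Fin (m + 1) → ℂ, (∀ i, ‖x i‖ < ε) →
      (Summable fun u => ‖qfac q t a u / qfac q t c u * smat q t M b c ccbc u v *
        eval x (TE q t M u)‖) ∧
      (Summable fun u => ‖qfac q t b u / qfac q t c u * smat q t M a c ccac u v *
        eval x (TE q t M u)‖) ∧
      qfac q t b v * ∑' u, qfac q t a u / qfac q t c u * smat q t M b c ccbc u v *
          eval x (TE q t M u) =
        qfac q t a v * ((∏ i, qpochInf (a * x i) q / qpochInf (b * x i) q) *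
          ∑' u, qfac q t b u / qfac q t c u * smat q t M a c ccac u v *
            eval x (TE q t M u)) := by
  obtain ⟨ε₁, hε₁, H₁⟩ := (expBdd_series P hM hc h1 a v).exists_summable P hM
  obtain ⟨ε₂, hε₂, H₂⟩ := (expBdd_series P hM hc h2 b v).exists_summable P hM
  obtain ⟨ε₃, hε₃, H₃⟩ := exists_kernel_sum P m b a
  refine ⟨min ε₁ (min ε₂ ε₃), lt_min hε₁ (lt_min hε₂ hε₃), fun x hx => ?_⟩
  have S₁ := H₁ x fun i => (lt_min_iff.1 (hx i)).1
  have S₂ := H₂ x fun i => (lt_min_iff.1 (lt_min_iff.1 (hx i)).2).1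
  obtain ⟨S₃, E₃⟩ := H₃ x fun i => (lt_min_iff.1 (lt_min_iff.1 (hx i)).2).2
  refine ⟨S₁, S₂, ?_⟩
  obtain ⟨_, T₁⟩ := tsum_eq_tsum_comps_add (k := wt v) S₁ fun u hu => by
    rw [smat_eq_zero h1 hu, mul_zero, zero_mul]
  obtain ⟨N₂, T₂⟩ := tsum_eq_tsum_comps_add (k := wt v) S₂ fun u hu => by
    rw [smat_eq_zero h2 hu, mul_zero, zero_mul]
  rw [T₁, T₂, ← E₃, tsum_mul_tsum_eq_tsum_sum_antidiagonal_of_summable_norm S₃ N₂,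
    ← tsum_mul_left, ← tsum_mul_left]
  refine tsum_congr fun N => ?_
  simp only [mul_assoc (_ / _)]
  exact graded_identity P hM ha hb hc hcu h1 h2 v x N

end

/-- **sl_n q-Euler transformation** (Corollary 8.3). -/
theorem sln_q_euler_transformation
    (hn : 0 < n) (q t : ℂ) (hq0 : q ≠ 0) (hq1 : ‖q‖ < 1) (ht : t ≠ 0)
    (hqt : ∀ i j : ℤ, ¬(i = 0 ∧ j = 0) → q ^ i * t ^ j ≠ 1)
    (M : (Fin n → ℕ) → MvPolynomial (Fin n) ℂ) (hM : IsInterpFamily q t M)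
    (v : Fin n → ℕ) (a b c : ℂ) (ha : a ≠ 0) (hb : b ≠ 0) (hc : c ≠ 0)
    (hcu : ∀ u : Fin n → ℕ, qfac q t c u ≠ 0) (hbv : qfac q t b v ≠ 0)
    (ccbc ccac : (Fin n → ℕ) → (Fin n → ℕ) → ℂ)
    (h1 : IsConnection q t M b c ccbc) (h2 : IsConnection q t M a c ccac) :
    ∃ ε > 0, ∀ x : Fin n → ℂ, (∀ i, ‖x i‖ < ε) →
      Summable (fun u : Fin n → ℕ =>
        ‖qfac q t a u / qfac q t c u * skew q t M b c ccbc u v *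
          eval x (EE q t M u)‖) ∧
      Summable (fun u : Fin n → ℕ =>
        ‖qfac q t b u / qfac q t c u * skew q t M a c ccac u v *
          eval x (EE q t M u)‖) ∧
      ∑' u : Fin n → ℕ, qfac q t a u / qfac q t c u * skew q t M b c ccbc u v *
          eval x (EE q t M u) =
        qfac q t a v / qfac q t b v *
          (∏ i, qpochInf (a * x i) q / qpochInf (b * x i) q) *
          ∑' u : Fin n → ℕ, qfac q t b u / qfac q t c u *
            skew q t M a c ccac u v * eval x (EE q t M u) := by
  obtain ⟨m, rfl⟩ := Nat.exists_eq_succ_of_ne_zero hn.ne'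
  have P : Params q t := ⟨hq0, hq1, ht, hqt⟩
  obtain ⟨ε, hε, H⟩ := euler_transformation_TE P hM ha hb hc hcu h1 h2 v
  refine ⟨ε, hε, fun x hx => ?_⟩
  obtain ⟨S₁, S₂, E⟩ := H x hx
  have e : ∀ {b : ℂ} (d : ℂ) (cc : (Fin (m + 1) → ℕ) → (Fin (m + 1) → ℕ) → ℂ)
      (u : Fin (m + 1) → ℕ), d * skew q t M b c cc u v * eval x (EE q t M u) =
        (q ^ nstat' v)⁻¹ * (d * smat q t M b c cc u v * eval x (TE q t M u)) :=
    fun d cc u => by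
      rw [mul_assoc, skew_mul_EE P hM hc]
      ring
  simp only [e]
  refine ⟨?_, ?_, ?_⟩
  · simpa only [norm_mul] using S₁.mul_left ‖(q ^ nstat' v)⁻¹‖
  · simpa only [norm_mul] using S₂.mul_left ‖(q ^ nstat' v)⁻¹‖
  · rw [tsum_mul_left, tsum_mul_left, div_mul_eq_mul_div, div_mul_eq_mul_div, eq_div_iff hbv]
    linear_combination (q ^ nstat' v)⁻¹ * E

end LRW
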